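/- There exists a function ε : (0,∞) → (0,∞) with the property that for every α ∈ (0, 1/6), ε(δ)/δ^{1/6−α} → 0 as δ → 0⁺, such that the following holds for every n ≥ 1 and every δ > 0: if X is an n×n complex matrix with ‖X‖ ≤ 1, X*X ≥ (1/4)I (that is, (1/2)I ≤ |X| ≤ I where |X| = (X*X)^{1/2}), and ‖[X*, X]‖ ≤ δ, then there exists a normal n×n matrix X′ with ‖X′‖ ≤ 1, X′*X′ ≥ (1/4)I, and ‖X − X′‖ ≤ ε(δ). The function ε does not depend on the dimension n. -/

import Mathlib

open Matrix
open scoped ComplexOrder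

noncomputable section

namespace AC

variable {m : Type*} [Fintype m] [DecidableEq m]

/-- The ℓ² operator norm of a complex matrix. -/
def opNorm (A : Matrix m m ℂ) : ℝ :=
  ‖Matrix.toEuclideanCLM (𝕜 := ℂ) A‖

/-- `(H₁, H₂, H₃)` is a δ-representation of the sphere: each `Hᵣ` is Hermitian, all
commutators have ℓ²-operator norm at most `δ`, and `‖H₁² + H₂² + H₃² − I‖ ≤ δ`. -/
def IsSphereRep (δ : ℝ) (H₁ H₂ H₃ : Matrix m m ℂ) : Prop :=
  H₁.IsHermitian ∧ H₂.IsHermitian ∧ H₃.IsHermitian ∧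
  opNorm (H₁ * H₂ - H₂ * H₁) ≤ δ ∧
  opNorm (H₁ * H₃ - H₃ * H₁) ≤ δ ∧
  opNorm (H₂ * H₃ - H₃ * H₂) ≤ δ ∧
  opNorm (H₁ ^ 2 + H₂ ^ 2 + H₃ ^ 2 - 1) ≤ δ

/-- The 2n×2n Hermitian block matrix `S(H₁,H₂,H₃) = [[H₃, H₁ − iH₂], [H₁ + iH₂, −H₃]]`. -/
def sphS (H₁ H₂ H₃ : Matrix m m ℂ) : Matrix (m ⊕ m) (m ⊕ m) ℂ :=
  Matrix.fromBlocks H₃ (H₁ - Complex.I • H₂) (H₁ + Complex.I • H₂) (-H₃)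

open Classical in
/-- The Bott index: the number of positive eigenvalues (with multiplicity) of
`S(H₁,H₂,H₃)` minus `n`.  (Junk value `0` if `S(H₁,H₂,H₃)` is not Hermitian.) -/
def bott (H₁ H₂ H₃ : Matrix m m ℂ) : ℤ :=
  if h : (sphS H₁ H₂ H₃).IsHermitian then
    ((Finset.univ.filter fun i => 0 < h.eigenvalues i).card : ℤ) - Fintype.card m
  else 0

end AC

set_option linter.unusedSectionVars false

namespace AC

section
variable {A : Type} [CStarAlgebra A] [FiniteDimensional ℂ A]

theorem finite_spectrum_real (a : A) : (spectrum ℝ a).Finite := by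
  have h1 : (spectrum ℂ a).Finite := by
    have h_int : IsIntegral ℂ a := Algebra.IsIntegral.isIntegral a
    have hp : minpoly ℂ a ≠ 0 := minpoly.ne_zero h_int
    refine (Polynomial.rootSet_finite (minpoly ℂ a) ℂ).subset ?_
    intro x hx
    rw [Polynomial.mem_rootSet]
    refine ⟨hp, ?_⟩
    have := spectrum.subset_polynomial_aeval a (minpoly ℂ a) ⟨x, hx, rfl⟩
    rw [minpoly.aeval] at this
    have hA : Nontrivial A := by
      by_contra hn
      rw [not_nontrivial_iff_subsingleton] at hn
      simp at hx
    simpa using this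
  have h2 : (spectrum ℝ a) = (fun t : ℝ => (t : ℂ)) ⁻¹' (spectrum ℂ a) := by
    ext t
    simp [spectrum.mem_iff]
    rfl
  rw [h2]
  exact h1.preimage (Complex.ofReal_injective.injOn)

theorem fcont (f : ℝ → ℝ) (a : A) : ContinuousOn f (spectrum ℝ a) :=
  (finite_spectrum_real a).continuousOn f

/-- Functional calculus of a self-adjoint element by an arbitrary real function. -/
def fc (f : ℝ → ℝ) (a : A) : A := cfc f a

theorem fc_mul (f g : ℝ → ℝ) (a : A) : fc f a * fc g a = fc (fun t => f t * g t) a :=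
  (cfc_mul f g a (fcont f a) (fcont g a)).symm

theorem fc_add (f g : ℝ → ℝ) (a : A) : fc f a + fc g a = fc (fun t => f t + g t) a :=
  (cfc_add a f g (fcont f a) (fcont g a)).symm

theorem fc_sub (f g : ℝ → ℝ) (a : A) : fc f a - fc g a = fc (fun t => f t - g t) a :=
  (cfc_sub f g a (fcont f a) (fcont g a)).symm

theorem fc_smul (r : ℝ) (f : ℝ → ℝ) (a : A) : r • fc f a = fc (fun t => r * f t) a :=
  (cfc_smul r f a (fcont f a)).symm

theorem fc_const (r : ℝ) {a : A} (ha : IsSelfAdjoint a) : fc (fun _ => r) a = r • (1 : A) := by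
  unfold fc
  rw [cfc_const r a, Algebra.algebraMap_eq_smul_one]

theorem fc_one {a : A} (ha : IsSelfAdjoint a) : fc (fun _ => 1) a = 1 := by
  rw [fc_const 1 ha, one_smul]

theorem fc_zero (a : A) : fc (fun _ => 0) a = 0 := by
  unfold fc; exact cfc_const_zero ℝ a

theorem fc_id {a : A} (ha : IsSelfAdjoint a) : fc (fun t => t) a = a := cfc_id' ℝ a

theorem fc_isSelfAdjoint (f : ℝ → ℝ) (a : A) : IsSelfAdjoint (fc f a) := cfc_predicate f a

@[simp] theorem star_fc (f : ℝ → ℝ) (a : A) : star (fc f a) = fc f a := fc_isSelfAdjoint f a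

theorem fc_congr {f g : ℝ → ℝ} {a : A} (h : ∀ t ∈ spectrum ℝ a, f t = g t) : fc f a = fc g a :=
  cfc_congr h

theorem norm_fc_le {f : ℝ → ℝ} {a : A} {c : ℝ} (hc : 0 ≤ c)
    (h : ∀ t ∈ spectrum ℝ a, |f t| ≤ c) : ‖fc f a‖ ≤ c :=
  norm_cfc_le hc h

theorem norm_fc_le' {f : ℝ → ℝ} {a : A} {c : ℝ} (h : ∀ t, |f t| ≤ c) : ‖fc f a‖ ≤ c :=
  norm_fc_le ((abs_nonneg _).trans (h 0)) fun t _ => h t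

theorem abs_le_norm_of_mem {a : A} {t : ℝ} (ht : t ∈ spectrum ℝ a) : |t| ≤ ‖a‖ := by
  have : Nontrivial A := by
    by_contra hn
    rw [not_nontrivial_iff_subsingleton] at hn
    simp at ht
  simpa using spectrum.norm_le_norm_of_mem ht

theorem fc_comp (f g : ℝ → ℝ) {a : A} (ha : IsSelfAdjoint a) :
    fc f (fc g a) = fc (fun t => f (g t)) a := by
  unfold fc
  exact (cfc_comp' f g a (((finite_spectrum_real a).image g).continuousOn f) (fcont g a)).symm

theorem fc_eq_aeval (f : ℝ → ℝ) {a : A} (ha : IsSelfAdjoint a) (p : Polynomial ℝ)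
    (h : ∀ t ∈ spectrum ℝ a, f t = p.eval t) : fc f a = Polynomial.aeval a p := by
  rw [fc_congr h, ← cfc_polynomial p a]; rfl

theorem aeval_intertwine {a b z : A} (h : a * z = z * b) (p : Polynomial ℝ) :
    Polynomial.aeval a p * z = z * Polynomial.aeval b p := by
  induction p using Polynomial.induction_on with
  | C r => simp [Algebra.algebraMap_eq_smul_one]
  | add p q hp hq => simp [add_mul, mul_add, hp, hq]
  | monomial n r hn =>
    simp only [map_mul, Polynomial.aeval_C, map_pow, Polynomial.aeval_X] at hn ⊢
    rw [pow_succ a, ← mul_assoc, mul_assoc, h, ← mul_assoc, hn, pow_succ b]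
    noncomm_ring

theorem fc_intertwine (f : ℝ → ℝ) {a b z : A} (ha : IsSelfAdjoint a) (hb : IsSelfAdjoint b)
    (h : a * z = z * b) : fc f a * z = z * fc f b := by
  classical
  set S := (finite_spectrum_real a).toFinset ∪ (finite_spectrum_real b).toFinset
  have hS : ∀ t ∈ S, f t = (Lagrange.interpolate S id f).eval t := fun t ht =>
    (Lagrange.eval_interpolate_at_node f (Set.injOn_id _) ht).symm
  rw [fc_eq_aeval f ha (Lagrange.interpolate S id f) fun t ht => hS t (by simp [S, ht]),
    fc_eq_aeval f hb (Lagrange.interpolate S id f) fun t ht => hS t (by simp [S, ht])]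
  exact aeval_intertwine h _

theorem fc_comm (f : ℝ → ℝ) {a z : A} (ha : IsSelfAdjoint a) (h : a * z = z * a) :
    fc f a * z = z * fc f a := fc_intertwine f ha ha h

theorem fc_map {B : Type} [CStarAlgebra B] [FiniteDimensional ℂ B] (φ : B →⋆ₐ[ℂ] A) (f : ℝ → ℝ)
    {b : B} (hb : IsSelfAdjoint b) : φ (fc f b) = fc f (φ b) := by
  have hb' : IsSelfAdjoint (φ b) := hb.map φ
  classical
  set S := (finite_spectrum_real b).toFinset ∪ (finite_spectrum_real (φ b)).toFinset
  have hS : ∀ t ∈ S, f t = (Lagrange.interpolate S id f).eval t := fun t ht =>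
    (Lagrange.eval_interpolate_at_node f (Set.injOn_id _) ht).symm
  rw [fc_eq_aeval f hb (Lagrange.interpolate S id f) fun t ht => hS t (by simp [S, ht]),
    fc_eq_aeval f hb' (Lagrange.interpolate S id f) fun t ht => hS t (by simp [S, ht])]
  generalize Lagrange.interpolate S id f = p
  induction p using Polynomial.induction_on with
  | C r =>
    have := map_smul φ (r : ℂ) (1 : B)
    simp only [Polynomial.aeval_C, Algebra.algebraMap_eq_smul_one, map_one] at this ⊢
    exact this
  | add p q hp hq => simp [hp, hq]
  | monomial n r hn =>
    rw [pow_succ, ← mul_assoc, map_mul, map_mul, hn, map_mul]; simp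

theorem norm_one_le : ‖(1 : A)‖ ≤ 1 := by
  rcases subsingleton_or_nontrivial A with h | h
  · rw [Subsingleton.elim (1 : A) 0]; simp
  · simp

/-- The one-parameter unitary group generated by `a`. -/
def expI (s : ℝ) (a : A) : A := NormedSpace.exp (s • (Complex.I • a))

theorem expI_zero (a : A) : expI 0 a = 1 := by simp [expI]

theorem expI_add (s t : ℝ) (a : A) : expI (s + t) a = expI s a * expI t a := by
  let +nondep : NormedAlgebra ℚ A := NormedAlgebra.restrictScalars ℚ ℂ A
  unfold expI
  rw [add_smul]
  exact NormedSpace.exp_add_of_commute (((Commute.refl _).smul_left s).smul_right t)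

theorem expI_mem_unitary (s : ℝ) {a : A} (ha : IsSelfAdjoint a) : expI s a ∈ unitary A := by
  let +nondep : NormedAlgebra ℚ A := NormedAlgebra.restrictScalars ℚ ℂ A
  refine NormedSpace.exp_mem_unitary_of_mem_skewAdjoint ?_
  rw [skewAdjoint.mem_iff]
  simp [ha.star_eq]

theorem norm_le_one_of_mem_unitary {u : A} (hu : u ∈ unitary A) : ‖u‖ ≤ 1 := by
  have h : ‖star u * u‖ = ‖u‖ * ‖u‖ := CStarRing.norm_star_mul_self
  rw [Unitary.star_mul_self_of_mem hu] at h
  nlinarith [norm_one_le (A := A), norm_nonneg u]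

theorem norm_expI_le (s : ℝ) {a : A} (ha : IsSelfAdjoint a) : ‖expI s a‖ ≤ 1 :=
  norm_le_one_of_mem_unitary (expI_mem_unitary s ha)

theorem hasDerivAt_expI (s : ℝ) (a : A) :
    HasDerivAt (fun t => expI t a) (expI s a * (Complex.I • a)) s :=
  hasDerivAt_exp_smul_const (𝕂 := ℝ) (Complex.I • a) s

theorem hasDerivAt_expI' (s : ℝ) (a : A) :
    HasDerivAt (fun t => expI t a) ((Complex.I • a) * expI s a) s :=
  hasDerivAt_exp_smul_const' (𝕂 := ℝ) (Complex.I • a) s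

theorem norm_mul_le_of_le {x y : A} {p q : ℝ} (hx : ‖x‖ ≤ p) (hy : ‖y‖ ≤ q) : ‖x * y‖ ≤ p * q :=
  (norm_mul_le x y).trans (mul_le_mul hx hy (norm_nonneg y) ((norm_nonneg x).trans hx))

theorem norm_expI_mul_sub_le (s : ℝ) {a b : A} (z : A) (ha : IsSelfAdjoint a)
    (hb : IsSelfAdjoint b) :
    ‖expI s a * z - z * expI s b‖ ≤ |s| * ‖a * z - z * b‖ := by
  have hd : ∀ t ∈ (Set.univ : Set ℝ), HasDerivWithinAt (fun t => expI t a * z * expI (-t) b)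
      (expI t a * (Complex.I • (a * z - z * b)) * expI (-t) b) Set.univ t := by
    intro t _
    have h1 := (hasDerivAt_expI t a).mul_const z
    have h2 := (hasDerivAt_expI' (-t) b).scomp t (hasDerivAt_neg t)
    have h3 := h1.mul h2
    refine (h3.congr_deriv ?_).hasDerivWithinAt
    simp only [Function.comp, mul_sub, sub_mul, smul_sub, mul_smul_comm, smul_mul_assoc, neg_smul,
      one_smul, mul_neg]
    noncomm_ring
  have hb' : ∀ t ∈ (Set.univ : Set ℝ),
      ‖expI t a * (Complex.I • (a * z - z * b)) * expI (-t) b‖ ≤ ‖a * z - z * b‖ := by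
    intro t _
    have := norm_mul_le_of_le (norm_mul_le_of_le (norm_expI_le t ha)
      (le_of_eq (norm_smul Complex.I (a * z - z * b)))) (norm_expI_le (-t) hb)
    simpa using this
  have key := convex_univ.norm_image_sub_le_of_norm_hasDerivWithin_le hd hb'
    (Set.mem_univ 0) (Set.mem_univ s)
  have e : expI s a * z - z * expI s b =
      (expI s a * z * expI (-s) b - expI 0 a * z * expI (-0) b) * expI s b := by
    have : expI (-s) b * expI s b = 1 := by rw [← expI_add]; simp [expI_zero]
    rw [sub_mul, mul_assoc _ _ (expI s b), this]; simp [expI_zero]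
  rw [e]
  refine (norm_mul_le_of_le key (norm_expI_le s hb)).trans ?_
  rw [mul_one, mul_comm]; simp

theorem cfc_cexp_eq_expI (s : ℝ) {a : A} (ha : IsSelfAdjoint a) :
    cfc (fun z : ℂ => Complex.exp (s * Complex.I * z)) a = expI s a := by
  have hn : IsStarNormal a := ha.isStarNormal
  have hn' : IsStarNormal ((s * Complex.I : ℂ) • a) := inferInstance
  unfold expI
  rw [cfc_comp_const_mul (s * Complex.I : ℂ) Complex.exp a (by fun_prop),
    CFC.complex_exp_eq_normedSpace_exp hn', mul_smul]
  rfl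

/-- `f` is operator Lipschitz with constant `K`, in commutator form. -/
def OL (K : ℝ) (f : ℝ → ℝ) : Prop :=
  ∀ (A : Type) [CStarAlgebra A] [FiniteDimensional ℂ A] (a b z : A), IsSelfAdjoint a →
    IsSelfAdjoint b → ‖fc f a * z - z * fc f b‖ ≤ K * ‖a * z - z * b‖

theorem OL.mono {K K' : ℝ} {f : ℝ → ℝ} (h : OL K f) (hK : K ≤ K') : OL K' f :=
  fun A _ _ a b z ha hb => (h A a b z ha hb).trans (by gcongr)

open FourierTransform in
theorem exists_OL {f : ℝ → ℝ} (hf : ContDiff ℝ (⊤ : ℕ∞) f) (hs : HasCompactSupport f) :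
    ∃ K, OL K f := by
  have h1 : HasCompactSupport (fun t => (f t : ℂ)) := hs.comp_left (g := fun t : ℝ => (t : ℂ)) rfl
  have h2 : ContDiff ℝ (⊤ : ℕ∞) (fun t => (f t : ℂ)) := Complex.ofRealCLM.contDiff.comp hf
  set g : SchwartzMap ℝ ℂ := h1.toSchwartzMap h2 with hg
  set G : SchwartzMap ℝ ℂ := 𝓕 g with hG
  have hinv : ∀ t : ℝ, (f t : ℂ) = ∫ w : ℝ, G w * Complex.exp ((2 * Real.pi * w : ℝ) * Complex.I * t) := by
    intro t
    have h3 : 𝓕⁻ G = g := FourierPair.fourierInv_fourier_eq g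
    have h4 : (𝓕⁻ G) t = (f t : ℂ) := by rw [h3]; rfl
    rw [← h4, SchwartzMap.fourierInv_coe, Real.fourierInv_eq']
    congr 1
    ext w
    rw [smul_eq_mul, mul_comm]
    congr 2
    simp
    ring
  have hint1 : MeasureTheory.Integrable (fun w => ‖G w‖) := G.integrable.norm
  have hint2 : MeasureTheory.Integrable (fun w => ‖w‖ * ‖G w‖) := by
    simpa using G.integrable_pow_mul MeasureTheory.volume 1
  refine ⟨∫ w, 2 * Real.pi * (‖w‖ * ‖G w‖), ?_⟩
  intro A _ _ a b z ha hb
  have hcont : ∀ c : A, ContinuousOn (Function.uncurry fun (w : ℝ) (x : ℂ) =>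
      G w * Complex.exp ((2 * Real.pi * w : ℝ) * Complex.I * x)) (Set.univ ×ˢ spectrum ℂ c) := by
    intro c
    have := G.continuous
    unfold Function.uncurry
    fun_prop
  have hbd : ∀ c : A, IsSelfAdjoint c → ∀ᵐ w : ℝ, ∀ x ∈ spectrum ℂ c,
      ‖G w * Complex.exp ((2 * Real.pi * w : ℝ) * Complex.I * x)‖ ≤ ‖G w‖ := by
    intro c hc
    refine .of_forall fun w x hx => ?_
    rw [hc.mem_spectrum_eq_re hx, norm_mul]
    have : ((2 * Real.pi * w : ℝ) : ℂ) * Complex.I * (x.re : ℂ) = ((2 * Real.pi * w * x.re : ℝ) : ℂ) * Complex.I := by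
      push_cast; ring
    rw [this, Complex.norm_exp_ofReal_mul_I, mul_one]
  have hrep : ∀ c : A, IsSelfAdjoint c →
      MeasureTheory.Integrable (fun w => G w • expI (2 * Real.pi * w) c) ∧
      fc f c = ∫ w, G w • expI (2 * Real.pi * w) c := by
    intro c hc
    have hn : IsStarNormal c := hc.isStarNormal
    have e : ∀ w : ℝ, cfc (fun x : ℂ => G w * Complex.exp ((2 * Real.pi * w : ℝ) * Complex.I * x)) c
        = G w • expI (2 * Real.pi * w) c := by
      intro w
      rw [cfc_const_mul _ _ c (by fun_prop), cfc_cexp_eq_expI _ hc]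
    simp only [← e]
    refine ⟨integrable_cfc _ (fun w => ‖G w‖) c (hcont c) (hbd c hc) hint1.hasFiniteIntegral, ?_⟩
    rw [← cfc_integral _ (fun w => ‖G w‖) c (hcont c) (hbd c hc) hint1.hasFiniteIntegral]
    unfold fc
    rw [cfc_real_eq_complex]
    refine cfc_congr fun x hx => ?_
    rw [hc.mem_spectrum_eq_re hx]
    exact hinv x.re
  have hl := ((ContinuousLinearMap.mul ℂ A).flip z).integral_comp_comm (hrep a ha).1
  have hr := (ContinuousLinearMap.mul ℂ A z).integral_comp_comm (hrep b hb).1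
  simp only [ContinuousLinearMap.flip_apply, ContinuousLinearMap.mul_apply'] at hl hr
  rw [(hrep a ha).2, (hrep b hb).2, ← hl, ← hr, ← MeasureTheory.integral_sub]
  · rw [← MeasureTheory.integral_mul_const]
    refine MeasureTheory.norm_integral_le_of_norm_le ((hint2.const_mul _).mul_const _) ?_
    refine .of_forall fun w => ?_
    have : (G w • expI (2 * Real.pi * w) a) * z - z * (G w • expI (2 * Real.pi * w) b)
       = G w • (expI (2 * Real.pi * w) a * z - z * expI (2 * Real.pi * w) b) := by
      rw [smul_sub, smul_mul_assoc, mul_smul_comm]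
    rw [this, norm_smul]
    have h := norm_expI_mul_sub_le (2 * Real.pi * w) z ha hb
    have h' : |2 * Real.pi * w| = 2 * Real.pi * ‖w‖ := by
      rw [abs_mul, abs_of_pos Real.two_pi_pos]; rfl
    rw [h'] at h
    calc _ ≤ ‖G w‖ * (2 * Real.pi * ‖w‖ * ‖a * z - z * b‖) := by gcongr
      _ = _ := by ring
  · exact (hrep a ha).1.mul_const z
  · exact (hrep b hb).1.const_mul z

theorem bra_add (x y z : A) : ⁅x, y + z⁆ = ⁅x, y⁆ + ⁅x, z⁆ := by
  simp only [Ring.lie_def]; noncomm_ring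

theorem bra_sub (x y z : A) : ⁅x, y - z⁆ = ⁅x, y⁆ - ⁅x, z⁆ := by
  simp only [Ring.lie_def]; noncomm_ring

theorem bra_sum {ι : Type*} (s : Finset ι) (x : A) (f : ι → A) :
    ⁅x, ∑ i ∈ s, f i⁆ = ∑ i ∈ s, ⁅x, f i⁆ := by
  simp only [Ring.lie_def, Finset.mul_sum, Finset.sum_mul, Finset.sum_sub_distrib]

theorem norm_lie_swap (x y : A) : ‖⁅x, y⁆‖ = ‖⁅y, x⁆‖ := by
  rw [Ring.lie_def, Ring.lie_def, norm_sub_rev]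

theorem norm_lie_le (x y : A) : ‖⁅x, y⁆‖ ≤ 2 * ‖x‖ * ‖y‖ := by
  rw [Ring.lie_def]
  refine (norm_sub_le _ _).trans ?_
  nlinarith [norm_mul_le x y, norm_mul_le y x]

theorem lie_mul_right (x y z : A) : ⁅x, y * z⁆ = ⁅x, y⁆ * z + y * ⁅x, z⁆ := by
  simp only [Ring.lie_def]; noncomm_ring

theorem norm_lie_mul_le (x y z : A) : ‖⁅x, y * z⁆‖ ≤ ‖⁅x, y⁆‖ * ‖z‖ + ‖y‖ * ‖⁅x, z⁆‖ := by
  rw [lie_mul_right]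
  exact (norm_add_le _ _).trans (add_le_add (norm_mul_le _ _) (norm_mul_le _ _))

theorem norm_lie_add_le (x y z : A) : ‖⁅x, y + z⁆‖ ≤ ‖⁅x, y⁆‖ + ‖⁅x, z⁆‖ := by
  rw [bra_add]; exact norm_add_le _ _

theorem star_lie (x y : A) : star ⁅x, y⁆ = ⁅star y, star x⁆ := by
  simp [Ring.lie_def]

theorem norm_lie_star (x y : A) : ‖⁅star x, star y⁆‖ = ‖⁅x, y⁆‖ := by
  rw [← norm_star ⁅x, y⁆, star_lie, norm_lie_swap]

theorem norm_lie_star_left (x : A) {y : A} (hy : IsSelfAdjoint y) : ‖⁅star x, y⁆‖ = ‖⁅x, y⁆‖ := by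
  conv_lhs => rw [← hy.star_eq]
  exact norm_lie_star x y

theorem norm_lie_smul (c : ℂ) (x y : A) : ‖⁅x, c • y⁆‖ = ‖c‖ * ‖⁅x, y⁆‖ := by
  rw [Ring.lie_def, mul_smul_comm, smul_mul_assoc, ← smul_sub, norm_smul, Ring.lie_def]

theorem OL.lie {K : ℝ} {f : ℝ → ℝ} (h : OL K f) {a : A} (ha : IsSelfAdjoint a) (z : A) :
    ‖⁅fc f a, z⁆‖ ≤ K * ‖⁅a, z⁆‖ := h A a a z ha ha

theorem OL.sub {K : ℝ} {f : ℝ → ℝ} (h : OL K f) {a b : A} (ha : IsSelfAdjoint a)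
    (hb : IsSelfAdjoint b) : ‖fc f a - fc f b‖ ≤ K * ‖a - b‖ := by
  simpa using h A a b 1 ha hb

/-! ### Spectral projections -/

/-- The spectral projection of `a` for the set `s`. -/
def pr (s : Set ℝ) (a : A) : A := fc (s.indicator fun _ => 1) a

@[simp] theorem star_pr (s : Set ℝ) (a : A) : star (pr s a) = pr s a := star_fc _ _

theorem pr_isSelfAdjoint (s : Set ℝ) (a : A) : IsSelfAdjoint (pr s a) := star_pr s a

theorem pr_mul_pr (s t : Set ℝ) (a : A) : pr s a * pr t a = pr (s ∩ t) a := by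
  unfold pr
  rw [fc_mul]
  congr 1; ext x; classical
  by_cases h1 : x ∈ s <;> by_cases h2 : x ∈ t <;> simp [h1, h2]

@[simp] theorem pr_mul_self (s : Set ℝ) (a : A) : pr s a * pr s a = pr s a := by
  rw [pr_mul_pr, Set.inter_self]

theorem pr_empty (a : A) : pr ∅ a = 0 := by simp [pr, fc_zero]

theorem pr_mul_pr_of_disjoint {s t : Set ℝ} (h : Disjoint s t) (a : A) : pr s a * pr t a = 0 := by
  rw [pr_mul_pr, h.inter_eq, pr_empty]

theorem norm_pr_le (s : Set ℝ) (a : A) : ‖pr s a‖ ≤ 1 := by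
  refine norm_fc_le' fun t => ?_
  by_cases h : t ∈ s <;> simp [h]

theorem pr_compl (s : Set ℝ) {a : A} (ha : IsSelfAdjoint a) : pr sᶜ a = 1 - pr s a := by
  unfold pr
  rw [← fc_one ha, fc_sub]
  congr 1; ext x
  by_cases h1 : x ∈ s <;> simp [h1]

theorem norm_fc_mul_pr_le {f : ℝ → ℝ} {s : Set ℝ} {c : ℝ} (hc : 0 ≤ c) (h : ∀ t ∈ s, |f t| ≤ c)
    (a : A) : ‖fc f a * pr s a‖ ≤ c := by
  unfold pr
  rw [fc_mul]
  refine norm_fc_le' fun t => ?_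
  by_cases ht : t ∈ s
  · simpa [ht] using h t ht
  · simpa [ht] using hc

theorem fc_mul_pr_eq {f : ℝ → ℝ} {s : Set ℝ} (h : ∀ t ∉ s, f t = 0) (a : A) :
    fc f a * pr s a = fc f a := by
  unfold pr
  rw [fc_mul]
  refine fc_congr fun t _ => ?_
  by_cases ht : t ∈ s
  · simp [ht]
  · simp [h t ht]

theorem fc_mul_comm (f g : ℝ → ℝ) (a : A) : fc f a * fc g a = fc g a * fc f a := by
  rw [fc_mul, fc_mul]; simp only [mul_comm]

theorem pr_mul_fc_eq {f : ℝ → ℝ} {s : Set ℝ} (h : ∀ t ∉ s, f t = 0) (a : A) :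
    pr s a * fc f a = fc f a := by
  unfold pr; rw [fc_mul_comm]; exact fc_mul_pr_eq h a

theorem fc_mul_pr_eq_pr {f : ℝ → ℝ} {s : Set ℝ} (h : ∀ t ∈ s, f t = 1) (a : A) :
    fc f a * pr s a = pr s a := by
  unfold pr
  rw [fc_mul]
  refine fc_congr fun t _ => ?_
  by_cases ht : t ∈ s
  · simp [h t ht]
  · simp [ht]

theorem le_norm_fc_mul {f : ℝ → ℝ} {s : Set ℝ} {c : ℝ} (hc : 0 < c) (h : ∀ t ∈ s, c ≤ |f t|)
    {a z : A} (hz : pr s a * z = z) : c * ‖z‖ ≤ ‖fc f a * z‖ := by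
  have e : z = fc (s.indicator fun t => (f t)⁻¹) a * (fc f a * z) := by
    rw [← mul_assoc, fc_mul]
    conv_lhs => rw [← hz]
    refine congrArg (· * z) (fc_congr fun t _ => ?_)
    by_cases ht : t ∈ s
    · have : f t ≠ 0 := by
        intro h0; have := h t ht; rw [h0, abs_zero] at this; linarith
      simp [ht, this]
    · simp [ht]
  have hn : ‖fc (s.indicator fun t => (f t)⁻¹) a‖ ≤ c⁻¹ := by
    refine norm_fc_le' fun t => ?_
    by_cases ht : t ∈ s
    · simp only [ht, Set.indicator_of_mem, abs_inv]
      exact inv_anti₀ hc (h t ht)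
    · simp [ht, hc.le]
  have h2 : ‖z‖ ≤ c⁻¹ * ‖fc f a * z‖ := by
    conv_lhs => rw [e]
    exact norm_mul_le_of_le hn le_rfl
  rw [inv_mul_eq_div, le_div_iff₀ hc] at h2
  linarith

theorem norm_mul_star_self' (z : A) : ‖star z * z‖ = ‖z‖ ^ 2 := by
  rw [CStarRing.norm_star_mul_self, sq]

theorem fc_add_const (μ : ℝ) {a : A} (ha : IsSelfAdjoint a) :
    fc (fun t => t + μ) a = a + μ • (1 : A) := by
  rw [← fc_add, fc_id ha, fc_const μ ha]

theorem sylvester {s t : Set ℝ} {α g : ℝ} (hg : 0 < g) (hs : ∀ x ∈ s, α ≤ x)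
    (ht : ∀ x ∈ t, x ≤ α - g) {a b Z : A} (ha : IsSelfAdjoint a) (hb : IsSelfAdjoint b)
    (h1 : pr s a * Z = Z) (h2 : Z * pr t b = Z) : g * ‖Z‖ ≤ ‖a * Z - Z * b‖ := by
  set μ := ‖b‖ + |α| + g + 1 with hμ
  have hμ1 : 0 < α - g + μ := by
    have := neg_abs_le α; have := norm_nonneg b; linarith
  have l1 : (α + μ) * ‖Z‖ ≤ ‖fc (fun t => t + μ) a * Z‖ := by
    refine le_norm_fc_mul (s := s) (by linarith) (fun x hx => ?_) h1
    have := hs x hx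
    exact le_trans (by linarith) (le_abs_self _)
  have l2 : ‖Z * fc (fun t => t + μ) b‖ ≤ (α - g + μ) * ‖Z‖ := by
    rw [← h2, mul_assoc, h2, mul_comm (α - g + μ)]
    refine norm_mul_le_of_le le_rfl ?_
    unfold pr
    rw [fc_mul]
    refine norm_fc_le hμ1.le fun x hx => ?_
    by_cases hxt : x ∈ t
    · have h3 := ht x hxt
      have h4 := abs_le.1 (abs_le_norm_of_mem hx)
      simp only [hxt, Set.indicator_of_mem, one_mul, abs_le]
      have := abs_nonneg α
      constructor <;> linarith
    · simp [hxt, hμ1.le]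
  have e : a * Z - Z * b = fc (fun t => t + μ) a * Z - Z * fc (fun t => t + μ) b := by
    rw [fc_add_const μ ha, fc_add_const μ hb, add_mul, mul_add, smul_mul_assoc, mul_smul_comm,
      one_mul, mul_one]
    abel
  rw [e]
  have := norm_sub_norm_le (fc (fun t => t + μ) a * Z) (Z * fc (fun t => t + μ) b)
  linarith

theorem self_mul_fc (f : ℝ → ℝ) {a : A} (ha : IsSelfAdjoint a) : a * fc f a = fc f a * a := by
  conv_lhs => rw [← fc_id ha, fc_comp _ _ ha]
  conv_rhs => rw [← fc_id ha, fc_comp _ _ ha]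
  exact fc_mul_comm _ _ a

theorem sylvester_lie {s t : Set ℝ} {α g : ℝ} (hg : 0 < g) (hs : ∀ x ∈ s, α ≤ x)
    (ht : ∀ x ∈ t, x ≤ α - g) {a : A} (y : A) (ha : IsSelfAdjoint a) :
    g * ‖pr s a * y * pr t a‖ ≤ ‖⁅a, y⁆‖ := by
  refine (sylvester hg hs ht ha ha (Z := pr s a * y * pr t a) ?_ ?_).trans ?_
  · rw [← mul_assoc, ← mul_assoc, pr_mul_self]
  · rw [mul_assoc, pr_mul_self]
  · have e : a * (pr s a * y * pr t a) - (pr s a * y * pr t a) * a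
        = pr s a * ⁅a, y⁆ * pr t a := by
      have h1 : a * pr s a = pr s a * a := self_mul_fc _ ha
      have h2 : a * pr t a = pr t a * a := self_mul_fc _ ha
      rw [← mul_assoc, ← mul_assoc, h1, mul_assoc _ (pr t a) a, ← h2, Ring.lie_def]
      noncomm_ring
    rw [e]
    simpa using norm_mul_le_of_le (norm_mul_le_of_le (norm_pr_le s a) (le_refl ‖⁅a, y⁆‖)) (norm_pr_le t a)

/-! ### Positivity -/

theorem norm_star_mul_self_le_add (x y : A) :
    ‖star x * x‖ ≤ ‖star x * x + star y * y‖ := by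
  let := CStarAlgebra.spectralOrder A
  let := CStarAlgebra.spectralOrderedRing A
  refine CStarAlgebra.norm_le_norm_of_nonneg_of_le (star_mul_self_nonneg x) ?_
  exact le_add_of_nonneg_right (star_mul_self_nonneg y)

theorem norm_sum_block_le {ι : Type*} (s : Finset ι) {c : ℝ} (hc : 0 ≤ c) (p q Y : ι → A)
    (hpsa : ∀ i ∈ s, IsSelfAdjoint (p i)) (hqsa : ∀ i ∈ s, IsSelfAdjoint (q i))
    (hqq : ∀ i ∈ s, q i * q i = q i)
    (hp0 : ∀ i ∈ s, ∀ j ∈ s, i ≠ j → p i * p j = 0)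
    (hq0 : ∀ i ∈ s, ∀ j ∈ s, i ≠ j → q i * q j = 0)
    (hY : ∀ i ∈ s, ‖p i * Y i * q i‖ ≤ c) : ‖∑ i ∈ s, p i * Y i * q i‖ ≤ c := by
  let := CStarAlgebra.spectralOrder A
  let := CStarAlgebra.spectralOrderedRing A
  classical
  set Z := ∑ i ∈ s, p i * Y i * q i with hZ
  have hsq : star Z * Z = ∑ i ∈ s, star (p i * Y i * q i) * (p i * Y i * q i) := by
    rw [hZ, star_sum, Finset.sum_mul]
    refine Finset.sum_congr rfl fun i hi => ?_
    rw [Finset.mul_sum, Finset.sum_eq_single i]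
    · intro j hj hji
      simp only [star_mul, (hpsa i hi).star_eq]
      have := hp0 i hi j hj (Ne.symm hji)
      calc _ = star (q i) * star (Y i) * (p i * p j) * Y j * q j := by noncomm_ring
        _ = 0 := by rw [this]; simp
    · exact fun h => absurd hi h
  have hle : ∀ i ∈ s, star (p i * Y i * q i) * (p i * Y i * q i) ≤ (c ^ 2) • q i := by
    intro i hi
    have h1 : star (p i * Y i * q i) * (p i * Y i * q i) ≤
        algebraMap ℝ A ‖star (p i * Y i * q i) * (p i * Y i * q i)‖ :=
      IsSelfAdjoint.le_algebraMap_norm_self (IsSelfAdjoint.star_mul_self _)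
    have h2 := star_left_conjugate_le_conjugate h1 (q i)
    have h3 : star (q i) * (star (p i * Y i * q i) * (p i * Y i * q i)) * q i
        = star (p i * Y i * q i) * (p i * Y i * q i) := by
      rw [← mul_assoc, ← star_mul, mul_assoc, mul_assoc (p i * Y i) , hqq i hi]
    rw [h3] at h2
    refine h2.trans ?_
    rw [Algebra.algebraMap_eq_smul_one, mul_smul_comm, mul_one, smul_mul_assoc,
      (hqsa i hi).star_eq, hqq i hi]
    have hq : 0 ≤ q i := by
      have := star_mul_self_nonneg (q i)
      rwa [(hqsa i hi).star_eq, hqq i hi] at this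
    refine smul_le_smul_of_nonneg_right ?_ hq
    rw [norm_mul_star_self']
    have := hY i hi
    gcongr
  have hQ : ‖∑ i ∈ s, q i‖ ≤ 1 := by
    set Q := ∑ i ∈ s, q i with hQ
    have h1 : star Q = Q := by
      rw [hQ, star_sum]; exact Finset.sum_congr rfl fun i hi => (hqsa i hi).star_eq
    have h2 : Q * Q = Q := by
      rw [hQ, Finset.sum_mul]
      refine Finset.sum_congr rfl fun i hi => ?_
      rw [Finset.mul_sum, Finset.sum_eq_single i]
      · exact hqq i hi
      · exact fun j hj hji => hq0 i hi j hj (Ne.symm hji)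
      · exact fun h => absurd hi h
    have h3 := norm_mul_star_self' Q
    rw [h1, h2] at h3
    nlinarith [norm_nonneg Q]
  have h5 : ‖star Z * Z‖ ≤ ‖(c ^ 2) • ∑ i ∈ s, q i‖ := by
    refine CStarAlgebra.norm_le_norm_of_nonneg_of_le (star_mul_self_nonneg Z) ?_
    rw [hsq, Finset.smul_sum]
    exact Finset.sum_le_sum hle
  rw [norm_mul_star_self', norm_smul, Real.norm_of_nonneg (sq_nonneg c)] at h5
  refine le_of_sq_le_sq ?_ hc
  nlinarith [sq_nonneg c]

/-! ### Localisation of low-lying states -/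

theorem star_mul_self_eq {h b : A} (hh : IsSelfAdjoint h) (hb : IsSelfAdjoint b) :
    star (h + Complex.I • b) * (h + Complex.I • b) = h * h + b * b + Complex.I • ⁅h, b⁆ := by
  simp only [star_add, star_smul, hh.star_eq, hb.star_eq, Ring.lie_def, add_mul, mul_add,
    smul_mul_assoc, mul_smul_comm, smul_sub, smul_add]
  have e : Complex.I • Complex.I • (b * b) = -(b * b) := by rw [smul_smul]; simp
  simp only [Complex.star_def, Complex.conj_I, neg_smul, smul_neg, e]
  abel

theorem norm_sq_le_left {h b : A} (hh : IsSelfAdjoint h) (hb : IsSelfAdjoint b) {κ : ℝ}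
    (hκ : ‖⁅h, b⁆‖ ≤ κ) (z : A) :
    ‖h * z‖ ^ 2 ≤ ‖(h + Complex.I • b) * z‖ ^ 2 + κ * ‖z‖ ^ 2 := by
  have e : star (h * z) * (h * z) + star (b * z) * (b * z)
      = star ((h + Complex.I • b) * z) * ((h + Complex.I • b) * z)
        - star z * (Complex.I • ⁅h, b⁆) * z := by
    have := star_mul_self_eq hh hb
    have h2 : star ((h + Complex.I • b) * z) * ((h + Complex.I • b) * z) =
      star z * (star (h + Complex.I • b) * (h + Complex.I • b)) * z := by
      rw [star_mul]; noncomm_ring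
    rw [h2, this]
    simp only [star_mul, hh.star_eq, hb.star_eq]
    noncomm_ring
  have h1 := norm_star_mul_self_le_add (h * z) (b * z)
  rw [e, norm_mul_star_self'] at h1
  refine h1.trans ((norm_sub_le _ _).trans ?_)
  rw [norm_mul_star_self']
  have : ‖star z * (Complex.I • ⁅h, b⁆) * z‖ ≤ ‖z‖ * κ * ‖z‖ :=
    norm_mul_le_of_le (norm_mul_le_of_le (norm_star z).le
      (by rw [norm_smul]; simpa using hκ)) le_rfl
  nlinarith

theorem norm_sq_le_right {h b : A} (hh : IsSelfAdjoint h) (hb : IsSelfAdjoint b) {κ : ℝ}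
    (hκ : ‖⁅h, b⁆‖ ≤ κ) (z : A) :
    ‖b * z‖ ^ 2 ≤ ‖(h + Complex.I • b) * z‖ ^ 2 + κ * ‖z‖ ^ 2 := by
  have h1 := norm_sq_le_left (h := -b) (b := h) hb.neg hh (κ := κ)
    (by
      have : ⁅-b, h⁆ = ⁅h, b⁆ := by simp only [Ring.lie_def]; noncomm_ring
      rwa [this]) z
  have e : (-b + Complex.I • h) = Complex.I • (h + Complex.I • b) := by
    rw [smul_add, smul_smul]; simp [add_comm]
  rw [e, neg_mul, norm_neg, smul_mul_assoc, norm_smul] at h1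
  simpa using h1

theorem localization {S B g : A} {κ ρ τ : ℝ} (hρ : 0 ≤ ρ) (hτ : 0 ≤ τ)
    (hB : ∀ z, ‖B * z‖ ^ 2 ≤ ‖S * z‖ ^ 2 + κ * ‖z‖ ^ 2)
    (hBg : ∀ z, τ * ‖g * z‖ ≤ ‖B * (g * z)‖) :
    (τ ^ 2 - ρ - κ) * ‖g * pr (Set.Icc (-ρ) ρ) (star S * S)‖ ≤ ‖⁅star S * S, g⁆‖ := by
  set X := star S * S with hX
  set P := pr (Set.Icc (-ρ) ρ) X with hP
  have hXsa : IsSelfAdjoint X := IsSelfAdjoint.star_mul_self S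
  have hPs : star P = P := star_pr _ _
  set m := ‖g * P‖ with hm
  have h1 := hB (g * P)
  have h2 := hBg P
  have hXP : ‖X * P‖ ≤ ρ := by
    have := norm_fc_mul_pr_le (f := fun t => t) (s := Set.Icc (-ρ) ρ) hρ
      (fun t ht => abs_le.2 ht) X
    rwa [fc_id hXsa] at this
  have h3 : ‖S * (g * P)‖ ^ 2 ≤ m ^ 2 * ρ + m * ‖⁅X, g⁆‖ := by
    rw [← norm_mul_star_self']
    have e : star (S * (g * P)) * (S * (g * P))
        = star (g * P) * (g * P) * (X * P) + star (g * P) * ⁅X, g⁆ * P := by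
      have hPP : P * P = P := pr_mul_self _ _
      have hcom : X * P = P * X := self_mul_fc _ hXsa
      have : g * P * (X * P) = g * X * P := by
        rw [hcom, mul_assoc g P, ← mul_assoc P P, hPP, ← hcom]
        exact (mul_assoc _ _ _).symm
      rw [mul_assoc (star (g * P)) (g * P), this, star_mul S, Ring.lie_def, hX]
      noncomm_ring
    rw [e]
    refine (norm_add_le _ _).trans (add_le_add ?_ ?_)
    · refine norm_mul_le_of_le ?_ hXP
      rw [norm_mul_star_self']
    · simpa using norm_mul_le_of_le (norm_mul_le_of_le (norm_star (g * P)).le (le_refl ‖⁅X, g⁆‖))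
        (norm_pr_le (Set.Icc (-ρ) ρ) X)
  have hm0 : 0 ≤ m := norm_nonneg _
  have h4 : (τ * m) ^ 2 ≤ ‖B * (g * P)‖ ^ 2 := by gcongr
  have h5 : m * ((τ ^ 2 - ρ - κ) * m) ≤ m * ‖⁅X, g⁆‖ := by nlinarith
  rcases hm0.eq_or_lt with h0 | h0
  · rw [← h0, mul_zero]; exact norm_nonneg _
  · exact le_of_mul_le_mul_left h5 h0

end

/-! ### Smooth cut-off functions -/

/-- A smooth bump equal to `1` on `[-r, r]` and supported in `[-R, R]`. -/
def bmp (r R t : ℝ) : ℝ :=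
  Real.smoothTransition ((R - t) / (R - r)) * Real.smoothTransition ((R + t) / (R - r))

@[fun_prop]
theorem contDiff_st {f : ℝ → ℝ} (hf : ContDiff ℝ (⊤ : ℕ∞) f) :
    ContDiff ℝ (⊤ : ℕ∞) fun t => Real.smoothTransition (f t) :=
  Real.smoothTransition.contDiff.comp hf

theorem contDiff_bmp (r R : ℝ) : ContDiff ℝ (⊤ : ℕ∞) (bmp r R) := by
  unfold bmp; fun_prop

theorem bmp_nonneg (r R t : ℝ) : 0 ≤ bmp r R t :=
  mul_nonneg (Real.smoothTransition.nonneg _) (Real.smoothTransition.nonneg _)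

theorem bmp_le_one (r R t : ℝ) : bmp r R t ≤ 1 :=
  mul_le_one₀ (Real.smoothTransition.le_one _) (Real.smoothTransition.nonneg _)
    (Real.smoothTransition.le_one _)

theorem bmp_eq_one {r R t : ℝ} (h : r < R) (ht : |t| ≤ r) : bmp r R t = 1 := by
  have := abs_le.1 ht
  unfold bmp
  rw [Real.smoothTransition.one_of_one_le, Real.smoothTransition.one_of_one_le, one_mul] <;>
  · rw [le_div_iff₀ (by linarith)]; linarith

theorem bmp_eq_zero {r R t : ℝ} (h : r < R) (ht : R ≤ |t|) : bmp r R t = 0 := by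
  unfold bmp
  rcases le_abs.1 ht with h' | h'
  · rw [Real.smoothTransition.zero_of_nonpos, zero_mul]
    exact div_nonpos_of_nonpos_of_nonneg (by linarith) (by linarith)
  · rw [mul_comm, Real.smoothTransition.zero_of_nonpos, zero_mul]
    exact div_nonpos_of_nonpos_of_nonneg (by linarith) (by linarith)

theorem hasCompactSupport_of_abs {f : ℝ → ℝ} {R : ℝ} (h : ∀ t, R ≤ |t| → f t = 0) :
    HasCompactSupport f := by
  refine HasCompactSupport.intro (isCompact_Icc (a := -R) (b := R)) fun t ht => h t ?_
  by_contra h'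
  push Not at h'
  exact ht (abs_le.1 h'.le)

/-- Localises to within `3/8` of an integer. -/
def fq : ℝ → ℝ := bmp (1/4) (3/8)
/-- Lifts small eigenvalues away from zero. -/
def fβ (t : ℝ) : ℝ := (1/256) * bmp (1/256) (1/64) t
/-- Localises near the origin. -/
def fq' : ℝ → ℝ := bmp (3/16) (1/4)
/-- A smooth step from `-1` to `1`, constant near the origin. -/
def fφ (t : ℝ) : ℝ := Real.smoothTransition (128 * t - 1) - Real.smoothTransition (-128 * t - 1)
/-- The real part of the winding symbol. -/
def fy1 (t : ℝ) : ℝ := Real.cos (Real.pi / 2 * fφ t) ^ 2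
/-- The imaginary part of the winding symbol. -/
def fy2 (t : ℝ) : ℝ := Real.cos (Real.pi / 2 * fφ t) * Real.sin (Real.pi / 2 * fφ t)
/-- A smooth step from `0` to `1` on `[0, 1]`. -/
def fω (t : ℝ) : ℝ := Real.smoothTransition ((t - 1/8) / (3/4)) * Real.smoothTransition (3 - t)
/-- The overlap function. -/
def fG (t : ℝ) : ℝ := fω t * (1 - fω t)
/-- A smooth sign function, exact for `1/4 ≤ |t| ≤ 1`. -/
def fχ (t : ℝ) : ℝ :=
  (Real.smoothTransition (4 * t) - Real.smoothTransition (-4 * t)) * bmp 1 2 t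
/-- The smooth sign away from the winding region. -/
def fκ (t : ℝ) : ℝ := (Real.smoothTransition (128 * t) - Real.smoothTransition (-128 * t)) *
  (1 - fω (fy1 t)) * bmp 2 3 t
/-- The sign function with value `1` at `0`. -/
def sg (t : ℝ) : ℝ := if 0 ≤ t then 1 else -1

theorem fφ_zero {t : ℝ} (h : |t| ≤ 1/128) : fφ t = 0 := by
  have := abs_le.1 h
  unfold fφ
  rw [Real.smoothTransition.zero_of_nonpos (by linarith),
    Real.smoothTransition.zero_of_nonpos (by linarith), sub_zero]

theorem fφ_of_pos {t : ℝ} (h : 0 ≤ t) : fφ t = Real.smoothTransition (128 * t - 1) := by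
  unfold fφ
  rw [Real.smoothTransition.zero_of_nonpos (x := -128 * t - 1) (by linarith), sub_zero]

theorem fφ_neg (t : ℝ) : fφ (-t) = - fφ t := by
  unfold fφ; ring_nf

theorem fy2_neg (t : ℝ) : fy2 (-t) = - fy2 t := by
  unfold fy2; rw [fφ_neg, mul_neg, Real.cos_neg, Real.sin_neg, mul_neg]

theorem cos_fφ_zero {t : ℝ} (h : 1/64 ≤ |t|) : Real.cos (Real.pi / 2 * fφ t) = 0 := by
  have key : ∀ s : ℝ, 1/64 ≤ s → Real.cos (Real.pi / 2 * fφ s) = 0 := by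
    intro s hs
    rw [fφ_of_pos (by linarith), Real.smoothTransition.one_of_one_le (by linarith), mul_one,
      Real.cos_pi_div_two]
  rcases le_abs.1 h with h' | h'
  · exact key t h'
  · have := key (-t) h'
    rwa [fφ_neg, mul_neg, Real.cos_neg] at this

theorem fy1_zero {t : ℝ} (h : 1/64 ≤ |t|) : fy1 t = 0 := by
  unfold fy1; rw [cos_fφ_zero h]; simp

theorem fy2_zero {t : ℝ} (h : 1/64 ≤ |t|) : fy2 t = 0 := by
  unfold fy2; rw [cos_fφ_zero h]; simp

theorem fy1_one {t : ℝ} (h : |t| ≤ 1/128) : fy1 t = 1 := by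
  unfold fy1; rw [fφ_zero h]; simp

theorem fy_rel (t : ℝ) : fy2 t ^ 2 = fy1 t - fy1 t ^ 2 := by
  unfold fy1 fy2
  have := Real.sin_sq_add_cos_sq (Real.pi / 2 * fφ t)
  linear_combination (Real.cos (Real.pi / 2 * fφ t)) ^ 2 * this

theorem fy1_nonneg (t : ℝ) : 0 ≤ fy1 t := sq_nonneg _

theorem fy1_le_one (t : ℝ) : fy1 t ≤ 1 := by
  have := Real.sin_sq_add_cos_sq (Real.pi / 2 * fφ t)
  unfold fy1; nlinarith [sq_nonneg (Real.sin (Real.pi / 2 * fφ t))]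

theorem abs_fy1_le (t : ℝ) : |fy1 t| ≤ 1 := by
  rw [abs_of_nonneg (fy1_nonneg t)]; exact fy1_le_one t

theorem abs_fy2_le (t : ℝ) : |fy2 t| ≤ 1 := by
  unfold fy2
  rw [abs_mul]
  exact mul_le_one₀ (Real.abs_cos_le_one _) (abs_nonneg _) (Real.abs_sin_le_one _)

theorem fy2_nonneg {t : ℝ} (h : 0 ≤ t) : 0 ≤ fy2 t := by
  unfold fy2
  have h1 : 0 ≤ fφ t := by rw [fφ_of_pos h]; exact Real.smoothTransition.nonneg _
  have h2 : fφ t ≤ 1 := by rw [fφ_of_pos h]; exact Real.smoothTransition.le_one _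
  have hp := Real.pi_pos
  refine mul_nonneg (Real.cos_nonneg_of_mem_Icc ⟨?_, ?_⟩) (Real.sin_nonneg_of_nonneg_of_le_pi ?_ ?_)
  all_goals nlinarith

theorem fω_nonneg (t : ℝ) : 0 ≤ fω t :=
  mul_nonneg (Real.smoothTransition.nonneg _) (Real.smoothTransition.nonneg _)

theorem fω_le_one (t : ℝ) : fω t ≤ 1 :=
  mul_le_one₀ (Real.smoothTransition.le_one _) (Real.smoothTransition.nonneg _)
    (Real.smoothTransition.le_one _)

theorem fω_zero {t : ℝ} (h : t ≤ 1/8) : fω t = 0 := by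
  unfold fω
  rw [Real.smoothTransition.zero_of_nonpos
    (div_nonpos_of_nonpos_of_nonneg (by linarith) (by norm_num)), zero_mul]

theorem fω_one {t : ℝ} (h : 7/8 ≤ t) (h' : t ≤ 2) : fω t = 1 := by
  unfold fω
  rw [Real.smoothTransition.one_of_one_le, Real.smoothTransition.one_of_one_le (by linarith),
    one_mul]
  rw [le_div_iff₀ (by norm_num)]; linarith

theorem step_eq_sg {t c : ℝ} (hc : 0 < c) (h : 1/c ≤ |t|) :
    Real.smoothTransition (c * t) - Real.smoothTransition (-c * t) = sg t := by
  have h1 : 1 ≤ c * |t| := by rwa [div_le_iff₀ hc, mul_comm] at h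
  unfold sg
  split_ifs with h0
  · rw [abs_of_nonneg h0] at h1
    rw [Real.smoothTransition.one_of_one_le h1, Real.smoothTransition.zero_of_nonpos (by nlinarith),
      sub_zero]
  · push Not at h0
    rw [abs_of_neg h0] at h1
    rw [Real.smoothTransition.one_of_one_le (x := -c * t) (by linarith),
      Real.smoothTransition.zero_of_nonpos (by nlinarith), zero_sub]

theorem sg_sq (t : ℝ) : sg t * sg t = 1 := by unfold sg; split_ifs <;> norm_num

theorem abs_sg (t : ℝ) : |sg t| = 1 := by unfold sg; split_ifs <;> norm_num

theorem abs_step_le (x y : ℝ) :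
    |Real.smoothTransition x - Real.smoothTransition y| ≤ 1 := by
  have h1 := Real.smoothTransition.nonneg x
  have h2 := Real.smoothTransition.nonneg y
  have h3 := Real.smoothTransition.le_one x
  have h4 := Real.smoothTransition.le_one y
  rw [abs_le]; constructor <;> linarith

theorem abs_fχ_le (t : ℝ) : |fχ t| ≤ 1 := by
  unfold fχ
  rw [abs_mul, abs_of_nonneg (bmp_nonneg _ _ _)]
  exact mul_le_one₀ (abs_step_le _ _) (bmp_nonneg _ _ _) (bmp_le_one _ _ _)

theorem fχ_eq {t : ℝ} (h : 1/4 ≤ |t|) (h' : |t| ≤ 1) : fχ t = sg t := by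
  unfold fχ
  rw [step_eq_sg (by norm_num) h, bmp_eq_one (by norm_num) h', mul_one]

theorem fκ_eq {t : ℝ} (h' : |t| ≤ 2) : fκ t = sg t * (1 - fω (fy1 t)) := by
  unfold fκ
  rw [bmp_eq_one (by norm_num) h', mul_one]
  by_cases h : 1/128 ≤ |t|
  · rw [step_eq_sg (by norm_num) h]
  · rw [fy1_one (by linarith), fω_one (by norm_num) (by norm_num)]; simp

theorem abs_fκ_le (t : ℝ) : |fκ t| ≤ 1 := by
  unfold fκ
  rw [abs_mul, abs_mul, abs_of_nonneg (bmp_nonneg _ _ _), abs_of_nonneg (a := 1 - fω (fy1 t))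
    (by linarith [fω_le_one (fy1 t)])]
  exact mul_le_one₀ (mul_le_one₀ (abs_step_le _ _) (by linarith [fω_le_one (fy1 t)])
    (by linarith [fω_nonneg (fy1 t)])) (bmp_nonneg _ _ _) (bmp_le_one _ _ _)

theorem overlap_eq (t : ℝ) (ht : |t| ≤ 2) : fω (fy1 t) * fκ t = fχ (fy2 t) * fG (fy1 t) := by
  rw [fκ_eq ht]
  unfold fG
  by_cases h1 : fy1 t ≤ 1/8
  · rw [fω_zero h1]; simp
  by_cases h2 : 7/8 ≤ fy1 t
  · rw [fω_one h2 (by linarith [fy1_le_one t])]; simp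
  push Not at h1 h2
  have h3 := fy_rel t
  have h4 : 1/4 ≤ |fy2 t| := by
    refine le_of_sq_le_sq ?_ (abs_nonneg _)
    rw [sq_abs, h3]; nlinarith
  have h5 : sg (fy2 t) = sg t := by
    unfold sg
    rcases le_or_gt 0 t with h0 | h0
    · rw [if_pos h0, if_pos (fy2_nonneg h0)]
    · have h6 := fy2_nonneg (t := -t) (by linarith)
      rw [fy2_neg] at h6
      have h7 : fy2 t ≠ 0 := by intro h; rw [h] at h4; norm_num at h4
      have h8 : fy2 t < 0 := lt_of_le_of_ne (by linarith) h7
      rw [if_neg (by linarith), if_neg (by linarith)]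
  rw [fχ_eq h4 (abs_fy2_le t), h5]
  ring

theorem contDiff_fφ : ContDiff ℝ (⊤ : ℕ∞) fφ := by unfold fφ; fun_prop

theorem contDiff_fy1 : ContDiff ℝ (⊤ : ℕ∞) fy1 := by
  have := contDiff_fφ
  unfold fy1; fun_prop

theorem contDiff_fω : ContDiff ℝ (⊤ : ℕ∞) fω := by
  unfold fω; fun_prop

theorem fω_zero' {t : ℝ} (h : 3 ≤ |t|) : fω t = 0 := by
  rcases le_abs.1 h with h' | h'
  · unfold fω; rw [Real.smoothTransition.zero_of_nonpos (x := 3 - t) (by linarith), mul_zero]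
  · exact fω_zero (by linarith)

/-- A common operator Lipschitz constant for all the cut-off functions. -/
structure Lip (K : ℝ) : Prop where
  one_le : 1 ≤ K
  q : OL K fq
  β : OL K fβ
  q' : OL K fq'
  y1 : OL K fy1
  y2 : OL K fy2
  ω : OL K fω
  G : OL K fG
  χ : OL K fχ
  κ : OL K fκ

theorem exists_Lip : ∃ K, Lip K := by
  obtain ⟨K1, h1⟩ := exists_OL (f := fq) (contDiff_bmp _ _)
    (hasCompactSupport_of_abs fun t => bmp_eq_zero (by norm_num))
  obtain ⟨K2, h2⟩ := exists_OL (f := fβ) (contDiff_const.mul (contDiff_bmp _ _))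
    (hasCompactSupport_of_abs (R := 1/64) fun t ht => by
      unfold fβ; rw [bmp_eq_zero (by norm_num) ht, mul_zero])
  obtain ⟨K3, h3⟩ := exists_OL (f := fq') (contDiff_bmp _ _)
    (hasCompactSupport_of_abs fun t => bmp_eq_zero (by norm_num))
  obtain ⟨K4, h4⟩ := exists_OL (f := fy1) contDiff_fy1
    (hasCompactSupport_of_abs fun t => fy1_zero)
  obtain ⟨K5, h5⟩ := exists_OL (f := fy2) (by have := contDiff_fφ; unfold fy2; fun_prop)
    (hasCompactSupport_of_abs fun t => fy2_zero)
  obtain ⟨K6, h6⟩ := exists_OL (f := fω) contDiff_fω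
    (hasCompactSupport_of_abs fun t => fω_zero')
  obtain ⟨K7, h7⟩ := exists_OL (f := fG) (by have := contDiff_fω; unfold fG; fun_prop)
    (hasCompactSupport_of_abs (R := 3) fun t ht => by unfold fG; rw [fω_zero' ht, zero_mul])
  obtain ⟨K8, h8⟩ := exists_OL (f := fχ)
    (by have := contDiff_bmp 1 2; unfold fχ; fun_prop)
    (hasCompactSupport_of_abs (R := 2) fun t ht => by
      unfold fχ; rw [bmp_eq_zero (by norm_num) ht, mul_zero])
  obtain ⟨K9, h9⟩ := exists_OL (f := fκ)
    (by
      have := contDiff_bmp 2 3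
      have h : ContDiff ℝ (⊤ : ℕ∞) fun t => fω (fy1 t) := contDiff_fω.comp contDiff_fy1
      unfold fκ; fun_prop)
    (hasCompactSupport_of_abs (R := 3) fun t ht => by
      unfold fκ; rw [bmp_eq_zero (by norm_num) ht, mul_zero])
  refine ⟨1 + |K1| + |K2| + |K3| + |K4| + |K5| + |K6| + |K7| + |K8| + |K9|, ?_, h1.mono ?_,
    h2.mono ?_, h3.mono ?_, h4.mono ?_, h5.mono ?_, h6.mono ?_, h7.mono ?_, h8.mono ?_,
    h9.mono ?_⟩
  all_goals
    linarith [abs_nonneg K1, abs_nonneg K2, abs_nonneg K3, abs_nonneg K4, abs_nonneg K5,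
      abs_nonneg K6, abs_nonneg K7, abs_nonneg K8, abs_nonneg K9, le_abs_self K1, le_abs_self K2,
      le_abs_self K3, le_abs_self K4, le_abs_self K5, le_abs_self K6, le_abs_self K7,
      le_abs_self K8, le_abs_self K9]

section
variable {A : Type} [CStarAlgebra A] [FiniteDimensional ℂ A]

theorem fc_neg_arg (f : ℝ → ℝ) {a : A} (ha : IsSelfAdjoint a) : fc f (-a) = fc (fun t => f (-t)) a := by
  have : -a = fc (fun t => -1 * t) a := by
    rw [← fc_smul, fc_id ha, neg_one_smul]
  rw [this, fc_comp _ _ ha]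
  simp

theorem fc_sub_const_arg (f : ℝ → ℝ) (c : ℝ) {a : A} (ha : IsSelfAdjoint a) :
    fc f (a - c • (1 : A)) = fc (fun t => f (t - c)) a := by
  have : a - c • (1 : A) = fc (fun t => t - c) a := by
    rw [← fc_sub, fc_id ha, fc_const c ha]
  rw [this, fc_comp _ _ ha]

theorem isSelfAdjoint_sub_const (c : ℝ) {a : A} (ha : IsSelfAdjoint a) :
    IsSelfAdjoint (a - c • (1 : A)) :=
  ha.sub ((IsSelfAdjoint.all c).smul (IsSelfAdjoint.one A))

theorem lie_self_mul_fc (f : ℝ → ℝ) {a : A} (ha : IsSelfAdjoint a) : ⁅a * a, fc f a⁆ = 0 := by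
  rw [Ring.lie_def, mul_assoc, self_mul_fc f ha, ← mul_assoc, self_mul_fc f ha, mul_assoc, sub_self]

theorem add_bra (x y z : A) : ⁅x + y, z⁆ = ⁅x, z⁆ + ⁅y, z⁆ := by
  simp only [Ring.lie_def]; noncomm_ring

theorem norm_lie_sq_le (a g : A) : ‖⁅a * a, g⁆‖ ≤ 2 * ‖a‖ * ‖⁅a, g⁆‖ := by
  rw [norm_lie_swap]
  refine (norm_lie_mul_le g a a).trans ?_
  rw [norm_lie_swap g a]
  linarith

theorem one_sub_fc (f : ℝ → ℝ) {a : A} (ha : IsSelfAdjoint a) :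
    1 - fc f a = fc (fun t => 1 - f t) a := by
  rw [← fc_one ha, fc_sub]

theorem norm_one_sub_fc_le {f : ℝ → ℝ} (h0 : ∀ t, 0 ≤ f t) (h1 : ∀ t, f t ≤ 1) {a : A}
    (ha : IsSelfAdjoint a) : ‖1 - fc f a‖ ≤ 1 := by
  rw [one_sub_fc f ha]
  refine norm_fc_le' fun t => ?_
  rw [abs_le]; constructor <;> linarith [h0 t, h1 t]

theorem lie_one_sub (x y : A) : ⁅x, 1 - y⁆ = -⁅x, y⁆ := by
  simp only [Ring.lie_def]; noncomm_ring

theorem low_state_right {K : ℝ} (L : Lip K) {h b : A} (hh : IsSelfAdjoint h) (hb : IsSelfAdjoint b)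
    {κ : ℝ} (hκ : ‖⁅h, b⁆‖ ≤ κ) (hκ1 : κ ≤ 1/256) (hn : ‖h‖ ≤ 1) :
    ‖(1 - fc fq b) * pr (Set.Icc (-(1/64)) (1/64))
      (star (h + Complex.I • b) * (h + Complex.I • b))‖ ≤ 128 * K * κ := by
  have hκ0 : 0 ≤ κ := (norm_nonneg _).trans hκ
  have key := localization (S := h + Complex.I • b) (B := b) (g := 1 - fc fq b) (κ := κ)
    (ρ := 1/64) (τ := 1/4) (by norm_num) (by norm_num) (norm_sq_le_right hh hb hκ) ?_
  · have hc : ‖⁅star (h + Complex.I • b) * (h + Complex.I • b), 1 - fc fq b⁆‖ ≤ 4 * K * κ := by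
      rw [lie_one_sub, norm_neg, star_mul_self_eq hh hb, add_bra, add_bra, lie_self_mul_fc fq hb,
        add_zero]
      have e1 : ‖⁅h, fc fq b⁆‖ ≤ K * κ := by
        rw [norm_lie_swap]
        refine (L.q.lie hb h).trans ?_
        rw [norm_lie_swap]
        have := L.one_le
        gcongr
      have e2 := norm_lie_sq_le h (fc fq b)
      have e3 := norm_lie_le (Complex.I • ⁅h, b⁆) (fc fq b)
      have e4 : ‖fc fq b‖ ≤ 1 := norm_fc_le' fun t => by
        rw [fq, abs_of_nonneg (bmp_nonneg _ _ _)]; exact bmp_le_one _ _ _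
      have e5 : ‖Complex.I • ⁅h, b⁆‖ ≤ κ := by rw [norm_smul]; simpa using hκ
      have e6 : 2 * ‖h‖ * ‖⁅h, fc fq b⁆‖ ≤ 2 * 1 * (K * κ) := by gcongr
      have e7 : 2 * ‖Complex.I • ⁅h, b⁆‖ * ‖fc fq b‖ ≤ 2 * κ * 1 := by gcongr
      have e8 : κ ≤ K * κ := by nlinarith [L.one_le]
      refine (norm_add_le _ _).trans ?_
      linarith
    have := norm_nonneg ((1 - fc fq b) * pr (Set.Icc (-(1/64)) (1/64))
      (star (h + Complex.I • b) * (h + Complex.I • b)))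
    nlinarith
  · intro z
    have : ∀ w : A, b * w = fc (fun t => t) b * w := fun w => by rw [fc_id hb]
    rw [this]
    refine le_norm_fc_mul (s := {t | 1/4 ≤ |t|}) (by norm_num) (fun t ht => ht) ?_
    rw [one_sub_fc _ hb, ← mul_assoc, pr_mul_fc_eq]
    intro t ht
    simp only [Set.mem_ofPred_eq, not_le] at ht
    rw [fq, bmp_eq_one (by norm_num) ht.le, sub_self]

theorem low_state_left {K : ℝ} (L : Lip K) {h b : A} (hh : IsSelfAdjoint h) (hb : IsSelfAdjoint b)
    {κ : ℝ} (hκ : ‖⁅h, b⁆‖ ≤ κ) (hκ1 : κ ≤ 1/256) :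
    ‖(1 - fc fq' h) * pr (Set.Icc (-(1/64)) (1/64))
      (star (h + Complex.I • b) * (h + Complex.I • b))‖ ≤ 128 * (‖b‖ + 1) * K * κ := by
  have hκ0 : 0 ≤ κ := (norm_nonneg _).trans hκ
  have key := localization (S := h + Complex.I • b) (B := h) (g := 1 - fc fq' h) (κ := κ)
    (ρ := 1/64) (τ := 3/16) (by norm_num) (by norm_num) (norm_sq_le_left hh hb hκ) ?_
  · have hc : ‖⁅star (h + Complex.I • b) * (h + Complex.I • b), 1 - fc fq' h⁆‖
        ≤ 2 * (‖b‖ + 1) * K * κ := by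
      rw [lie_one_sub, norm_neg, star_mul_self_eq hh hb, add_bra, add_bra, lie_self_mul_fc fq' hh,
        zero_add]
      have e1 : ‖⁅b, fc fq' h⁆‖ ≤ K * κ := by
        rw [norm_lie_swap]
        refine (L.q'.lie hh b).trans ?_
        have := L.one_le
        gcongr
      have e2 := norm_lie_sq_le b (fc fq' h)
      have e3 := norm_lie_le (Complex.I • ⁅h, b⁆) (fc fq' h)
      have e4 : ‖fc fq' h‖ ≤ 1 := norm_fc_le' fun t => by
        rw [fq', abs_of_nonneg (bmp_nonneg _ _ _)]; exact bmp_le_one _ _ _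
      have e5 : ‖Complex.I • ⁅h, b⁆‖ ≤ κ := by rw [norm_smul]; simpa using hκ
      have e6 : 2 * ‖b‖ * ‖⁅b, fc fq' h⁆‖ ≤ 2 * ‖b‖ * (K * κ) := by gcongr
      have e7 : 2 * ‖Complex.I • ⁅h, b⁆‖ * ‖fc fq' h‖ ≤ 2 * κ * 1 := by gcongr
      have e8 : κ ≤ K * κ := by nlinarith [L.one_le]
      refine (norm_add_le _ _).trans ?_
      linarith
    have := norm_nonneg ((1 - fc fq' h) * pr (Set.Icc (-(1/64)) (1/64))
      (star (h + Complex.I • b) * (h + Complex.I • b)))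
    nlinarith
  · intro z
    have : ∀ w : A, h * w = fc (fun t => t) h * w := fun w => by rw [fc_id hh]
    rw [this]
    refine le_norm_fc_mul (s := {t | 3/16 ≤ |t|}) (by norm_num) (fun t ht => ht) ?_
    rw [one_sub_fc _ hh, ← mul_assoc, pr_mul_fc_eq]
    intro t ht
    simp only [Set.mem_ofPred_eq, not_le] at ht
    rw [fq', bmp_eq_one (by norm_num) ht.le, sub_self]

theorem bmp_neg (r R t : ℝ) : bmp r R (-t) = bmp r R t := by
  unfold bmp; rw [mul_comm, sub_neg_eq_add, ← sub_eq_add_neg]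

theorem star_S_eq {h b : A} (hh : IsSelfAdjoint h) (hb : IsSelfAdjoint b) :
    h + Complex.I • (-b) = star (h + Complex.I • b) := by
  simp [hh.star_eq, hb.star_eq]

theorem spectrum_star_mul_self_pos {S : A} (hu : IsUnit S) {t : ℝ}
    (ht : t ∈ spectrum ℝ (star S * S)) : 0 < t := by
  refine lt_of_le_of_ne (spectrum_star_mul_self_nonneg t ht) fun h => ?_
  rw [← h] at ht
  exact spectrum.zero_notMem ℝ (hu.star.mul hu) ht

/-- The multiplier that lifts small singular values. -/
def fγ (t : ℝ) : ℝ := √((t + fβ t) / t) - 1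

theorem fβ_nonneg (t : ℝ) : 0 ≤ fβ t := mul_nonneg (by norm_num) (bmp_nonneg _ _ _)

theorem fβ_le (t : ℝ) : fβ t ≤ 1/256 := by
  have := bmp_le_one (1/256) (1/64) t
  unfold fβ; linarith

theorem fβ_add_ge {t : ℝ} (ht : 0 < t) : 1/256 ≤ t + fβ t := by
  by_cases h : t ≤ 1/256
  · unfold fβ; rw [bmp_eq_one (by norm_num) (by rwa [abs_of_pos ht])]; linarith
  · linarith [fβ_nonneg t]

theorem fγ_zero {t : ℝ} (ht : t ∉ Set.Icc (-(1/64) : ℝ) (1/64)) : fγ t = 0 := by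
  have h1 : 1/64 ≤ |t| := by
    by_contra h; push Not at h; exact ht (abs_le.1 h.le)
  have h0 : t ≠ 0 := by rintro rfl; norm_num at h1
  unfold fγ fβ
  rw [bmp_eq_zero (by norm_num) h1, mul_zero, add_zero, div_self h0]; simp

theorem fγ_add_one_sq {t : ℝ} (ht : 0 < t) : (1 + fγ t) * t * (1 + fγ t) = t + fβ t := by
  have h := Real.sq_sqrt (x := (t + fβ t) / t) (by have := fβ_nonneg t; positivity)
  unfold fγ
  have : (1 + (√((t + fβ t) / t) - 1)) * t * (1 + (√((t + fβ t) / t) - 1))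
      = √((t + fβ t) / t) ^ 2 * t := by ring
  rw [this, h]; field_simp

theorem fγ_sq_le {t : ℝ} (ht : 0 < t) : fγ t * t * fγ t ≤ 1/256 := by
  have h1 := fγ_add_one_sq ht
  have h2 : 0 ≤ fγ t := by
    unfold fγ
    have : 1 ≤ √((t + fβ t) / t) := by
      rw [Real.one_le_sqrt, one_le_div ht]; linarith [fβ_nonneg t]
    linarith
  have h3 := fβ_le t
  have : 0 ≤ fγ t * t := by positivity
  nlinarith

theorem fc_mul_self_mul_fc (f g : ℝ → ℝ) {a : A} (ha : IsSelfAdjoint a) :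
    fc f a * a * fc g a = fc (fun t => f t * t * g t) a := by
  have : fc f a * a = fc (fun t => f t * t) a := by
    conv_lhs => rw [← fc_id ha, fc_comp _ _ ha, fc_mul]
  rw [this, fc_mul]

theorem exists_fill {K : ℝ} (L : Lip K) {h b : A} (hh : IsSelfAdjoint h) (hb : IsSelfAdjoint b)
    {κ : ℝ} (hκ : ‖⁅h, b⁆‖ ≤ κ) (hκ1 : κ ≤ 1/256) (hn : ‖h‖ ≤ 1) {S : A}
    (hS : S = h + Complex.I • b) (hu : IsUnit S) :
    ∃ D : A, star (S + D) * (S + D) = star S * S + fc fβ (star S * S) ∧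
      (S + D) * star (S + D) = S * star S + fc fβ (S * star S) ∧
      ‖D‖ ≤ 1/16 ∧ ‖D * (1 - fc fq b)‖ ≤ 8 * K * κ ∧ ‖(1 - fc fq b) * D‖ ≤ 8 * K * κ ∧
      (∀ Z, ‖Z‖ ≤ 16 * ‖(S + D) * Z‖) ∧
      ‖D * pr {t | 1/4 ≤ |t|} h‖ ≤ 8 * (‖b‖ + 1) * K * κ ∧
      ‖star D * pr {t | 1/4 ≤ |t|} h‖ ≤ 8 * (‖b‖ + 1) * K * κ := by
  set X := star S * S with hX
  set Y := S * star S with hY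
  have hXsa : IsSelfAdjoint X := IsSelfAdjoint.star_mul_self S
  have hYsa : IsSelfAdjoint Y := IsSelfAdjoint.mul_star_self S
  have hpX : ∀ t ∈ spectrum ℝ X, 0 < t := fun t ht => spectrum_star_mul_self_pos hu ht
  have hpY : ∀ t ∈ spectrum ℝ Y, 0 < t := fun t ht => by
    refine spectrum_star_mul_self_pos (S := star S) hu.star ?_
    rwa [star_star]
  have hYS : ∀ f : ℝ → ℝ, fc f Y * S = S * fc f X := fun f =>
    fc_intertwine f hYsa hXsa (by rw [hX, hY, mul_assoc])
  set D := S * fc fγ X with hD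
  have hD' : D = fc fγ Y * S := (hYS fγ).symm
  have hSD : S + D = S * fc (fun t => 1 + fγ t) X := by
    rw [← fc_add (fun _ => 1), fc_one hXsa, mul_add, mul_one]
  have hSD' : S + D = fc (fun t => 1 + fγ t) Y * S := by rw [hSD, hYS]
  have h1 : star (S + D) * (S + D) = X + fc fβ X := by
    have : star (S + D) * (S + D) = fc (fun t => 1 + fγ t) X * X * fc (fun t => 1 + fγ t) X := by
      rw [hSD, star_mul, star_fc, hX]; noncomm_ring
    rw [this, fc_mul_self_mul_fc _ _ hXsa, fc_congr fun t ht => fγ_add_one_sq (hpX t ht),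
      ← fc_add, fc_id hXsa]
  have h2 : (S + D) * star (S + D) = Y + fc fβ Y := by
    have : (S + D) * star (S + D) = fc (fun t => 1 + fγ t) Y * Y * fc (fun t => 1 + fγ t) Y := by
      rw [hSD', star_mul, star_fc, hY]; noncomm_ring
    rw [this, fc_mul_self_mul_fc _ _ hYsa, fc_congr fun t ht => fγ_add_one_sq (hpY t ht),
      ← fc_add, fc_id hYsa]
  have h3 : ‖D‖ ≤ 1/16 := by
    have e : star D * D = fc fγ X * X * fc fγ X := by
      rw [hD, star_mul, star_fc, hX]; noncomm_ring
    have : ‖D‖ ^ 2 ≤ 1/256 := by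
      rw [← norm_mul_star_self', e, fc_mul_self_mul_fc _ _ hXsa]
      refine norm_fc_le (by norm_num) fun t ht => ?_
      rw [abs_of_nonneg]
      · exact fγ_sq_le (hpX t ht)
      · have := hpX t ht; nlinarith [sq_nonneg (fγ t)]
    nlinarith [norm_nonneg D]
  have hDP : D * pr (Set.Icc (-(1/64)) (1/64)) X = D := by
    rw [hD, mul_assoc, fc_mul_pr_eq fun t ht => fγ_zero ht]
  have hPD : pr (Set.Icc (-(1/64)) (1/64)) Y * D = D := by
    rw [hD', ← mul_assoc, pr_mul_fc_eq fun t ht => fγ_zero ht]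
  have hκ' : ‖⁅h, -b⁆‖ ≤ κ := by
    have : ⁅h, -b⁆ = -⁅h, b⁆ := by simp only [Ring.lie_def]; noncomm_ring
    rwa [this, norm_neg]
  have hq : fc fq (-b) = fc fq b := by
    rw [fc_neg_arg fq hb]; simp only [fq, bmp_neg]
  have lX1 : ‖(1 - fc fq b) * pr (Set.Icc (-(1/64)) (1/64)) X‖ ≤ 128 * K * κ := by
    have := low_state_right L hh hb hκ hκ1 hn
    rwa [← hS] at this
  have lY1 : ‖(1 - fc fq b) * pr (Set.Icc (-(1/64)) (1/64)) Y‖ ≤ 128 * K * κ := by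
    have := low_state_right L hh hb.neg hκ' hκ1 hn
    rwa [star_S_eq hh hb, hq, ← hS, star_star] at this
  have lX2 : ‖(1 - fc fq' h) * pr (Set.Icc (-(1/64)) (1/64)) X‖ ≤ 128 * (‖b‖ + 1) * K * κ := by
    have := low_state_left L hh hb hκ hκ1
    rwa [← hS] at this
  have lY2 : ‖(1 - fc fq' h) * pr (Set.Icc (-(1/64)) (1/64)) Y‖ ≤ 128 * (‖b‖ + 1) * K * κ := by
    have := low_state_left L hh hb.neg hκ' hκ1
    rwa [star_S_eq hh hb, ← hS, star_star, norm_neg] at this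
  have sa1 : ∀ (f : ℝ → ℝ) (c : A), star (1 - fc f c) = 1 - fc f c := fun f c => by simp
  have hZ : (1 - fc fq' h) * pr {t | 1/4 ≤ |t|} h = pr {t | 1/4 ≤ |t|} h := by
    rw [one_sub_fc _ hh]
    refine fc_mul_pr_eq_pr (fun t ht => ?_) h
    rw [fq', bmp_eq_zero (by norm_num) ht, sub_zero]
  have swap : ∀ {P g : A} {c : ℝ}, star P = P → star g = g → ‖g * P‖ ≤ c → ‖P * g‖ ≤ c := by
    intro P g c hP hg hc
    rw [← norm_star, star_mul, hP, hg]; exact hc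
  refine ⟨D, h1, h2, h3, ?_, ?_, ?_, ?_, ?_⟩
  · rw [← hDP, mul_assoc]
    refine (norm_mul_le_of_le h3 (swap (star_pr _ _) (sa1 _ _) lX1)).trans (by linarith)
  · rw [← hPD, ← mul_assoc]
    refine (norm_mul_le_of_le lY1 h3).trans (by linarith)
  · intro Z
    have e : ‖(S + D) * Z‖ ^ 2 = ‖fc (fun t => √(t + fβ t)) X * Z‖ ^ 2 := by
      rw [← norm_mul_star_self', ← norm_mul_star_self']
      congr 1
      have e1 : star ((S + D) * Z) * ((S + D) * Z) = star Z * (star (S + D) * (S + D)) * Z := by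
        rw [star_mul]; noncomm_ring
      have e2 : star (fc (fun t => √(t + fβ t)) X * Z) * (fc (fun t => √(t + fβ t)) X * Z)
          = star Z * (fc (fun t => √(t + fβ t)) X * fc (fun t => √(t + fβ t)) X) * Z := by
        rw [star_mul, star_fc]; noncomm_ring
      rw [e1, e2, h1, fc_mul]
      congr 2
      nth_rewrite 1 [← fc_id hXsa]
      rw [fc_add]
      refine fc_congr fun t ht => ?_
      exact (Real.mul_self_sqrt (by linarith [fβ_nonneg t, hpX t ht])).symm
    have e3 : ‖(S + D) * Z‖ = ‖fc (fun t => √(t + fβ t)) X * Z‖ := by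
      rwa [sq_eq_sq₀ (norm_nonneg _) (norm_nonneg _)] at e
    rw [e3]
    have hps : pr {t | 0 < t} X = 1 := by
      rw [← fc_one hXsa]
      exact fc_congr fun t ht => by simp [hpX t ht]
    have := le_norm_fc_mul (f := fun t => √(t + fβ t)) (s := {t | 0 < t}) (c := 1/16)
      (by norm_num) (fun t ht => ?_) (a := X) (z := Z) (by rw [hps, one_mul])
    · linarith
    · rw [abs_of_nonneg (Real.sqrt_nonneg _)]
      refine Real.le_sqrt_of_sq_le ?_
      have := fβ_add_ge ht
      norm_num at this ⊢
      exact this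
  · rw [← hDP, ← hZ, mul_assoc, ← mul_assoc (pr _ X)]
    have := norm_mul_le_of_le h3 (norm_mul_le_of_le (swap (star_pr _ _) (sa1 _ _) lX2)
      (norm_pr_le {t | 1/4 ≤ |t|} h))
    linarith
  · rw [← hPD, star_mul, star_pr, ← hZ, mul_assoc, ← mul_assoc (pr _ Y)]
    have := norm_mul_le_of_le ((norm_star D).le.trans h3)
      (norm_mul_le_of_le (swap (star_pr _ _) (sa1 _ _) lY2) (norm_pr_le {t | 1/4 ≤ |t|} h))
    linarith

/-- Localisation of `a` near the integer `j`. -/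
def qq (a : A) (j : ℤ) : A := fc fq (a - (j : ℝ) • (1 : A))

/-- A family of fillings of the shifted matrices `h + i (a - j)`. -/
structure Filled (K η ν : ℝ) (I : Finset ℤ) (a h : A) (D : ℤ → A) : Prop where
  one_le : 1 ≤ ν
  card_le : (I.card : ℝ) ≤ ν
  nonneg : 0 ≤ η
  small : 256 * ν * η ≤ 1
  sa : IsSelfAdjoint a
  sh : IsSelfAdjoint h
  lie_le : K * ‖⁅h, a⁆‖ ≤ η
  lip : Lip K
  bra : ∀ j ∈ I, ⁅star (h + Complex.I • (a - (j : ℝ) • (1 : A)) + D j),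
    h + Complex.I • (a - (j : ℝ) • (1 : A)) + D j⁆ =
    ⁅star (h + Complex.I • (a - (j : ℝ) • (1 : A))), h + Complex.I • (a - (j : ℝ) • (1 : A))⁆ +
    (fc fβ (star (h + Complex.I • (a - (j : ℝ) • (1 : A))) *
      (h + Complex.I • (a - (j : ℝ) • (1 : A)))) -
     fc fβ ((h + Complex.I • (a - (j : ℝ) • (1 : A))) *
      star (h + Complex.I • (a - (j : ℝ) • (1 : A)))))
  norm_le : ∀ j ∈ I, ‖D j‖ ≤ 1/16
  right : ∀ j ∈ I, ‖D j * (1 - qq a j)‖ ≤ 8 * η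
  left : ∀ j ∈ I, ‖(1 - qq a j) * D j‖ ≤ 8 * η
  inv : ∀ j ∈ I, ∀ Z, ‖Z‖ ≤ 16 * ‖(h + Complex.I • (a - (j : ℝ) • (1 : A)) + D j) * Z‖
  far : ∀ j ∈ I, ‖D j * pr {t | 1/4 ≤ |t|} h‖ ≤ 8 * ν * η
  far' : ∀ j ∈ I, ‖star (D j) * pr {t | 1/4 ≤ |t|} h‖ ≤ 8 * ν * η

theorem qq_eq {a : A} (ha : IsSelfAdjoint a) (j : ℤ) : qq a j = fc (fun t => fq (t - j)) a :=
  fc_sub_const_arg fq j ha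

theorem fq_nonneg (t : ℝ) : 0 ≤ fq t := bmp_nonneg _ _ _

theorem fq_le_one (t : ℝ) : fq t ≤ 1 := bmp_le_one _ _ _

theorem norm_qq_le (a : A) (j : ℤ) : ‖qq a j‖ ≤ 1 := norm_fc_le' fun t => by
  rw [abs_of_nonneg (fq_nonneg t)]; exact fq_le_one t

@[simp] theorem star_qq (a : A) (j : ℤ) : star (qq a j) = qq a j := star_fc _ _

theorem one_le_abs_sub_of_ne {i j : ℤ} (hij : i ≠ j) : (1 : ℝ) ≤ |(i : ℝ) - j| := by
  have : (1 : ℤ) ≤ |i - j| := Int.one_le_abs (sub_ne_zero.2 hij)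
  exact_mod_cast this

theorem qq_mul_qq {a : A} (ha : IsSelfAdjoint a) {i j : ℤ} (hij : i ≠ j) :
    qq a i * qq a j = 0 := by
  rw [qq_eq ha, qq_eq ha, fc_mul, ← fc_zero a]
  refine fc_congr fun t _ => ?_
  have h1 := one_le_abs_sub_of_ne hij
  by_cases h : 3/8 ≤ |t - i|
  · rw [fq, bmp_eq_zero (by norm_num) h, zero_mul]
  · rw [fq, bmp_eq_zero (t := t - j) (by norm_num) ?_, mul_zero]
    push Not at h
    have : (i : ℝ) - j = (t - j) - (t - i) := by ring
    rw [this] at h1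
    linarith [abs_sub (t - j) (t - i)]

theorem norm_mul_le_of_localized {X Y q r : A} {η : ℝ} (hX : ‖X‖ ≤ 1/16) (hY : ‖Y‖ ≤ 1/16)
    (hq : ‖q‖ ≤ 1) (h1 : ‖X * (1 - q)‖ ≤ 8 * η) (h2 : ‖(1 - r) * Y‖ ≤ 8 * η)
    (h0 : q * r = 0) : ‖X * Y‖ ≤ η := by
  have e : X * Y = X * (1 - q) * Y + X * q * ((1 - r) * Y) := by
    have : X * Y = X * (1 - q) * Y + X * q * ((1 - r) * Y) + X * (q * r) * Y := by noncomm_ring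
    rw [this, h0]; simp
  rw [e]
  refine (norm_add_le _ _).trans ?_
  have a1 := norm_mul_le_of_le h1 hY
  have a2 := norm_mul_le_of_le (norm_mul_le_of_le hX hq) h2
  linarith

namespace Filled
variable {K η ν : ℝ} {I : Finset ℤ} {a h : A} {D : ℤ → A}

theorem norm_star_le (F : Filled K η ν I a h D) {j : ℤ} (hj : j ∈ I) : ‖star (D j)‖ ≤ 1/16 := by
  rw [norm_star]; exact F.norm_le j hj

theorem right_star (F : Filled K η ν I a h D) {j : ℤ} (hj : j ∈ I) :
    ‖star (D j) * (1 - qq a j)‖ ≤ 8 * η := by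
  rw [← norm_star]; simpa using F.left j hj

theorem left_star (F : Filled K η ν I a h D) {j : ℤ} (hj : j ∈ I) :
    ‖(1 - qq a j) * star (D j)‖ ≤ 8 * η := by
  rw [← norm_star]; simpa using F.right j hj

theorem sum_le (F : Filled K η ν I a h D) {f : ℤ → A} {c : ℝ} (hc : 0 ≤ c)
    (hf : ∀ j ∈ I, ‖f j‖ ≤ c) : ‖∑ j ∈ I, f j‖ ≤ ν * c := by
  refine (norm_sum_le_of_le I hf).trans ?_
  rw [Finset.sum_const, nsmul_eq_mul]
  have := F.card_le
  gcongr

theorem one_le_K (F : Filled K η ν I a h D) : 1 ≤ K := F.lip.one_le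

theorem norm_lie_ha (F : Filled K η ν I a h D) : ‖⁅h, a⁆‖ ≤ η := by
  have := F.one_le_K; have := F.lie_le; nlinarith [norm_nonneg ⁅h, a⁆]

theorem norm_sum_le_eighth (F : Filled K η ν I a h D) : ‖∑ j ∈ I, D j‖ ≤ 1/8 := by
  have hη := F.nonneg
  set p : ℤ → A := fun j => pr {t | |t - j| < 1/2} a with hp
  have hpq : ∀ j, p j * qq a j = qq a j := fun j => by
    rw [qq_eq F.sa]
    refine pr_mul_fc_eq (fun t ht => ?_) a
    simp only [Set.mem_ofPred_eq, not_lt] at ht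
    exact bmp_eq_zero (by norm_num) (by linarith)
  have hqp : ∀ j, qq a j * p j = qq a j := fun j => by
    have := congrArg star (hpq j)
    simpa [hp] using this
  have h1 : ‖∑ j ∈ I, p j * (qq a j * D j * qq a j) * p j‖ ≤ 1/16 := by
    refine norm_sum_block_le I (by norm_num) p p _ (fun _ _ => pr_isSelfAdjoint _ _)
      (fun _ _ => pr_isSelfAdjoint _ _) (fun _ _ => pr_mul_self _ _) ?_ ?_ ?_
    · intro i _ j _ hij
      refine pr_mul_pr_of_disjoint ?_ a
      rw [Set.disjoint_left]
      intro t h1 h2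
      simp only [Set.mem_ofPred_eq] at h1 h2
      have := one_le_abs_sub_of_ne hij
      have e : (i : ℝ) - j = (t - j) - (t - i) := by ring
      rw [e] at this
      linarith [abs_sub (t - j) (t - i)]
    · intro i _ j _ hij
      refine pr_mul_pr_of_disjoint ?_ a
      rw [Set.disjoint_left]
      intro t h1 h2
      simp only [Set.mem_ofPred_eq] at h1 h2
      have := one_le_abs_sub_of_ne hij
      have e : (i : ℝ) - j = (t - j) - (t - i) := by ring
      rw [e] at this
      linarith [abs_sub (t - j) (t - i)]
    · intro j hj
      have b1 := norm_mul_le_of_le (norm_mul_le_of_le (norm_qq_le a j) (F.norm_le j hj))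
        (norm_qq_le a j)
      have b2 := norm_mul_le_of_le (norm_mul_le_of_le (norm_pr_le {t | |t - j| < 1/2} a) b1)
        (norm_pr_le {t | |t - j| < 1/2} a)
      linarith
  have h2 : ‖∑ j ∈ I, ((1 - qq a j) * D j + qq a j * (D j * (1 - qq a j)))‖ ≤ ν * (16 * η) := by
    refine F.sum_le (by linarith) fun j hj => ?_
    refine (norm_add_le _ _).trans ?_
    have b1 := norm_mul_le_of_le (norm_qq_le a j) (F.right j hj)
    linarith [F.left j hj]
  have e : ∑ j ∈ I, D j = ∑ j ∈ I, p j * (qq a j * D j * qq a j) * p j +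
      ∑ j ∈ I, ((1 - qq a j) * D j + qq a j * (D j * (1 - qq a j))) := by
    rw [← Finset.sum_add_distrib]
    refine Finset.sum_congr rfl fun j _ => ?_
    have : p j * (qq a j * D j * qq a j) * p j = (p j * qq a j) * D j * (qq a j * p j) := by
      noncomm_ring
    rw [this, hpq, hqp]
    noncomm_ring
  rw [e]
  refine (norm_add_le _ _).trans ?_
  have := F.small
  linarith

theorem norm_qq_mul (F : Filled K η ν I a h D) {i j : ℤ} (hi : i ∈ I) (hij : i ≠ j) :
    ‖qq a j * D i‖ ≤ 8 * η := by
  have : qq a j * D i = qq a j * ((1 - qq a i) * D i) := by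
    rw [← mul_assoc, mul_sub, qq_mul_qq F.sa hij.symm, mul_one, sub_zero]
  rw [this]
  have := norm_mul_le_of_le (norm_qq_le a j) (F.left i hi)
  linarith

theorem norm_mul_qq (F : Filled K η ν I a h D) {i j : ℤ} (hi : i ∈ I) (hij : i ≠ j) :
    ‖D i * qq a j‖ ≤ 8 * η := by
  have : D i * qq a j = D i * (1 - qq a i) * qq a j := by
    rw [mul_assoc, sub_mul, qq_mul_qq F.sa hij, one_mul, sub_zero]
  rw [this]
  have := norm_mul_le_of_le (F.right i hi) (norm_qq_le a j)
  linarith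

theorem norm_lie_qq_sum (F : Filled K η ν I a h D) (j : ℤ) :
    ‖⁅qq a j, ∑ i ∈ I, D i⁆‖ ≤ ν * (16 * η) := by
  rw [bra_sum]
  refine F.sum_le (by linarith [F.nonneg]) fun i hi => ?_
  by_cases hij : i = j
  · subst hij
    have : ⁅qq a i, D i⁆ = D i * (1 - qq a i) - (1 - qq a i) * D i := by
      rw [Ring.lie_def]; noncomm_ring
    rw [this]
    refine (norm_sub_le _ _).trans ?_
    linarith [F.left i hi, F.right i hi]
  · rw [Ring.lie_def]
    refine (norm_sub_le _ _).trans ?_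
    linarith [F.norm_qq_mul hi hij, F.norm_mul_qq hi hij]

end Filled

/-- The real part, as an element of the algebra. -/
def rePt (x : A) : A := (1/2 : ℂ) • (x + star x)
/-- The imaginary part, as an element of the algebra. -/
def imPt (x : A) : A := (-Complex.I/2 : ℂ) • (x - star x)

theorem rePt_sa (x : A) : IsSelfAdjoint (rePt x) := by
  simp [rePt, isSelfAdjoint_iff, add_comm]

theorem imPt_sa (x : A) : IsSelfAdjoint (imPt x) := by
  rw [isSelfAdjoint_iff, imPt, star_smul, star_sub, star_star]
  simp [neg_div, ← smul_neg]

theorem rePt_add_imPt (x : A) : rePt x + Complex.I • imPt x = x := by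
  unfold rePt imPt
  rw [smul_smul]
  have : Complex.I * (-Complex.I/2) = 1/2 := by
    have := Complex.I_mul_I; linear_combination (-1/2 : ℂ) * this
  rw [this, ← smul_add]
  have : x + star x + (x - star x) = (2 : ℂ) • x := by rw [two_smul]; abel
  rw [this, smul_smul]; norm_num

theorem norm_rePt_mul_le {x z : A} {c : ℝ} (h1 : ‖x * z‖ ≤ c) (h2 : ‖star x * z‖ ≤ c) :
    ‖rePt x * z‖ ≤ c := by
  rw [rePt, smul_mul_assoc, norm_smul, add_mul]
  have := norm_add_le (x * z) (star x * z)
  norm_num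
  linarith

theorem norm_rePt_le {x : A} {c : ℝ} (h1 : ‖x‖ ≤ c) : ‖rePt x‖ ≤ c := by
  have := norm_rePt_mul_le (z := (1 : A)) (x := x) (c := c) (by simpa) (by simpa)
  simpa using this

theorem norm_imPt_le {x : A} {c : ℝ} (h1 : ‖x‖ ≤ c) : ‖imPt x‖ ≤ c := by
  rw [imPt, norm_smul]
  have := norm_sub_le x (star x)
  rw [norm_star] at this
  simp
  linarith

theorem norm_lie_rePt_le {x q : A} {c : ℝ} (hq : IsSelfAdjoint q) (h1 : ‖⁅q, x⁆‖ ≤ c) :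
    ‖⁅q, rePt x⁆‖ ≤ c := by
  rw [rePt, norm_lie_smul, bra_add]
  have h2 : ‖⁅q, star x⁆‖ ≤ c := by
    rw [norm_lie_swap, norm_lie_star_left x hq, norm_lie_swap]; exact h1
  have := norm_add_le ⁅q, x⁆ ⁅q, star x⁆
  norm_num
  linarith

theorem norm_lie_imPt_le {x q : A} {c : ℝ} (hq : IsSelfAdjoint q) (h1 : ‖⁅q, x⁆‖ ≤ c) :
    ‖⁅q, imPt x⁆‖ ≤ c := by
  rw [imPt, norm_lie_smul, bra_sub]
  have h2 : ‖⁅q, star x⁆‖ ≤ c := by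
    rw [norm_lie_swap, norm_lie_star_left x hq, norm_lie_swap]; exact h1
  have := norm_sub_le ⁅q, x⁆ ⁅q, star x⁆
  simp
  linarith

theorem lie_star_self_eq {h b : A} (hh : IsSelfAdjoint h) (hb : IsSelfAdjoint b) :
    ⁅star (h + Complex.I • b), h + Complex.I • b⁆ = (2 * Complex.I) • ⁅h, b⁆ := by
  simp only [star_add, star_smul, hh.star_eq, hb.star_eq, Ring.lie_def, add_mul, mul_add,
    smul_mul_assoc, mul_smul_comm, smul_sub, smul_add]
  have e : Complex.I • Complex.I • (b * b) = -(b * b) := by rw [smul_smul]; simp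
  simp only [Complex.star_def, Complex.conj_I, neg_smul, smul_neg, e, mul_smul, two_smul]
  abel

namespace Filled
variable {K η ν : ℝ} {I : Finset ℤ} {a h : A} {D : ℤ → A}

/-- The perturbed first matrix. -/
def na (I : Finset ℤ) (a : A) (D : ℤ → A) : A := a + imPt (∑ j ∈ I, D j)
/-- The perturbed second matrix. -/
def nh (I : Finset ℤ) (h : A) (D : ℤ → A) : A := h + rePt (∑ j ∈ I, D j)

theorem na_sa (F : Filled K η ν I a h D) : IsSelfAdjoint (na I a D) := F.sa.add (imPt_sa _)
theorem nh_sa (F : Filled K η ν I a h D) : IsSelfAdjoint (nh I h D) := F.sh.add (rePt_sa _)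

theorem norm_na_sub (F : Filled K η ν I a h D) : ‖na I a D - a‖ ≤ 1/8 := by
  rw [na, add_sub_cancel_left]; exact norm_imPt_le F.norm_sum_le_eighth

theorem norm_nh_sub (F : Filled K η ν I a h D) : ‖nh I h D - h‖ ≤ 1/8 := by
  rw [nh, add_sub_cancel_left]; exact norm_rePt_le F.norm_sum_le_eighth

theorem nT_eq : nh I h D + Complex.I • na I a D = h + Complex.I • a + ∑ j ∈ I, D j := by
  conv_rhs => rw [← rePt_add_imPt (∑ j ∈ I, D j)]
  rw [na, nh, smul_add]; abel

theorem norm_far (F : Filled K η ν I a h D) :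
    ‖(nh I h D - h) * pr {t | 1/4 ≤ |t|} h‖ ≤ 8 * ν ^ 2 * η := by
  have h0 : 0 ≤ 8 * ν * η := by have := F.nonneg; have := F.one_le; positivity
  rw [nh, add_sub_cancel_left]
  refine norm_rePt_mul_le ?_ ?_
  · rw [Finset.sum_mul]
    refine (F.sum_le h0 F.far).trans (by ring_nf; rfl)
  · rw [star_sum, Finset.sum_mul]
    refine (F.sum_le h0 F.far').trans (by ring_nf; rfl)

theorem norm_lie_qq_na (F : Filled K η ν I a h D) (j : ℤ) :
    ‖⁅qq a j, na I a D⁆‖ ≤ 16 * ν * η := by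
  have h1 : ⁅qq a j, a⁆ = 0 := by
    rw [qq_eq F.sa, Ring.lie_def, self_mul_fc _ F.sa, sub_self]
  rw [na, bra_add, h1, zero_add]
  refine (norm_lie_imPt_le (star_qq a j) (F.norm_lie_qq_sum j)).trans (by ring_nf; rfl)

theorem norm_lie_qq_nh (F : Filled K η ν I a h D) (j : ℤ) :
    ‖⁅qq a j, nh I h D⁆‖ ≤ 17 * ν * η := by
  have h1 : ‖⁅qq a j, h⁆‖ ≤ η := by
    refine (F.lip.q.lie (isSelfAdjoint_sub_const _ F.sa) h).trans ?_
    have : ⁅a - (j : ℝ) • (1 : A), h⁆ = ⁅a, h⁆ := by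
      simp [Ring.lie_def, sub_mul, mul_sub]
    rw [this, norm_lie_swap]
    exact F.lie_le
  rw [nh, bra_add]
  refine (norm_add_le _ _).trans ?_
  have := norm_lie_rePt_le (star_qq a j) (F.norm_lie_qq_sum j)
  nlinarith [F.one_le, F.nonneg]

theorem norm_lie_na_nh (F : Filled K η ν I a h D) :
    ‖⁅nh I h D, na I a D⁆‖ ≤ 3 * ν ^ 2 * η := by
  have hη := F.nonneg
  have hν := F.one_le
  have key := lie_star_self_eq F.nh_sa F.na_sa
  rw [nT_eq] at key
  have e : ⁅star (h + Complex.I • a + ∑ j ∈ I, D j), h + Complex.I • a + ∑ j ∈ I, D j⁆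
      = (2 * Complex.I) • ⁅h, a⁆ +
      ∑ i ∈ I, ((fc fβ (star (h + Complex.I • (a - (i : ℝ) • (1 : A))) *
          (h + Complex.I • (a - (i : ℝ) • (1 : A)))) -
        fc fβ ((h + Complex.I • (a - (i : ℝ) • (1 : A))) *
          star (h + Complex.I • (a - (i : ℝ) • (1 : A))))) +
        ∑ j ∈ I.erase i, ⁅star (D i), D j⁆) := by
    have e1 : ∀ (T d : A), ⁅star (T + d), T + d⁆ = ⁅star T, T⁆ + (⁅star T, d⁆ + ⁅star d, T⁆)
        + ⁅star d, d⁆ := by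
      intro T d; simp only [star_add, Ring.lie_def]; noncomm_ring
    rw [e1, lie_star_self_eq F.sh F.sa, add_assoc]
    congr 1
    have e2 : ⁅star (∑ j ∈ I, D j), ∑ j ∈ I, D j⁆ = ∑ i ∈ I, ∑ j ∈ I, ⁅star (D i), D j⁆ := by
      simp only [Ring.lie_def, star_sum, Finset.sum_sub_distrib, Finset.mul_sum, Finset.sum_mul]
      rw [Finset.sum_comm]
    have e3 : ⁅star (h + Complex.I • a), ∑ j ∈ I, D j⁆ + ⁅star (∑ j ∈ I, D j), h + Complex.I • a⁆
        = ∑ i ∈ I, (⁅star (h + Complex.I • a), D i⁆ + ⁅star (D i), h + Complex.I • a⁆) := by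
      simp only [Ring.lie_def, star_sum, Finset.sum_sub_distrib, Finset.mul_sum, Finset.sum_mul,
        Finset.sum_add_distrib]
    rw [e2, e3, ← Finset.sum_add_distrib]
    refine Finset.sum_congr rfl fun i hi => ?_
    rw [← Finset.add_sum_erase I _ hi, ← add_assoc]
    congr 1
    have b1 := F.bra i hi
    rw [e1] at b1
    have b2 : ⁅star (h + Complex.I • (a - (i : ℝ) • (1 : A))), D i⁆ +
        ⁅star (D i), h + Complex.I • (a - (i : ℝ) • (1 : A))⁆
        = ⁅star (h + Complex.I • a), D i⁆ + ⁅star (D i), h + Complex.I • a⁆ := by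
      simp only [Ring.lie_def, star_add, star_smul, star_sub, smul_sub, mul_add, mul_sub, add_mul,
        sub_mul, smul_mul_assoc, mul_smul_comm, one_mul, mul_one, star_one]
      abel
    rw [b2, add_assoc] at b1
    exact add_left_cancel b1
  have hsum : ‖∑ i ∈ I, ((fc fβ (star (h + Complex.I • (a - (i : ℝ) • (1 : A))) *
          (h + Complex.I • (a - (i : ℝ) • (1 : A)))) -
        fc fβ ((h + Complex.I • (a - (i : ℝ) • (1 : A))) *
          star (h + Complex.I • (a - (i : ℝ) • (1 : A))))) +
        ∑ j ∈ I.erase i, ⁅star (D i), D j⁆)‖ ≤ ν * (2 * η + ν * (2 * η)) := by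
    refine F.sum_le (by positivity) fun i hi => (norm_add_le _ _).trans (add_le_add ?_ ?_)
    · refine (F.lip.β.sub (IsSelfAdjoint.star_mul_self _) (IsSelfAdjoint.mul_star_self _)).trans ?_
      rw [← Ring.lie_def, lie_star_self_eq F.sh (isSelfAdjoint_sub_const _ F.sa), norm_smul]
      have : ⁅h, a - (i : ℝ) • (1 : A)⁆ = ⁅h, a⁆ := by
        simp [Ring.lie_def, sub_mul, mul_sub]
      rw [this]
      have := F.lie_le
      simp
      linarith
    · have hb : ∀ j ∈ I.erase i, ‖⁅star (D i), D j⁆‖ ≤ 2 * η := by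
        intro j hj
        have hji := Finset.ne_of_mem_erase hj
        have hj' := Finset.mem_of_mem_erase hj
        rw [Ring.lie_def]
        refine (norm_sub_le _ _).trans ?_
        have c1 := norm_mul_le_of_localized (F.norm_star_le hi) (F.norm_le j hj') (norm_qq_le a i)
          (F.right_star hi) (F.left j hj') (qq_mul_qq F.sa hji.symm)
        have c2 := norm_mul_le_of_localized (F.norm_le j hj') (F.norm_star_le hi) (norm_qq_le a j)
          (F.right j hj') (F.left_star hi) (qq_mul_qq F.sa hji)
        linarith
      refine (norm_sum_le_of_le _ hb).trans ?_
      rw [Finset.sum_const, nsmul_eq_mul]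
      have c3 : ((I.erase i).card : ℝ) ≤ ν :=
        (Nat.cast_le.2 (Finset.card_erase_le)).trans F.card_le
      gcongr
  rw [e] at key
  have n1 : ‖(2 * Complex.I) • ⁅nh I h D, na I a D⁆‖ = 2 * ‖⁅nh I h D, na I a D⁆‖ := by
    rw [norm_smul]; simp
  have n2 : ‖(2 * Complex.I) • ⁅h, a⁆‖ = 2 * ‖⁅h, a⁆‖ := by
    rw [norm_smul]; simp
  rw [← key] at n1
  have n3 := norm_add_le_of_le n2.le hsum
  rw [n1] at n3
  have n4 := F.norm_lie_ha
  have n5 : η ≤ ν ^ 2 * η := by nlinarith [mul_nonneg (by linarith : 0 ≤ ν) hη]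
  have n6 : ν * η ≤ ν ^ 2 * η := by nlinarith [mul_nonneg (by linarith : 0 ≤ ν) hη]
  nlinarith

end Filled
/-- The spectral projection onto a small window around an integer. -/
def win (a : A) (k : ℤ) : A := pr (Set.Icc (k - 1/64 : ℝ) (k + 1/64)) a

theorem sub_smul_eq_fc (c : ℝ) {a : A} (ha : IsSelfAdjoint a) :
    a - c • (1 : A) = fc (fun t => t - c) a := by
  rw [← fc_sub, fc_id ha, fc_const c ha]

theorem norm_sub_mul_win {a : A} (ha : IsSelfAdjoint a) (k : ℤ) (x : A) :
    ‖x * ((a - (k : ℝ) • (1 : A)) * win a k)‖ ≤ 1/64 * ‖x * win a k‖ := by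
  have e : (a - (k : ℝ) • (1 : A)) * win a k = win a k * ((a - (k : ℝ) • (1 : A)) * win a k) := by
    rw [sub_smul_eq_fc _ ha, win, ← mul_assoc, pr, fc_mul_comm _ (fun t => t - (k : ℝ)), ← pr,
      mul_assoc, pr_mul_self]
  rw [e, ← mul_assoc, mul_comm]
  refine norm_mul_le_of_le le_rfl ?_
  rw [sub_smul_eq_fc _ ha]
  refine norm_fc_mul_pr_le (by norm_num) (fun t ht => ?_) a
  rw [abs_le]; constructor <;> linarith [ht.1, ht.2]

namespace Filled
variable {K η ν : ℝ} {I : Finset ℤ} {a h : A} {D : ℤ → A}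

theorem norm_qq_win (F : Filled K η ν I a h D) {i k : ℤ} (hik : i ≠ k) :
    ‖qq a i * win (na I a D) k‖ ≤ 64 * ν * η := by
  set P := win (na I a D) k with hP
  have hη := F.nonneg
  have hν := F.one_le
  have h0 : 0 ≤ ν * η := by positivity
  have u1 : ‖(na I a D - (k : ℝ) • (1 : A)) * (qq a i * P)‖ ≤ 1/64 * ‖qq a i * P‖ + 16 * ν * η := by
    have e : (na I a D - (k : ℝ) • (1 : A)) * (qq a i * P) =
        qq a i * ((na I a D - (k : ℝ) • (1 : A)) * P) - ⁅qq a i, na I a D⁆ * P := by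
      simp only [Ring.lie_def, sub_mul, mul_sub, smul_mul_assoc, mul_smul_comm, one_mul]
      noncomm_ring
    rw [e]
    refine (norm_sub_le _ _).trans (add_le_add (norm_sub_mul_win F.na_sa k _) ?_)
    exact (norm_mul_le_of_le (F.norm_lie_qq_na i) (norm_pr_le _ _ : ‖P‖ ≤ 1)).trans
      (mul_one _).le
  have l1 : 5/8 * ‖qq a i * P‖ ≤ ‖(a - (k : ℝ) • (1 : A)) * (qq a i * P)‖ := by
    rw [sub_smul_eq_fc _ F.sa]
    refine le_norm_fc_mul (s := {t | |t - i| < 3/8}) (by norm_num) (fun t ht => ?_) ?_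
    · simp only [Set.mem_ofPred_eq] at ht
      have := one_le_abs_sub_of_ne hik
      have e : (i : ℝ) - k = (t - k) - (t - i) := by ring
      rw [e] at this
      linarith [abs_sub (t - k) (t - i)]
    · rw [← mul_assoc, qq_eq F.sa, pr_mul_fc_eq]
      intro t ht
      simp only [Set.mem_ofPred_eq, not_lt] at ht
      exact bmp_eq_zero (by norm_num) ht
  have l2 : ‖(a - (k : ℝ) • (1 : A)) * (qq a i * P)‖ ≤
      ‖(na I a D - (k : ℝ) • (1 : A)) * (qq a i * P)‖ + 1/8 * ‖qq a i * P‖ := by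
    have e : (a - (k : ℝ) • (1 : A)) * (qq a i * P) =
      (na I a D - (k : ℝ) • (1 : A)) * (qq a i * P) - (na I a D - a) * (qq a i * P) := by
      noncomm_ring
    rw [e]
    exact (norm_sub_le _ _).trans (add_le_add le_rfl (norm_mul_le_of_le F.norm_na_sub le_rfl))
  have := norm_nonneg (qq a i * P)
  linarith

theorem norm_fc_win (F : Filled K η ν I a h D) {y : ℝ → ℝ} (hy : OL K y)
    (hy1 : ∀ t, |y t| ≤ 1) (hy0 : ∀ t, 1/64 ≤ |t| → y t = 0) {k : ℤ} (hk : k ∈ I) :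
    ‖fc y (nh I h D) * win (na I a D) k‖ ≤ 600 * K * ν ^ 2 * η := by
  have hη := F.nonneg
  have hν := F.one_le
  have hK := F.one_le_K
  set h' := nh I h D with hh'
  set a' := na I a D with ha'
  set P := win a' k with hP
  set Z := fc y h' * P with hZ
  have hP1 : ‖P‖ ≤ 1 := norm_pr_le _ _
  have hy1' : ‖fc y h'‖ ≤ 1 := norm_fc_le' hy1
  have hl : ‖⁅a', fc y h'⁆‖ ≤ K * (3 * ν ^ 2 * η) := by
    rw [norm_lie_swap]
    refine (hy.lie F.nh_sa a').trans ?_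
    have := F.norm_lie_na_nh
    gcongr
  have b1 : ‖h' * Z‖ ≤ 1/64 * ‖Z‖ := by
    have e : h' * Z = h' * pr (Set.Icc (-(1/64)) (1/64)) h' * Z := by
      rw [mul_assoc, hZ, ← mul_assoc (pr _ _), pr_mul_fc_eq]
      intro t ht
      refine hy0 t ?_
      by_contra hc
      push Not at hc
      exact ht (abs_le.1 hc.le)
    rw [e]
    refine norm_mul_le_of_le ?_ le_rfl
    have := norm_fc_mul_pr_le (f := fun t => t) (s := Set.Icc (-(1/64)) (1/64)) (c := 1/64)
      (by norm_num) (fun t ht => abs_le.2 ht) h'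
    rwa [fc_id F.nh_sa] at this
  have b2 : ‖(a' - (k : ℝ) • (1 : A)) * Z‖ ≤ 1/64 * ‖Z‖ + K * (3 * ν ^ 2 * η) := by
    have e : (a' - (k : ℝ) • (1 : A)) * Z =
        fc y h' * ((a' - (k : ℝ) • (1 : A)) * P) + ⁅a', fc y h'⁆ * P := by
      simp only [hZ, Ring.lie_def, sub_mul, mul_sub, smul_mul_assoc, mul_smul_comm, one_mul]
      noncomm_ring
    rw [e]
    refine (norm_add_le _ _).trans (add_le_add (norm_sub_mul_win F.na_sa k _) ?_)
    simpa using norm_mul_le_of_le hl hP1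
  have b3 : ∀ i ∈ I.erase k, ‖D i * Z‖ ≤ 14 * K * ν * η := by
    intro i hi
    have hik := Finset.ne_of_mem_erase hi
    have hi' := Finset.mem_of_mem_erase hi
    have e : D i * Z = D i * (1 - qq a i) * Z + D i * (⁅qq a i, fc y h'⁆ * P
        + fc y h' * (qq a i * P)) := by
      simp only [hZ, Ring.lie_def]; noncomm_ring
    have hZ1 : ‖Z‖ ≤ 1 := by simpa using norm_mul_le_of_le hy1' hP1
    have c1 := norm_mul_le_of_le (F.right i hi') hZ1
    have c2 : ‖⁅qq a i, fc y h'⁆‖ ≤ K * (17 * ν * η) := by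
      rw [norm_lie_swap]
      refine (hy.lie F.nh_sa _).trans ?_
      have := F.norm_lie_qq_nh i
      rw [norm_lie_swap] at this
      gcongr
    have c3 := norm_mul_le_of_le c2 hP1
    have c4 := norm_mul_le_of_le hy1' (F.norm_qq_win hik)
    have c5 := norm_mul_le_of_le (F.norm_le i hi') (norm_add_le_of_le c3 c4)
    rw [e]
    refine (norm_add_le_of_le c1 c5).trans ?_
    have c6 : η ≤ K * ν * η := by
      have : 1 ≤ K * ν := by nlinarith
      nlinarith
    have c7 : ν * η ≤ K * ν * η := by
      have : 0 ≤ ν * η := by positivity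
      nlinarith
    linarith
  have b4 : ‖∑ i ∈ I.erase k, D i * Z‖ ≤ ν * (14 * K * ν * η) := by
    refine (norm_sum_le_of_le _ b3).trans ?_
    rw [Finset.sum_const, nsmul_eq_mul]
    have c3 : ((I.erase k).card : ℝ) ≤ ν :=
      (Nat.cast_le.2 (Finset.card_erase_le)).trans F.card_le
    gcongr
  have b5 := F.inv k hk Z
  have e : (h + Complex.I • (a - (k : ℝ) • (1 : A)) + D k) * Z =
      h' * Z + Complex.I • ((a' - (k : ℝ) • (1 : A)) * Z) - ∑ i ∈ I.erase k, D i * Z := by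
    have e1 : h + Complex.I • (a - (k : ℝ) • (1 : A)) + D k =
        h' + Complex.I • (a' - (k : ℝ) • (1 : A)) - ∑ i ∈ I.erase k, D i := by
      have := nT_eq (I := I) (h := h) (a := a) (D := D)
      rw [← Finset.add_sum_erase I _ hk] at this
      calc _ = h + Complex.I • a + (D k + ∑ i ∈ I.erase k, D i)
            - Complex.I • (k : ℝ) • (1 : A) - ∑ i ∈ I.erase k, D i := by rw [smul_sub]; abel
        _ = _ := by rw [← this, smul_sub]; abel
    rw [e1, sub_mul, add_mul, smul_mul_assoc, Finset.sum_mul]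
  rw [e] at b5
  have b6 : ‖h' * Z + Complex.I • ((a' - (k : ℝ) • (1 : A)) * Z) - ∑ i ∈ I.erase k, D i * Z‖ ≤
      1/64 * ‖Z‖ + (1/64 * ‖Z‖ + K * (3 * ν ^ 2 * η)) + ν * (14 * K * ν * η) := by
    refine norm_sub_le_of_le (norm_add_le_of_le b1 ?_) b4
    rw [norm_smul]; simpa using b2
  have : 0 ≤ K * ν ^ 2 * η := by positivity
  nlinarith

theorem pr_Ici_eq {c : ℝ} (hc : 0 ≤ c) {k : ℝ} (a : A) :
    pr (Set.Ici k) a = pr (Set.Ici k) a * pr (Set.Icc (k - c) (k + c)) a + pr (Set.Ioi (k + c)) a := by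
  rw [pr_mul_pr]
  unfold pr
  rw [fc_add]
  refine fc_congr fun t _ => ?_
  rcases lt_or_ge t k with h1 | h1
  · have h2 : ¬ k ≤ t := by linarith
    have h3 : ¬ k + c < t := by linarith
    simp [Set.indicator, h2, h3]
  · rcases le_or_gt t (k + c) with h2 | h2
    · have h3 : k - c ≤ t := by linarith
      have h4 : k ≤ t + c := by linarith
      simp [Set.indicator, h1, h2, h4, not_lt.2 h2]
    · simp [Set.indicator, h1, h2, not_le.2 h2]

theorem norm_block (F : Filled K η ν I a h D) {y : ℝ → ℝ} (hy : OL K y)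
    (hy1 : ∀ t, |y t| ≤ 1) (hy0 : ∀ t, 1/64 ≤ |t| → y t = 0) {k : ℤ} (hk : k ∈ I) :
    ‖pr (Set.Ici (k : ℝ)) (na I a D) * fc y (nh I h D) * (1 - pr (Set.Ici (k : ℝ)) (na I a D))‖
      ≤ 800 * K * ν ^ 2 * η := by
  have hη := F.nonneg
  have hν := F.one_le
  have hK := F.one_le_K
  set h' := nh I h D with hh'
  set a' := na I a D with ha'
  have hl : ‖⁅a', fc y h'⁆‖ ≤ K * (3 * ν ^ 2 * η) := by
    rw [norm_lie_swap]
    refine (hy.lie F.nh_sa a').trans ?_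
    have := F.norm_lie_na_nh
    gcongr
  rw [← pr_compl _ F.na_sa]
  set R := pr (Set.Ici (k : ℝ)) a' with hR
  have e : R = R * win a' k + pr (Set.Ioi (k + 1/64 : ℝ)) a' := by
    exact pr_Ici_eq (by norm_num) a'
  have b1 : ‖R * (win a' k * fc y h') * pr (Set.Ici (k : ℝ))ᶜ a'‖ ≤ 600 * K * ν ^ 2 * η := by
    have c := F.norm_fc_win hy hy1 hy0 hk
    rw [← norm_star, star_mul, star_fc, win, star_pr, ← win] at c
    simpa using norm_mul_le_of_le (norm_mul_le_of_le (norm_pr_le (Set.Ici (k : ℝ)) a') c)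
      (norm_pr_le (Set.Ici (k : ℝ))ᶜ a')
  have b2 := sylvester_lie (s := Set.Ioi (k + 1/64 : ℝ)) (t := (Set.Ici (k : ℝ))ᶜ)
    (α := k + 1/64) (g := 1/64) (by norm_num) (fun x hx => (Set.mem_Ioi.1 hx).le)
    (fun x hx => by simp at hx; linarith) (fc y h') F.na_sa
  rw [← ha'] at b2
  have e2 : R * fc y h' * pr (Set.Ici (k : ℝ))ᶜ a' =
      R * (win a' k * fc y h') * pr (Set.Ici (k : ℝ))ᶜ a' +
      pr (Set.Ioi (k + 1/64 : ℝ)) a' * fc y h' * pr (Set.Ici (k : ℝ))ᶜ a' := by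
    conv_lhs => rw [e]
    noncomm_ring
  rw [e2]
  refine (norm_add_le _ _).trans ?_
  have : 0 ≤ K * ν ^ 2 * η := by positivity
  linarith

theorem norm_lie_pr (F : Filled K η ν I a h D) {y : ℝ → ℝ} (hy : OL K y)
    (hy1 : ∀ t, |y t| ≤ 1) (hy0 : ∀ t, 1/64 ≤ |t| → y t = 0) {k : ℤ} (hk : k ∈ I)
    (hk1 : k + 1 ∈ I) :
    ‖⁅pr (Set.Ico (k : ℝ) (k + 1)) (na I a D), fc y (nh I h D)⁆‖ ≤ 3200 * K * ν ^ 2 * η := by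
  have key : ∀ k ∈ I, ‖⁅fc y (nh I h D), pr (Set.Ici (k : ℝ)) (na I a D)⁆‖
      ≤ 1600 * K * ν ^ 2 * η := by
    intro k hk
    have b := F.norm_block hy hy1 hy0 hk
    set R := pr (Set.Ici (k : ℝ)) (na I a D)
    have b' := b
    rw [← norm_star] at b'
    have sR : star R = R := star_pr _ _
    simp only [star_mul, star_sub, star_one, sR, star_fc] at b'
    have e : ⁅fc y (nh I h D), R⁆ = (1 - R) * (fc y (nh I h D) * R) - R * fc y (nh I h D) * (1 - R) := by
      rw [Ring.lie_def]; noncomm_ring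
    rw [e]
    exact (norm_sub_le _ _).trans (by linarith)
  have e : pr (Set.Ico (k : ℝ) (k + 1)) (na I a D) =
      pr (Set.Ici (k : ℝ)) (na I a D) - pr (Set.Ici ((k + 1 : ℤ) : ℝ)) (na I a D) := by
    unfold pr
    rw [fc_sub]
    refine fc_congr fun t _ => ?_
    push_cast
    by_cases h1 : (k : ℝ) ≤ t <;> by_cases h2 : (k : ℝ) + 1 ≤ t
    · simp [Set.indicator, h1, h2]
    · simp [Set.indicator, h1, h2]
    · linarith
    · simp [Set.indicator, h1, h2]
  rw [norm_lie_swap, e, bra_sub]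
  refine (norm_sub_le _ _).trans ?_
  linarith [key k hk, key _ hk1]

end Filled

theorem exists_filled {K κ : ℝ} (L : Lip K) {a h : A} (ha : IsSelfAdjoint a) (hh : IsSelfAdjoint h)
    (M : ℕ) (hM : ‖a‖ ≤ M - 2) (hn : ‖h‖ ≤ 1) (hκ : ‖⁅h, a⁆‖ ≤ κ)
    (hs : 256 * (2 * M + 1) * (K * κ) ≤ 1)
    (hu : ∀ j ∈ Finset.Icc (-(M : ℤ)) M, IsUnit (h + Complex.I • (a - (j : ℝ) • (1 : A)))) :
    ∃ D, Filled K (K * κ) (2 * M + 1) (Finset.Icc (-(M : ℤ)) M) a h D := by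
  have hκ0 : 0 ≤ κ := (norm_nonneg _).trans hκ
  have hK := L.one_le
  have hM0 : (0 : ℝ) ≤ M := Nat.cast_nonneg M
  have hκ1 : κ ≤ 1/256 := by
    have h1 : κ ≤ K * κ := by nlinarith
    have h2 : 0 ≤ M * (K * κ) := by positivity
    nlinarith
  have hfill : ∀ j : ℤ, ∃ D : A, j ∈ Finset.Icc (-(M : ℤ)) M →
      star (h + Complex.I • (a - (j : ℝ) • (1 : A)) + D) *
        (h + Complex.I • (a - (j : ℝ) • (1 : A)) + D) =
        star (h + Complex.I • (a - (j : ℝ) • (1 : A))) *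
          (h + Complex.I • (a - (j : ℝ) • (1 : A))) +
        fc fβ (star (h + Complex.I • (a - (j : ℝ) • (1 : A))) *
          (h + Complex.I • (a - (j : ℝ) • (1 : A)))) ∧
      (h + Complex.I • (a - (j : ℝ) • (1 : A)) + D) *
        star (h + Complex.I • (a - (j : ℝ) • (1 : A)) + D) =
        (h + Complex.I • (a - (j : ℝ) • (1 : A))) *
          star (h + Complex.I • (a - (j : ℝ) • (1 : A))) +
        fc fβ ((h + Complex.I • (a - (j : ℝ) • (1 : A))) *
          star (h + Complex.I • (a - (j : ℝ) • (1 : A)))) ∧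
      ‖D‖ ≤ 1/16 ∧ ‖D * (1 - qq a j)‖ ≤ 8 * K * κ ∧ ‖(1 - qq a j) * D‖ ≤ 8 * K * κ ∧
      (∀ Z, ‖Z‖ ≤ 16 * ‖(h + Complex.I • (a - (j : ℝ) • (1 : A)) + D) * Z‖) ∧
      ‖D * pr {t | 1/4 ≤ |t|} h‖ ≤ 8 * (‖a - (j : ℝ) • (1 : A)‖ + 1) * K * κ ∧
      ‖star D * pr {t | 1/4 ≤ |t|} h‖ ≤ 8 * (‖a - (j : ℝ) • (1 : A)‖ + 1) * K * κ := by
    intro j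
    by_cases hj : j ∈ Finset.Icc (-(M : ℤ)) M
    · obtain ⟨D, hD⟩ := exists_fill L hh (isSelfAdjoint_sub_const (j : ℝ) ha) (κ := κ)
        (by
          have : ⁅h, a - (j : ℝ) • (1 : A)⁆ = ⁅h, a⁆ := by simp [Ring.lie_def, sub_mul, mul_sub]
          rwa [this]) hκ1 hn rfl (hu j hj)
      exact ⟨D, fun _ => hD⟩
    · exact ⟨0, fun h => absurd h hj⟩
  choose D hD using hfill
  have hb : ∀ j ∈ Finset.Icc (-(M : ℤ)) M, ‖a - (j : ℝ) • (1 : A)‖ + 1 ≤ 2 * M + 1 := by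
    intro j hj
    have h1 := norm_sub_le a ((j : ℝ) • (1 : A))
    have h2 : ‖(j : ℝ) • (1 : A)‖ ≤ M := by
      rw [norm_smul]
      rw [Finset.mem_Icc] at hj
      have h3 : ‖(j : ℝ)‖ ≤ M := by
        rw [Real.norm_eq_abs, abs_le]
        exact ⟨by exact_mod_cast hj.1, by exact_mod_cast hj.2⟩
      have := norm_one_le (A := A)
      calc _ ≤ (M : ℝ) * 1 := by gcongr
        _ = M := mul_one _
    linarith
  have hKκ : 0 ≤ K * κ := by positivity
  have hfar : ∀ j ∈ Finset.Icc (-(M : ℤ)) M,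
      8 * (‖a - (j : ℝ) • (1 : A)‖ + 1) * K * κ ≤ 8 * (2 * M + 1) * (K * κ) := by
    intro j hj
    have := hb j hj
    rw [mul_assoc _ K]
    gcongr
  refine ⟨D, ?_⟩
  constructor
  · linarith
  · simp only [Int.card_Icc]
    have : ((M : ℤ) + 1 - -M).toNat = 2 * M + 1 := by omega
    rw [this]; push_cast; rfl
  · exact hKκ
  · exact hs
  · exact ha
  · exact hh
  · gcongr
  · exact L
  · intro j hj
    obtain ⟨h1, h2, -⟩ := hD j hj
    simp only [Ring.lie_def]
    rw [h1, h2]; abel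
  · exact fun j hj => (hD j hj).2.2.1
  · exact fun j hj => (hD j hj).2.2.2.1.trans (by rw [mul_assoc])
  · exact fun j hj => (hD j hj).2.2.2.2.1.trans (by rw [mul_assoc])
  · exact fun j hj => (hD j hj).2.2.2.2.2.1
  · exact fun j hj => (hD j hj).2.2.2.2.2.2.1.trans (hfar j hj)
  · exact fun j hj => (hD j hj).2.2.2.2.2.2.2.trans (hfar j hj)

/-- Outcome of the filling step. -/
theorem exists_smoothed {K κ : ℝ} (L : Lip K) {a h : A} (ha : IsSelfAdjoint a)
    (hh : IsSelfAdjoint h) (M : ℕ) (hM : ‖a‖ ≤ M - 2) (hn : ‖h‖ ≤ 1) (hκ : ‖⁅h, a⁆‖ ≤ κ)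
    (hs : 256 * (2 * M + 1) * (K * κ) ≤ 1)
    (hu : ∀ j ∈ Finset.Icc (-(M : ℤ)) M, IsUnit (h + Complex.I • (a - (j : ℝ) • (1 : A)))) :
    ∃ a' h' : A, IsSelfAdjoint a' ∧ IsSelfAdjoint h' ∧ ‖a' - a‖ ≤ 1/8 ∧ ‖h' - h‖ ≤ 1/8 ∧
      ‖⁅h', a'⁆‖ ≤ 3 * (2 * M + 1) ^ 2 * (K * κ) ∧
      (∀ k ∈ Finset.Icc (-(M : ℤ)) (M - 1), ∀ y, OL K y → (∀ t, |y t| ≤ 1) →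
        (∀ t, 1/64 ≤ |t| → y t = 0) →
        ‖⁅pr (Set.Ico (k : ℝ) (k + 1)) a', fc y h'⁆‖ ≤ 3200 * K * (2 * M + 1) ^ 2 * (K * κ)) ∧
      ‖(h' - h) * pr {t | 1/4 ≤ |t|} h‖ ≤ 8 * (2 * M + 1) ^ 2 * (K * κ) := by
  obtain ⟨D, F⟩ := exists_filled L ha hh M hM hn hκ hs hu
  refine ⟨_, _, F.na_sa, F.nh_sa, F.norm_na_sub, F.norm_nh_sub, F.norm_lie_na_nh, ?_, F.norm_far⟩
  intro k hk y hy hy1 hy0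
  rw [Finset.mem_Icc] at hk
  refine F.norm_lie_pr hy hy1 hy0 ?_ ?_ <;> rw [Finset.mem_Icc] <;> omega

theorem mul_eq_one_swap {x y : A} (h : x * y = 1) : y * x = 1 := by
  have h1 : Function.Injective (LinearMap.mulLeft ℂ y) := fun p q hpq => by
    have := congrArg (x * ·) hpq
    simpa [← mul_assoc, h] using this
  obtain ⟨z, hz⟩ := LinearMap.surjective_of_injective h1 1
  have hz' : y * z = 1 := hz
  have : x = z := by rw [← mul_one x, ← hz', ← mul_assoc, h, one_mul]
  rw [this]; exact hz'

theorem abs_sub_one_le_of_mem {x : A} {t : ℝ} (ht : t ∈ spectrum ℝ x) :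
    |t - 1| ≤ ‖x - 1‖ := by
  refine abs_le_norm_of_mem ?_
  have := spectrum.sub_singleton_eq (R := ℝ) x 1
  rw [map_one] at this
  rw [← this]
  exact ⟨t, ht, 1, rfl, rfl⟩

theorem abs_inv_sqrt_sub_one_le {t ε : ℝ} (ht : |t - 1| ≤ 2 * ε) (hε : ε ≤ 1/8) :
    |(√t)⁻¹ - 1| ≤ 2 * ε := by
  have h1 := abs_le.1 ht
  have ht0 : 3/4 ≤ t := by linarith
  have hs : 3/4 ≤ √t := Real.le_sqrt_of_sq_le (by linarith)
  have hsq := Real.sq_sqrt (by linarith : 0 ≤ t)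
  have e : (√t)⁻¹ - 1 = (1 - t) / (√t * (1 + √t)) := by
    field_simp
    linear_combination -hsq
  rw [e, abs_div, abs_sub_comm, abs_of_pos (by positivity : 0 < √t * (1 + √t))]
  refine (div_le_self (abs_nonneg _) ?_).trans ht
  nlinarith

theorem exists_pinched_unitary {ι : Type*} (I : Finset ι) (E : ι → A)
    (hsa : ∀ i ∈ I, IsSelfAdjoint (E i)) (hid : ∀ i ∈ I, E i * E i = E i)
    (ho : ∀ i ∈ I, ∀ j ∈ I, i ≠ j → E i * E j = 0) (h1 : ∑ i ∈ I, E i = 1) {u : A}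
    (hu : star u * u = 1) {ε : ℝ} (hε : ∑ i ∈ I, ‖⁅E i, u⁆‖ ≤ ε) (hε1 : ε ≤ 1/8) :
    ∃ v : A, star v * v = 1 ∧ ‖v - u‖ ≤ 3 * ε ∧ ∀ i ∈ I, E i * v = v * E i := by
  have hε0 : 0 ≤ ε := (Finset.sum_nonneg fun _ _ => norm_nonneg _).trans hε
  have hun : ‖u‖ ≤ 1 := by
    have := norm_mul_star_self' u
    rw [hu] at this
    nlinarith [norm_one_le (A := A), norm_nonneg u]
  have hEn : ∀ i ∈ I, ‖E i‖ ≤ 1 := fun i hi => by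
    have := norm_mul_star_self' (E i)
    rw [(hsa i hi).star_eq, hid i hi] at this
    nlinarith [norm_nonneg (E i)]
  set w := ∑ i ∈ I, E i * u * E i with hw
  have hwn : ‖w‖ ≤ 1 := norm_sum_block_le I zero_le_one E E (fun _ => u) hsa hsa hid ho ho
    fun i hi => by
      have := norm_mul_le_of_le (norm_mul_le_of_le (hEn i hi) hun) (hEn i hi)
      linarith
  have hwu : ‖w - u‖ ≤ ε := by
    have e : u - w = ∑ i ∈ I, E i * ⁅E i, u⁆ := by
      have : u = ∑ i ∈ I, E i * u := by rw [← Finset.sum_mul, h1, one_mul]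
      conv_lhs => rw [this, hw, ← Finset.sum_sub_distrib]
      refine Finset.sum_congr rfl fun i hi => ?_
      rw [Ring.lie_def, mul_sub, ← mul_assoc, hid i hi, ← mul_assoc]
    rw [norm_sub_rev, e]
    refine (norm_sum_le _ _).trans (le_trans (Finset.sum_le_sum fun i hi => ?_) hε)
    simpa using norm_mul_le_of_le (hEn i hi) (le_refl ‖⁅E i, u⁆‖)
  have hEw : ∀ i ∈ I, E i * w = w * E i := by
    intro i hi
    rw [hw, Finset.mul_sum, Finset.sum_mul, Finset.sum_eq_single i, Finset.sum_eq_single i]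
    · rw [← mul_assoc, ← mul_assoc, hid i hi, mul_assoc _ (E i) (E i), hid i hi]
    · intro j hj hji; rw [mul_assoc, ho j hj i hi hji, mul_zero]
    · exact fun h => absurd hi h
    · intro j hj hji; rw [← mul_assoc, ← mul_assoc, ho i hi j hj hji.symm, zero_mul, zero_mul]
    · exact fun h => absurd hi h
  set X := star w * w with hX
  have hXsa : IsSelfAdjoint X := IsSelfAdjoint.star_mul_self w
  have hX1 : ‖X - 1‖ ≤ 2 * ε := by
    have e : X - 1 = star w * (w - u) + star (w - u) * u := by
      rw [← hu, hX, star_sub]; noncomm_ring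
    rw [e]
    have b1 := norm_mul_le_of_le ((norm_star w).le.trans hwn) hwu
    have b2 := norm_mul_le_of_le ((norm_star (w - u)).le.trans hwu) hun
    refine (norm_add_le_of_le b1 b2).trans (by linarith)
  set g : ℝ → ℝ := fun t => (√t)⁻¹ with hg
  have hsp : ∀ t ∈ spectrum ℝ X, |t - 1| ≤ 2 * ε := fun t ht =>
    (abs_sub_one_le_of_mem ht).trans hX1
  refine ⟨w * fc g X, ?_, ?_, ?_⟩
  · have e : star (w * fc g X) * (w * fc g X) = fc g X * X * fc g X := by
      rw [star_mul, star_fc, hX]; noncomm_ring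
    rw [e, fc_mul_self_mul_fc _ _ hXsa, ← fc_one hXsa]
    refine fc_congr fun t ht => ?_
    have h2 := abs_le.1 (hsp t ht)
    have h3 : 0 < t := by linarith
    have h4 : 0 < √t := Real.sqrt_pos.2 h3
    have hsq := Real.sq_sqrt h3.le
    simp only [hg]
    field_simp
    linear_combination -hsq
  · have e : w * fc g X - u = w * (fc g X - 1) + (w - u) := by noncomm_ring
    rw [e]
    have b1 : ‖fc g X - 1‖ ≤ 2 * ε := by
      rw [← fc_one hXsa, fc_sub]
      exact norm_fc_le (by linarith) fun t ht => abs_inv_sqrt_sub_one_le (hsp t ht) hε1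
    have b2 := norm_mul_le_of_le hwn b1
    refine (norm_add_le_of_le b2 hwu).trans (by linarith)
  · intro i hi
    have h2 := hEw i hi
    have h3 : E i * star w = star w * E i := by
      have := congrArg star h2
      simp only [star_mul, (hsa i hi).star_eq] at this
      exact this.symm
    have h4 : X * E i = E i * X := by
      rw [hX, mul_assoc, ← h2, ← mul_assoc, ← h3, mul_assoc]
    have h5 : fc g X * E i = E i * fc g X := fc_comm g hXsa h4
    rw [mul_assoc, h5, ← mul_assoc, h2, mul_assoc]

/-- Unit windows of the spectrum. -/
def blk (a : A) (k : ℤ) : A := pr (Set.Ico (k : ℝ) (k + 1)) a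

theorem blk_isSelfAdjoint (a : A) (k : ℤ) : IsSelfAdjoint (blk a k) := pr_isSelfAdjoint _ _

theorem blk_mul_self (a : A) (k : ℤ) : blk a k * blk a k = blk a k := pr_mul_self _ _

theorem blk_mul_blk (a : A) {j k : ℤ} (h : j ≠ k) : blk a j * blk a k = 0 := by
  refine pr_mul_pr_of_disjoint ?_ a
  rw [Set.disjoint_left]
  intro t h1 h2
  rw [Set.mem_Ico, ← Int.floor_eq_iff] at h1 h2
  exact h (h1.symm.trans h2)

theorem fc_sum {ι : Type*} (s : Finset ι) (f : ι → ℝ → ℝ) (a : A) :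
    ∑ i ∈ s, fc (f i) a = fc (fun t => ∑ i ∈ s, f i t) a := by
  classical
  induction s using Finset.induction_on with
  | empty => simp [fc_zero]
  | insert i s hi ih =>
    rw [Finset.sum_insert hi, ih, fc_add]
    simp only [Finset.sum_insert hi]

theorem sum_smul_blk {a : A} {M : ℕ} (hM : ‖a‖ < M) (f : ℤ → ℝ) :
    ∑ k ∈ Finset.Icc (-(M : ℤ)) (M - 1), f k • blk a k = fc (fun t => f ⌊t⌋) a := by
  unfold blk pr
  simp only [fc_smul]
  rw [fc_sum]
  refine fc_congr fun t ht => ?_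
  have h1 := abs_le.1 (abs_le_norm_of_mem ht)
  rw [Finset.sum_eq_single ⌊t⌋]
  · have : t ∈ Set.Ico (⌊t⌋ : ℝ) (⌊t⌋ + 1) := ⟨Int.floor_le t, Int.lt_floor_add_one t⟩
    rw [Set.indicator_of_mem this, mul_one]
  · intro k _ hk
    rw [Set.indicator_of_notMem, mul_zero]
    intro h
    rw [Set.mem_Ico, ← Int.floor_eq_iff] at h
    exact hk h.symm
  · intro h
    exfalso
    apply h
    rw [Finset.mem_Icc]
    refine ⟨?_, ?_⟩
    · rw [Int.le_floor]; push_cast; linarith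
    · have : ⌊t⌋ < (M : ℤ) := by rw [Int.floor_lt]; push_cast; linarith
      omega

theorem sum_blk {a : A} (ha : IsSelfAdjoint a) {M : ℕ} (hM : ‖a‖ < M) :
    ∑ k ∈ Finset.Icc (-(M : ℤ)) (M - 1), blk a k = 1 := by
  have := sum_smul_blk hM fun _ => 1
  rwa [fc_one ha, Finset.sum_congr rfl fun _ _ => one_smul ℝ _] at this

theorem comm_star {x v : A} (hx : IsSelfAdjoint x) (h : x * v = v * x) :
    x * star v = star v * x := by
  have := congrArg star h
  simp only [star_mul, hx.star_eq] at this
  exact this.symm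

theorem comm_rePt {x v : A} (hx : IsSelfAdjoint x) (h : x * v = v * x) :
    x * rePt v = rePt v * x := by
  rw [rePt, mul_smul_comm, smul_mul_assoc, mul_add, add_mul, h, comm_star hx h]

theorem comm_imPt {x v : A} (hx : IsSelfAdjoint x) (h : x * v = v * x) :
    x * imPt v = imPt v * x := by
  rw [imPt, mul_smul_comm, smul_mul_assoc, mul_sub, sub_mul, h, comm_star hx h]

theorem rePt_comm_imPt {v : A} (h : star v * v = v * star v) : rePt v * imPt v = imPt v * rePt v := by
  simp only [rePt, imPt, mul_smul_comm, smul_mul_assoc, mul_add, mul_sub, add_mul, sub_mul, h]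
  module

theorem rePt_sq_add_imPt_sq {v : A} (h : star v * v = v * star v) :
    rePt v * rePt v + imPt v * imPt v = star v * v := by
  simp only [rePt, imPt, mul_smul_comm, smul_mul_assoc, smul_smul]
  have e1 : (-Complex.I/2 * (-Complex.I/2) : ℂ) = -(1/4) := by
    have := Complex.I_mul_I; linear_combination (1/4 : ℂ) * this
  have e2 : (1/2 * (1/2) : ℂ) = 1/4 := by norm_num
  rw [e1, e2, neg_smul, ← sub_eq_add_neg, ← smul_sub]
  have : (v + star v) * (v + star v) - (v - star v) * (v - star v) = (4 : ℂ) • (star v * v) := by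
    have h4 : (4 : ℂ) = 1 + 1 + 1 + 1 := by norm_num
    rw [h4]
    simp only [add_smul, one_smul, add_mul, mul_add, sub_mul, mul_sub, h]
    abel
  rw [this, smul_smul]; norm_num

/-- Almost invariant winding data can be replaced by exactly invariant data. -/
theorem exists_invariant {a h : A} (ha : IsSelfAdjoint a) {M : ℕ}
    (hM : ‖a‖ < M) {c : ℝ}
    (h1 : ∀ k ∈ Finset.Icc (-(M : ℤ)) (M - 1), ‖⁅blk a k, fc fy1 h⁆‖ ≤ c)
    (h2 : ∀ k ∈ Finset.Icc (-(M : ℤ)) (M - 1), ‖⁅blk a k, fc fy2 h⁆‖ ≤ c)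
    (hc : 8 * M * c ≤ 1/8) :
    ∃ q p : A, IsSelfAdjoint q ∧ IsSelfAdjoint p ∧ q * p = p * q ∧ p * p = q - q * q ∧
      ‖q - fc fy1 h‖ ≤ 16 * M * c ∧ ‖p - fc fy2 h‖ ≤ 16 * M * c ∧
      fc (fun t => (⌊t⌋ : ℝ)) a * q = q * fc (fun t => (⌊t⌋ : ℝ)) a ∧
      fc (fun t => (⌊t⌋ : ℝ)) a * p = p * fc (fun t => (⌊t⌋ : ℝ)) a := by
  set y1 := fc fy1 h with hy1
  set y2 := fc fy2 h with hy2
  have sy1 : IsSelfAdjoint y1 := fc_isSelfAdjoint _ _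
  have sy2 : IsSelfAdjoint y2 := fc_isSelfAdjoint _ _
  set u : A := (1 - (2 : ℂ) • y1) - (2 * Complex.I) • y2 with hu
  have hrel : y2 * y2 = y1 - y1 * y1 := by
    rw [hy1, hy2, fc_mul, fc_mul, fc_sub]
    refine fc_congr fun t _ => ?_
    have := fy_rel t
    nlinarith
  have hcom : y1 * y2 = y2 * y1 := fc_mul_comm _ _ _
  have huu : star u * u = 1 := by
    have e : star u = (1 - (2 : ℂ) • y1) + (2 * Complex.I) • y2 := by
      simp [hu, sy1.star_eq, sy2.star_eq]
    rw [e]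
    have e2 : ((1 - (2 : ℂ) • y1) + (2 * Complex.I) • y2) * u
        = 1 - (4 : ℂ) • y1 + (4 : ℂ) • (y1 * y1) + (4 : ℂ) • (y2 * y2) := by
      have i1 : (2 * Complex.I * (2 * Complex.I) : ℂ) = -4 := by
        have := Complex.I_mul_I; linear_combination (4 : ℂ) * this
      have e3 : ((2 * Complex.I) • y2) * ((2 * Complex.I) • y2) = -((4 : ℂ) • (y2 * y2)) := by
        rw [smul_mul_assoc, mul_smul_comm, smul_smul, i1, neg_smul]
      have e4 : ((2 * Complex.I) • y2) * ((2 : ℂ) • y1) = ((2 : ℂ) • y1) * ((2 * Complex.I) • y2) := by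
        simp only [smul_mul_assoc, mul_smul_comm, smul_smul, hcom, mul_comm]
      have e5 : ((2 : ℂ) • y1) * ((2 : ℂ) • y1) = (4 : ℂ) • (y1 * y1) := by
        rw [smul_mul_assoc, mul_smul_comm, smul_smul]; norm_num
      have e6 : (4 : ℂ) • y1 = (2 : ℂ) • y1 + (2 : ℂ) • y1 := by module
      rw [hu]
      simp only [mul_sub, sub_mul, add_mul, mul_one, one_mul, e3, e4, e5, e6]
      abel
    rw [e2, hrel, smul_sub]; abel
  set I := Finset.Icc (-(M : ℤ)) (M - 1) with hI
  have hcard : (I.card : ℝ) = 2 * M := by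
    rw [hI, Int.card_Icc]
    have : ((M : ℤ) - 1 + 1 - -M).toNat = 2 * M := by omega
    rw [this]; push_cast; rfl
  have hsum : ∑ k ∈ I, ‖⁅blk a k, u⁆‖ ≤ 8 * M * c := by
    have : ∀ k ∈ I, ‖⁅blk a k, u⁆‖ ≤ 4 * c := by
      intro k hk
      have e : ⁅blk a k, u⁆ = -⁅blk a k, (2 : ℂ) • y1⁆ - ⁅blk a k, (2 * Complex.I) • y2⁆ := by
        rw [hu, bra_sub, lie_one_sub]
      rw [e]
      refine (norm_sub_le _ _).trans ?_
      rw [norm_neg, norm_lie_smul, norm_lie_smul]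
      have := h1 k hk
      have := h2 k hk
      simp
      linarith
    refine (Finset.sum_le_sum this).trans ?_
    rw [Finset.sum_const, nsmul_eq_mul, hcard]
    linarith
  obtain ⟨v, hv, hvu, hvE⟩ := exists_pinched_unitary I (blk a) (fun i _ => blk_isSelfAdjoint a i)
    (fun i _ => blk_mul_self a i) (fun i _ j _ hij => blk_mul_blk a hij) (sum_blk ha hM) huu hsum hc
  have hv' : star v * v = v * star v := by rw [hv, mul_eq_one_swap hv]
  have hfl : fc (fun t => (⌊t⌋ : ℝ)) a * v = v * fc (fun t => (⌊t⌋ : ℝ)) a := by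
    rw [← sum_smul_blk hM fun k => (k : ℝ), Finset.sum_mul, Finset.mul_sum]
    refine Finset.sum_congr rfl fun k hk => ?_
    rw [smul_mul_assoc, mul_smul_comm, hvE k hk]
  have sfl : IsSelfAdjoint (fc (fun t => (⌊t⌋ : ℝ)) a) := fc_isSelfAdjoint _ _
  have hre : rePt u = 1 - (2 : ℂ) • y1 := by
    simp [hu, rePt, sy1.star_eq, sy2.star_eq]
    module
  have him : imPt u = -((2 : ℂ) • y2) := by
    have e : u - star u = -((4 * Complex.I) • y2) := by
      simp [hu, sy1.star_eq, sy2.star_eq]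
      module
    rw [imPt, e, smul_neg, smul_smul]
    congr 2
    have := Complex.I_mul_I; linear_combination (-2 : ℂ) * this
  have dre : ‖rePt v - rePt u‖ ≤ 3 * (8 * M * c) := by
    have : rePt v - rePt u = rePt (v - u) := by
      simp only [rePt, star_sub]; module
    rw [this]; exact norm_rePt_le hvu
  have dim : ‖imPt v - imPt u‖ ≤ 3 * (8 * M * c) := by
    have : imPt v - imPt u = imPt (v - u) := by
      simp only [imPt, star_sub]; module
    rw [this]; exact norm_imPt_le hvu
  have hε0 : 0 ≤ 8 * M * c := (Finset.sum_nonneg fun _ _ => norm_nonneg _).trans hsum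
  have hc' := rePt_comm_imPt hv'
  have hs' := rePt_sq_add_imPt_sq hv'
  rw [hv] at hs'
  have sR := rePt_sa v
  have sI := imPt_sa v
  have cR := comm_rePt sfl hfl
  have cI := comm_imPt sfl hfl
  set R := rePt v
  set J := imPt v
  refine ⟨(1/2 : ℂ) • (1 - R), (-(1/2) : ℂ) • J, ?_, ?_, ?_, ?_, ?_, ?_, ?_, ?_⟩
  · simp [isSelfAdjoint_iff, sR.star_eq]
  · simp [isSelfAdjoint_iff, sI.star_eq]
  · simp only [smul_mul_assoc, mul_smul_comm, sub_mul, mul_sub, one_mul, mul_one, hc']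
    module
  · have : J * J = 1 - R * R := by rw [← hs']; abel
    simp only [smul_mul_assoc, mul_smul_comm, this, sub_mul, mul_sub, one_mul, mul_one]
    module
  · have : (1/2 : ℂ) • (1 - R) - y1 = (-(1/2) : ℂ) • (R - rePt u) := by
      rw [hre]; module
    rw [this, norm_smul]
    norm_num
    linarith
  · have : (-(1/2) : ℂ) • J - y2 = (-(1/2) : ℂ) • (J - imPt u) := by
      rw [him]; module
    rw [this, norm_smul]
    norm_num
    linarith
  · rw [mul_smul_comm, smul_mul_assoc, mul_sub, sub_mul, cR, mul_one, one_mul]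
  · rw [mul_smul_comm, smul_mul_assoc, cI]

theorem abs_fω_le (t : ℝ) : |fω t| ≤ 1 := by
  rw [abs_of_nonneg (fω_nonneg t)]; exact fω_le_one t

theorem abs_fG_le (t : ℝ) : |fG t| ≤ 1 := by
  have h0 := fω_nonneg t
  have h1 := fω_le_one t
  unfold fG
  rw [abs_of_nonneg (by nlinarith)]; nlinarith

theorem norm_fc_sg_le (a : A) : ‖fc sg a‖ ≤ 1 := norm_fc_le' fun t => (abs_sg t).le

theorem fc_sg_mul_self {a : A} (ha : IsSelfAdjoint a) : fc sg a * fc sg a = 1 := by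
  rw [fc_mul, ← fc_one ha]; exact fc_congr fun t _ => sg_sq t

/-- On the overlap region the sign of `p` inverts its smoothed sign. -/
theorem sg_mul_overlap {q p : A} (sq : IsSelfAdjoint q) (sp : IsSelfAdjoint p)
    (hr : p * p = q - q * q) (hq : ‖q‖ ≤ 2) :
    fc sg p * (fc fχ p * fc fG q) = fc fG q := by
  have e1 : pr {t : ℝ | 1/4 ≤ |t| ∧ |t| ≤ 1} p * fc fG q = fc fG q := by
    have e2 : pr {t : ℝ | 1/4 ≤ |t| ∧ |t| ≤ 1} p = pr (Set.Icc (1/16 : ℝ) 1) (p * p) := by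
      have : p * p = fc (fun t => t * t) p := by rw [← fc_mul, fc_id sp]
      rw [this]
      unfold pr
      rw [fc_comp _ _ sp]
      refine fc_congr fun t _ => ?_
      have : t ∈ {t : ℝ | 1/4 ≤ |t| ∧ |t| ≤ 1} ↔ t * t ∈ Set.Icc (1/16 : ℝ) 1 := by
        rw [Set.mem_ofPred_eq, Set.mem_Icc, ← abs_mul_abs_self t]
        have := abs_nonneg t
        constructor
        · rintro ⟨h1, h2⟩; constructor <;> nlinarith
        · rintro ⟨h1, h2⟩
          constructor
          · by_contra h; push Not at h; nlinarith
          · by_contra h; push Not at h; nlinarith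
      by_cases h : t * t ∈ Set.Icc (1/16 : ℝ) 1
      · rw [Set.indicator_of_mem h, Set.indicator_of_mem (this.2 h)]
      · rw [Set.indicator_of_notMem h, Set.indicator_of_notMem fun h' => h (this.1 h')]
    have e3 : q - q * q = fc (fun t => t - t * t) q := by
      rw [← fc_sub, ← fc_mul, fc_id sq]
    rw [e2, hr, e3]
    unfold pr
    rw [fc_comp _ _ sq, fc_mul]
    refine fc_congr fun t ht => ?_
    have h2 := abs_le.1 ((abs_le_norm_of_mem ht).trans hq)
    by_cases h : t - t * t ∈ Set.Icc (1/16 : ℝ) 1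
    · rw [Set.indicator_of_mem h, one_mul]
    · rw [Set.indicator_of_notMem h, zero_mul]
      symm
      unfold fG
      rcases le_or_gt t (1/8) with h1 | h1
      · rw [fω_zero h1, zero_mul]
      · rcases le_or_gt (7/8) t with h3 | h3
        · rw [fω_one h3 h2.2, sub_self, mul_zero]
        · exfalso; apply h; constructor <;> nlinarith
  rw [← e1, ← mul_assoc, ← mul_assoc, fc_mul]
  congr 1
  refine fc_mul_pr_eq_pr (fun t ht => ?_) p
  rw [fχ_eq ht.1 ht.2, sg_sq]

/-- The approximate symmetry assembled from winding data. -/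
def sym (q p h : A) : A := fc sg p * fc fω q + fc fκ h

theorem comm_fc_fc {q p : A} (sq : IsSelfAdjoint q) (sp : IsSelfAdjoint p) (hc : q * p = p * q)
    (f g : ℝ → ℝ) : fc f q * fc g p = fc g p * fc f q :=
  fc_comm f sq (fc_comm g sp hc.symm).symm

theorem sym_isSelfAdjoint {q p : A} (sq : IsSelfAdjoint q) (sp : IsSelfAdjoint p)
    (hc : q * p = p * q) (h : A) : IsSelfAdjoint (sym q p h) := by
  unfold sym
  rw [isSelfAdjoint_iff, star_add, star_mul, star_fc, star_fc, star_fc, comm_fc_fc sq sp hc]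

theorem norm_sym_sq_sub_one_le {K e : ℝ} (L : Lip K) {q p h : A} (sq : IsSelfAdjoint q)
    (sp : IsSelfAdjoint p) (hc : q * p = p * q) (hr : p * p = q - q * q) (hh : IsSelfAdjoint h)
    (hn : ‖h‖ ≤ 2) (hq : ‖q - fc fy1 h‖ ≤ e) (hp : ‖p - fc fy2 h‖ ≤ e) (he : e ≤ 1) :
    ‖sym q p h * sym q p h - 1‖ ≤ 8 * (K * e) := by
  have hK := L.one_le
  set σ := fc sg p with hσ
  set Ω := fc fω q with hΩ
  set k := fc fκ h with hk
  set Ω' := fc fω (fc fy1 h) with hΩ'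
  set G := fc fG q with hG
  have s1 : IsSelfAdjoint (fc fy1 h) := fc_isSelfAdjoint _ _
  have s2 : IsSelfAdjoint (fc fy2 h) := fc_isSelfAdjoint _ _
  have hq2 : ‖q‖ ≤ 2 := by
    have : ‖fc fy1 h‖ ≤ 1 := norm_fc_le' abs_fy1_le
    have := norm_add_le_of_le hq this
    rw [sub_add_cancel] at this
    linarith
  have hsp : ∀ t ∈ spectrum ℝ h, |t| ≤ 2 := fun t ht => (abs_le_norm_of_mem ht).trans hn
  have dΩ : ‖Ω - Ω'‖ ≤ K * e := (L.ω.sub sq s1).trans (by gcongr)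
  have dG : ‖G - fc fG (fc fy1 h)‖ ≤ K * e := (L.G.sub sq s1).trans (by gcongr)
  have dχ : ‖fc fχ p - fc fχ (fc fy2 h)‖ ≤ K * e := (L.χ.sub sp s2).trans (by gcongr)
  have nσ : ‖σ‖ ≤ 1 := norm_fc_sg_le p
  have nΩ : ‖Ω‖ ≤ 1 := norm_fc_le' abs_fω_le
  have nΩ1 : ‖1 - Ω‖ ≤ 1 := norm_one_sub_fc_le fω_nonneg fω_le_one sq
  have nΩ1' : ‖1 - Ω'‖ ≤ 1 := norm_one_sub_fc_le fω_nonneg fω_le_one s1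
  have nk : ‖k‖ ≤ 1 := norm_fc_le' abs_fκ_le
  have nG : ‖fc fG (fc fy1 h)‖ ≤ 1 := norm_fc_le' abs_fG_le
  have nχ : ‖fc fχ p‖ ≤ 1 := norm_fc_le' abs_fχ_le
  have hk2 : k * k = (1 - Ω') * (1 - Ω') := by
    rw [hk, hΩ', one_sub_fc _ s1, fc_comp _ _ hh, fc_mul, fc_mul]
    refine fc_congr fun t ht => ?_
    rw [fκ_eq (hsp t ht)]
    linear_combination (1 - fω (fy1 t)) ^ 2 * sg_sq t
  have hov : Ω' * k = fc fχ (fc fy2 h) * fc fG (fc fy1 h) := by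
    rw [hk, hΩ', fc_comp _ _ hh, fc_comp _ _ hh, fc_comp _ _ hh, fc_mul, fc_mul]
    exact fc_congr fun t ht => overlap_eq t (hsp t ht)
  have hσΩ : Ω * σ = σ * Ω := comm_fc_fc sq sp hc _ _
  have d1 : ‖Ω * k - fc fχ p * G‖ ≤ 3 * (K * e) := by
    have e1 : Ω * k - fc fχ p * G = (Ω - Ω') * k
        - ((fc fχ p - fc fχ (fc fy2 h)) * fc fG (fc fy1 h)
          + fc fχ p * (G - fc fG (fc fy1 h))) := by
      have : (Ω - Ω') * k = Ω * k - fc fχ (fc fy2 h) * fc fG (fc fy1 h) := by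
        rw [sub_mul, hov]
      rw [this]; noncomm_ring
    rw [e1]
    have b1 := norm_mul_le_of_le dΩ nk
    have b2 := norm_mul_le_of_le dχ nG
    have b3 := norm_mul_le_of_le nχ dG
    refine (norm_sub_le_of_le b1 (norm_add_le_of_le b2 b3)).trans (by linarith)
  have d2 : ‖σ * Ω * k - G‖ ≤ 3 * (K * e) := by
    have e1 : σ * Ω * k - G = σ * (Ω * k - fc fχ p * G) := by
      rw [mul_sub, hσ, hG, sg_mul_overlap sq sp hr hq2, mul_assoc]
    rw [e1]
    have := norm_mul_le_of_le nσ d1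
    linarith
  have d3 : ‖k * (σ * Ω) - G‖ ≤ 3 * (K * e) := by
    have e1 : k * (σ * Ω) - G = star (σ * Ω * k - G) := by
      rw [star_sub, star_mul, star_mul, hσ, hΩ, hk, hG, star_fc, star_fc, star_fc, star_fc,
        ← hσ, ← hΩ, hσΩ]
    rw [e1, norm_star]; exact d2
  have d4 : ‖k * k - (1 - Ω) * (1 - Ω)‖ ≤ 2 * (K * e) := by
    have e1 : k * k - (1 - Ω) * (1 - Ω) = (1 - Ω') * (Ω - Ω') + (Ω - Ω') * (1 - Ω) := by
      rw [hk2]; noncomm_ring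
    rw [e1]
    have b1 := norm_mul_le_of_le nΩ1' dΩ
    have b2 := norm_mul_le_of_le dΩ nΩ1
    refine (norm_add_le_of_le b1 b2).trans (by linarith)
  have e0 : sym q p h * sym q p h - 1
      = (σ * Ω * k - G) + (k * (σ * Ω) - G) + (k * k - (1 - Ω) * (1 - Ω)) := by
    have e1 : σ * Ω * (σ * Ω) = Ω * Ω := by
      rw [mul_assoc σ, ← mul_assoc Ω, hσΩ, mul_assoc σ Ω, ← mul_assoc σ σ, hσ, fc_sg_mul_self sp,
        one_mul]
    have e2 : G = Ω * (1 - Ω) := by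
      rw [hG, hΩ, one_sub_fc _ sq, fc_mul]; rfl
    have e3 : sym q p h * sym q p h = σ * Ω * (σ * Ω) + σ * Ω * k + k * (σ * Ω) + k * k := by
      unfold sym; noncomm_ring
    rw [e3, e1, e2]; noncomm_ring
  rw [e0]
  refine (norm_add_le_of_le (norm_add_le_of_le d2 d3) d4).trans (by linarith)

theorem norm_lie_sym_le {K κ : ℝ} (L : Lip K) {a h : A} (q p : A) (ha : IsSelfAdjoint a)
    (hh : IsSelfAdjoint h) (sq : IsSelfAdjoint q) (sp : IsSelfAdjoint p)
    (hq : fc (fun t => (⌊t⌋ : ℝ)) a * q = q * fc (fun t => (⌊t⌋ : ℝ)) a)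
    (hp : fc (fun t => (⌊t⌋ : ℝ)) a * p = p * fc (fun t => (⌊t⌋ : ℝ)) a)
    (hκ : ‖⁅h, a⁆‖ ≤ κ) : ‖⁅a, sym q p h⁆‖ ≤ 1 + K * κ := by
  have hK := L.one_le
  set fl := fc (fun t => (⌊t⌋ : ℝ)) a with hfl
  have nW : ‖fc sg p * fc fω q‖ ≤ 1 := by
    have := norm_mul_le_of_le (norm_fc_sg_le p) (norm_fc_le' (a := q) abs_fω_le)
    linarith
  have c1 : fl * (fc sg p * fc fω q) = fc sg p * fc fω q * fl := by
    have e1 : fc sg p * fl = fl * fc sg p := fc_comm _ sp hp.symm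
    have e2 : fc fω q * fl = fl * fc fω q := fc_comm _ sq hq.symm
    rw [← mul_assoc, ← e1, mul_assoc, ← e2, mul_assoc]
  set r := fc (fun t => t - (⌊t⌋ : ℝ) - 1/2) a with hr
  have nr : ‖r‖ ≤ 1/2 := norm_fc_le' fun t => by
    rw [abs_le]
    constructor <;> linarith [Int.floor_le t, Int.lt_floor_add_one t]
  have e1 : a = fl + r + (1/2 : ℝ) • (1 : A) := by
    rw [← fc_const _ ha, hfl, hr, fc_add, fc_add]
    conv_lhs => rw [← fc_id ha]
    exact fc_congr fun t _ => by ring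
  have e2 : ⁅a, fc sg p * fc fω q⁆ = ⁅r, fc sg p * fc fω q⁆ := by
    have : ⁅a, fc sg p * fc fω q⁆ = (fl * (fc sg p * fc fω q) - fc sg p * fc fω q * fl)
        + ⁅r, fc sg p * fc fω q⁆ := by
      simp only [Ring.lie_def]
      conv_lhs => rw [e1]
      simp only [add_mul, mul_add, smul_mul_assoc, mul_smul_comm, one_mul, mul_one]
      abel
    rw [this, c1, sub_self, zero_add]
  unfold sym
  refine (norm_lie_add_le _ _ _).trans (add_le_add ?_ ?_)
  · rw [e2]
    have := norm_lie_le r (fc sg p * fc fω q)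
    nlinarith [norm_nonneg r, norm_nonneg (fc sg p * fc fω q)]
  · rw [norm_lie_swap]
    exact (L.κ.lie hh a).trans (by gcongr)

theorem norm_sym_mul_pr_sub_le {K e ε : ℝ} (L : Lip K) {q h h' : A} (p : A)
    (sq : IsSelfAdjoint q) (hh : IsSelfAdjoint h) (hh' : IsSelfAdjoint h')
    (hn : ‖h‖ ≤ 1) (hq : ‖q - fc fy1 h'‖ ≤ e)
    (hε : ‖(h' - h) * pr {t | 1/4 ≤ |t|} h‖ ≤ ε) {s : Set ℝ} {ρ : ℝ}
    (hs : ∀ t ∈ s, 1/4 ≤ |t| ∧ sg t = ρ) :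
    ‖sym q p h' * pr s h - ρ • pr s h‖ ≤ K * e + K * (K * ε) + K * ε := by
  have hK := L.one_le
  set Z := pr s h with hZ
  have nZ : ‖Z‖ ≤ 1 := norm_pr_le _ _
  have hZε : ‖h' * Z - Z * h‖ ≤ ε := by
    have hsub : s ⊆ {t | 1/4 ≤ |t|} := fun t ht => (hs t ht).1
    have e1 : h' * Z - Z * h = (h' - h) * pr {t | 1/4 ≤ |t|} h * Z := by
      rw [hZ, mul_assoc, pr_mul_pr, Set.inter_eq_self_of_subset_right hsub,
        sub_mul, pr, self_mul_fc _ hh]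
    rw [e1]
    have := norm_mul_le_of_le hε nZ
    linarith
  have s1 : ∀ x : A, IsSelfAdjoint (fc fy1 x) := fc_isSelfAdjoint _
  have d1 : ‖fc fκ h' * Z - ρ • Z‖ ≤ K * ε := by
    have e1 : Z * fc fκ h = ρ • Z := by
      rw [hZ, pr, fc_mul, fc_smul]
      refine fc_congr fun t ht => ?_
      by_cases h1 : t ∈ s
      · have := hs t h1
        have h2 := (abs_le_norm_of_mem ht).trans hn
        rw [Set.indicator_of_mem h1, fκ_eq (by linarith), fy1_zero (by linarith [this.1]),
          fω_zero (by norm_num), this.2]; ring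
      · rw [Set.indicator_of_notMem h1]; ring
    rw [← e1]
    exact (L.κ A h' h Z hh' hh).trans (by gcongr)
  have d2 : ‖fc fω (fc fy1 h') * Z‖ ≤ K * (K * ε) := by
    have e1 : Z * fc fω (fc fy1 h) = 0 := by
      rw [hZ, pr, fc_comp _ _ hh, fc_mul, ← fc_zero h]
      refine fc_congr fun t ht => ?_
      by_cases h1 : t ∈ s
      · rw [fy1_zero (by linarith [(hs t h1).1]), fω_zero (by norm_num), mul_zero]
      · rw [Set.indicator_of_notMem h1]; ring
    have := L.ω A _ _ Z (s1 h') (s1 h)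
    rw [e1, sub_zero] at this
    refine this.trans ?_
    gcongr
    exact (L.y1 A h' h Z hh' hh).trans (by gcongr)
  have d3 : ‖(fc fω q - fc fω (fc fy1 h')) * Z‖ ≤ K * e := by
    have := norm_mul_le_of_le ((L.ω.sub sq (s1 h')).trans
      (mul_le_mul_of_nonneg_left hq (by linarith))) nZ
    linarith
  have e1 : sym q p h' * Z - ρ • Z = fc sg p * ((fc fω q - fc fω (fc fy1 h')) * Z
      + fc fω (fc fy1 h') * Z) + (fc fκ h' * Z - ρ • Z) := by
    unfold sym; noncomm_ring
  rw [e1]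
  have := norm_mul_le_of_le (norm_fc_sg_le p) (norm_add_le_of_le d3 d2)
  refine (norm_add_le_of_le this d1).trans (by linarith)

theorem norm_fc_sg_sub_le {S : A} (hS : IsSelfAdjoint S) : ‖fc sg S - S‖ ≤ ‖S * S - 1‖ := by
  set m : ℝ → ℝ := fun t => -(sg t / (1 + |t|)) with hm
  have e : fc sg S - S = (S * S - 1) * fc m S := by
    have e1 : S * S - 1 = fc (fun t => t * t - 1) S := by
      rw [← fc_sub, ← fc_mul, fc_id hS, fc_one hS]
    rw [e1, fc_mul]
    conv_lhs => rw [← fc_id hS, fc_comp _ _ hS, fc_sub]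
    refine fc_congr fun t _ => ?_
    have h1 : 0 < 1 + |t| := by positivity
    have h2 : t = sg t * |t| := by
      unfold sg; split_ifs with h
      · rw [abs_of_nonneg h, one_mul]
      · rw [abs_of_neg (not_le.1 h)]; ring
    have h3 := abs_mul_abs_self t
    simp only [hm]
    field_simp
    linear_combination (-1 - |t|) * h2 - sg t * h3
  have nm : ‖fc m S‖ ≤ 1 := norm_fc_le' fun t => by
    simp only [hm]
    rw [abs_neg, abs_div, abs_sg, abs_of_pos (by positivity : 0 < 1 + |t|)]
    exact div_le_one_of_le₀ (by linarith [abs_nonneg t]) (by positivity)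
  rw [e]
  have := norm_mul_le_of_le (le_refl ‖S * S - 1‖) nm
  linarith

theorem fc_sg_eq {S : A} (hS : IsSelfAdjoint S) :
    fc sg S = (2 : ℝ) • pr (Set.Ici 0) S - 1 := by
  rw [pr, fc_smul, ← fc_one hS, fc_sub]
  refine fc_congr fun t _ => ?_
  by_cases h : 0 ≤ t
  · rw [Set.indicator_of_mem (Set.mem_Ici.2 h), sg, if_pos h]; norm_num
  · rw [Set.indicator_of_notMem (fun h' => h (Set.mem_Ici.1 h')), sg, if_neg h]; norm_num

theorem finite_setOf_not_isUnit_add (x : A) :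
    {r : ℝ | ¬ IsUnit (x + r • (1 : A))}.Finite := by
  refine ((finite_spectrum_real (-x)).subset fun r hr => ?_)
  rw [spectrum.mem_iff]
  intro h
  refine hr ?_
  rw [sub_neg_eq_add, Algebra.algebraMap_eq_smul_one] at h
  rwa [add_comm]

theorem exists_shift_isUnit {ι : Type*} (I : Finset ι) (S : ι → A) {ε : ℝ} (hε : 0 < ε) :
    ∃ r, 0 ≤ r ∧ r ≤ ε ∧ ∀ i ∈ I, IsUnit (S i + r • (1 : A)) := by
  have h1 : (⋃ i ∈ I, {r : ℝ | ¬ IsUnit (S i + r • (1 : A))}).Finite :=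
    I.finite_toSet.biUnion fun i _ => finite_setOf_not_isUnit_add (S i)
  obtain ⟨r, hr, hr'⟩ := (Set.Icc_infinite hε).exists_notMem_finite h1
  refine ⟨r, hr.1, hr.2, fun i hi => ?_⟩
  by_contra h
  exact hr' (Set.mem_biUnion hi h)

theorem exists_cut_of_isUnit {K κ : ℝ} (L : Lip K) {a h : A} (ha : IsSelfAdjoint a)
    (hh : IsSelfAdjoint h) {M : ℕ} (hM : ‖a‖ ≤ M - 2) (hn : ‖h‖ ≤ 1) (hκ : ‖⁅h, a⁆‖ ≤ κ)
    (hs : 256 * (2 * M + 1) * (K * κ) ≤ 1)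
    (hu : ∀ j ∈ Finset.Icc (-(M : ℤ)) M, IsUnit (h + Complex.I • (a - (j : ℝ) • (1 : A))))
    {e : ℝ} (he : 16 * M * (3200 * K * (2 * M + 1) ^ 2 * (K * κ)) = e)
    (he1 : 8 * M * (K * e) ≤ 1) (hs2 : K * (3 * (2 * M + 1) ^ 2 * (K * κ)) ≤ 1) :
    ∃ W : A, IsSelfAdjoint W ∧ W * W = W ∧ ‖⁅a, W⁆‖ ≤ 3 ∧
      ‖(1 - W) * pr (Set.Ici (1/4)) h‖ ≤ 5 * (K * e) +
        16 * (2 * M + 1) ^ 2 * (K * (K * (K * κ))) ∧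
      ‖W * pr (Set.Iic (-(1/4))) h‖ ≤ 5 * (K * e) +
        16 * (2 * M + 1) ^ 2 * (K * (K * (K * κ))) := by
  have hK := L.one_le
  have hκ0 : 0 ≤ κ := (norm_nonneg _).trans hκ
  have hM2 : (2 : ℝ) ≤ M := by linarith [norm_nonneg a]
  obtain ⟨a', h', sa, sh, da, dh, hl, hw, hf⟩ := exists_smoothed L ha hh M hM hn hκ hs hu
  have na : ‖a'‖ ≤ M - 2 + 1/8 := by
    have := norm_add_le_of_le da hM
    rw [sub_add_cancel] at this; linarith
  have nh : ‖h'‖ ≤ 2 := by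
    have := norm_add_le_of_le dh hn
    rw [sub_add_cancel] at this; linarith
  have he0 : 0 ≤ e := by rw [← he]; positivity
  have hKe : e ≤ K * e := by nlinarith
  have heS : 16 * (K * e) ≤ 1 := by nlinarith
  obtain ⟨q, p, sq, sp, hqp, hr, dq, dp, cq, cp⟩ := exists_invariant sa (M := M)
    (by linarith) (fun k hk => hw k hk fy1 L.y1 abs_fy1_le fun t => fy1_zero)
    (fun k hk => hw k hk fy2 L.y2 abs_fy2_le fun t => fy2_zero) (by linarith)
  rw [he] at dq dp
  set S := sym q p h' with hS
  have sS : IsSelfAdjoint S := sym_isSelfAdjoint sq sp hqp h'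
  have hS1 : ‖S * S - 1‖ ≤ 8 * (K * e) :=
    norm_sym_sq_sub_one_le L sq sp hqp hr sh nh dq dp (by linarith)
  have hS2 := norm_lie_sym_le L q p sa sh sq sp cq cp hl
  have hsg := (norm_fc_sg_sub_le sS).trans hS1
  have hW := fc_sg_eq sS
  set W := pr (Set.Ici 0) S with hWdef
  have sW : IsSelfAdjoint W := pr_isSelfAdjoint _ _
  have nW : ‖W‖ ≤ 1 := norm_pr_le _ _
  have hW1 : W = (1/2 : ℂ) • (1 + fc sg S) := by
    rw [hW, RCLike.real_smul_eq_coe_smul (K := ℂ)]; push_cast; module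
  have key : ∀ {s : Set ℝ} {ρ : ℝ}, (∀ t ∈ s, 1/4 ≤ |t| ∧ sg t = ρ) →
      ‖fc sg S * pr s h - ρ • pr s h‖ ≤ 10 * (K * e) +
        32 * (2 * M + 1) ^ 2 * (K * (K * (K * κ))) := by
    intro s ρ hsρ
    have h1 := norm_sym_mul_pr_sub_le L p sq hh sh hn dq hf hsρ
    have h2 := norm_mul_le_of_le hsg (norm_pr_le s h)
    have h3 : fc sg S * pr s h - ρ • pr s h
        = (fc sg S - S) * pr s h + (S * pr s h - ρ • pr s h) := by noncomm_ring
    rw [h3]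
    refine (norm_add_le_of_le h2 h1).trans ?_
    have h4 : K * (8 * (2 * M + 1) ^ 2 * (K * κ)) ≤
        K * (K * (8 * (2 * M + 1) ^ 2 * (K * κ))) := by
      have : 0 ≤ K * (8 * (2 * M + 1) ^ 2 * (K * κ)) := by positivity
      nlinarith
    have h5 : 0 ≤ (2 * (M : ℝ) + 1) ^ 2 * (K * (K * (K * κ))) := by positivity
    nlinarith
  refine ⟨W, sW, pr_mul_self _ _, ?_, ?_, ?_⟩
  · have h1 : ‖⁅a', fc sg S⁆‖ ≤ 1 + K * (3 * (2 * M + 1) ^ 2 * (K * κ))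
        + 2 * M * (8 * (K * e)) := by
      have e1 : fc sg S = S + (fc sg S - S) := by abel
      rw [e1]
      refine (norm_lie_add_le _ _ _).trans (add_le_add hS2 ?_)
      refine (norm_lie_le _ _).trans ?_
      gcongr
      linarith
    have h2 : ‖⁅a', W⁆‖ ≤ 2 := by
      have : ⁅a', W⁆ = (1/2 : ℂ) • ⁅a', fc sg S⁆ := by
        rw [hW1]
        simp only [Ring.lie_def, mul_smul_comm, smul_mul_assoc, mul_add, add_mul, one_mul, mul_one]
        module
      rw [this, norm_smul]
      norm_num
      linarith
    have h3 : ⁅a, W⁆ = ⁅a', W⁆ - ⁅a' - a, W⁆ := by simp only [Ring.lie_def]; noncomm_ring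
    have h4 := norm_lie_le (a' - a) W
    have h5 : 2 * ‖a' - a‖ * ‖W‖ ≤ 2 * (1/8) * 1 := by gcongr
    rw [h3]
    refine (norm_sub_le _ _).trans (by linarith)
  · have h1 := key (s := Set.Ici (1/4)) (ρ := 1) fun t ht => by
      have ht : 1/4 ≤ t := ht
      rw [abs_of_nonneg (by linarith), sg, if_pos (by linarith)]; exact ⟨ht, rfl⟩
    have h2 : (1 - W) * pr (Set.Ici (1/4)) h = (-(1/2) : ℂ) •
        (fc sg S * pr (Set.Ici (1/4)) h - (1 : ℝ) • pr (Set.Ici (1/4)) h) := by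
      rw [hW1, one_smul]
      simp only [sub_mul, smul_mul_assoc, add_mul, one_mul]
      module
    rw [h2, norm_smul]
    norm_num at h1 ⊢
    linarith
  · have h1 := key (s := Set.Iic (-(1/4))) (ρ := -1) fun t ht => by
      have ht : t ≤ -(1/4) := ht
      rw [abs_of_nonpos (by linarith), sg, if_neg (by linarith)]; exact ⟨by linarith, rfl⟩
    have h2 : W * pr (Set.Iic (-(1/4))) h = ((1/2) : ℂ) •
        (fc sg S * pr (Set.Iic (-(1/4))) h - (-1 : ℝ) • pr (Set.Iic (-(1/4))) h) := by
      rw [hW1, neg_one_smul]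
      simp only [smul_mul_assoc, add_mul, one_mul]
      module
    rw [h2, norm_smul]
    norm_num at h1 ⊢
    linarith

end

/-- The quantitative cutting property with constant `C`. -/
def Cut (C : ℝ) : Prop :=
  ∀ (A : Type) [CStarAlgebra A] [FiniteDimensional ℂ A] (a h : A) (N κ : ℝ),
    IsSelfAdjoint a → IsSelfAdjoint h → 1 ≤ N → ‖a‖ ≤ N → ‖h‖ ≤ 1/2 → ‖⁅h, a⁆‖ ≤ κ →
    C * N ^ 4 * κ ≤ 1 →
    ∃ W : A, IsSelfAdjoint W ∧ W * W = W ∧ ‖⁅a, W⁆‖ ≤ 3 ∧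
      ‖(1 - W) * pr (Set.Ici (3/8)) h‖ ≤ C * N ^ 3 * κ ∧
      ‖W * pr (Set.Iic (-(3/8))) h‖ ≤ C * N ^ 3 * κ

theorem exists_Cut : ∃ C, 1 ≤ C ∧ Cut C := by
  obtain ⟨K, L⟩ := exists_Lip
  have hK := L.one_le
  refine ⟨10 ^ 9 * K ^ 3, ?_, ?_⟩
  · have : (1 : ℝ) ≤ K ^ 3 := one_le_pow₀ hK
    linarith
  intro A _ _ a h N κ ha hh hN hna hnh hκ hC
  have hκ0 : 0 ≤ κ := (norm_nonneg _).trans hκ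
  set M : ℕ := ⌈N⌉₊ + 2 with hM
  have hM1 : ‖a‖ ≤ (M : ℝ) - 2 := by
    rw [hM]; push_cast; linarith [Nat.le_ceil N]
  have hM2 : (M : ℝ) ≤ 4 * N := by
    rw [hM]; push_cast; linarith [Nat.ceil_lt_add_one (by linarith : 0 ≤ N)]
  have hM3 : 2 * (M : ℝ) + 1 ≤ 9 * N := by linarith
  have hM0 : (0 : ℝ) ≤ M := Nat.cast_nonneg M
  obtain ⟨r, hr0, hr1, hu⟩ := exists_shift_isUnit (Finset.Icc (-(M : ℤ)) M)
    (fun j : ℤ => h + Complex.I • (a - (j : ℝ) • (1 : A))) (ε := 1/100) (by norm_num)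
  have hh0 : IsSelfAdjoint (h + r • (1 : A)) :=
    hh.add ((IsSelfAdjoint.all r).smul (IsSelfAdjoint.one A))
  have hl0 : ⁅h + r • (1 : A), a⁆ = ⁅h, a⁆ := by
    simp only [Ring.lie_def, add_mul, mul_add, smul_mul_assoc, mul_smul_comm, one_mul, mul_one]
    abel
  have hn0 : ‖h + r • (1 : A)‖ ≤ 1 := by
    have h1 : ‖r • (1 : A)‖ ≤ 1/100 := by
      rw [norm_smul, Real.norm_of_nonneg hr0]
      nlinarith [norm_one_le (A := A), norm_nonneg (1 : A)]
    refine (norm_add_le_of_le hnh h1).trans (by norm_num)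
  have b1 : K * κ ≤ K ^ 3 * N ^ 4 * κ := by
    have h1 : K ≤ K ^ 3 := by nlinarith [sq_nonneg K]
    have h2 : 1 ≤ N ^ 4 := one_le_pow₀ hN
    have : K * 1 ≤ K ^ 3 * N ^ 4 := by gcongr
    nlinarith
  have b2 : N * (K * κ) ≤ K ^ 3 * N ^ 4 * κ := by
    have h1 : K ≤ K ^ 3 := by nlinarith [sq_nonneg K]
    have h2 : N ≤ N ^ 4 := by nlinarith [sq_nonneg N, one_le_pow₀ hN (n := 2), one_le_pow₀ hN (n := 3)]
    have : K * N ≤ K ^ 3 * N ^ 4 := by gcongr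
    nlinarith
  have c1 : 3200 * K * (2 * M + 1) ^ 2 * (K * κ) ≤ 3200 * K * (9 * N) ^ 2 * (K * κ) := by gcongr
  have c2 : 16 * M * (3200 * K * (2 * M + 1) ^ 2 * (K * κ))
      ≤ 16 * (4 * N) * (3200 * K * (9 * N) ^ 2 * (K * κ)) := by gcongr
  have c3 : K * (16 * M * (3200 * K * (2 * M + 1) ^ 2 * (K * κ)))
      ≤ 16588800 * (K ^ 3 * N ^ 3 * κ) := by
    refine (mul_le_mul_of_nonneg_left c2 (by linarith)).trans (le_of_eq (by ring))
  have c4 : 8 * M * (K * (16 * M * (3200 * K * (2 * M + 1) ^ 2 * (K * κ)))) ≤ 1 := by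
    have : 8 * (M : ℝ) * (K * (16 * M * (3200 * K * (2 * M + 1) ^ 2 * (K * κ))))
        ≤ 8 * (4 * N) * (16588800 * (K ^ 3 * N ^ 3 * κ)) := by gcongr
    have h0 : 0 ≤ K ^ 3 * N ^ 4 * κ := by positivity
    nlinarith
  have c5 : (2 * (M : ℝ) + 1) ^ 2 ≤ 81 * N ^ 2 := by
    have : (2 * (M : ℝ) + 1) ^ 2 ≤ (9 * N) ^ 2 := by gcongr
    linarith
  have c6 : (2 * (M : ℝ) + 1) ^ 2 * (K * (K * (K * κ))) ≤ 81 * (K ^ 3 * N ^ 3 * κ) := by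
    have h1 : N ^ 2 ≤ N ^ 3 := pow_le_pow_right₀ hN (by norm_num)
    have : (2 * (M : ℝ) + 1) ^ 2 * (K * (K * (K * κ))) ≤ 81 * N ^ 3 * (K * (K * (K * κ))) := by
      gcongr; linarith
    linarith
  have c7 : K * (3 * (2 * M + 1) ^ 2 * (K * κ)) ≤ 1 := by
    have h1 : (2 * (M : ℝ) + 1) ^ 2 * (K * (K * κ)) ≤ (2 * (M : ℝ) + 1) ^ 2 * (K * (K * (K * κ))) := by
      gcongr
      have : 0 ≤ K * κ := by positivity
      nlinarith
    have h2 : K ^ 3 * N ^ 3 * κ ≤ K ^ 3 * N ^ 4 * κ := by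
      gcongr
      norm_num
    nlinarith
  have c8 : 256 * (2 * (M : ℝ) + 1) * (K * κ) ≤ 1 := by
    have : 256 * (2 * (M : ℝ) + 1) * (K * κ) ≤ 256 * (9 * N) * (K * κ) := by gcongr
    nlinarith
  obtain ⟨W, w1, w2, w3, w4, w5⟩ := exists_cut_of_isUnit L ha hh0 hM1 hn0 (hl0 ▸ hκ) c8
    (fun j hj => by have := hu j hj; rwa [add_right_comm] at this) rfl c4 c7
  have fin : 5 * (K * (16 * M * (3200 * K * (2 * M + 1) ^ 2 * (K * κ)))) +
      16 * (2 * M + 1) ^ 2 * (K * (K * (K * κ))) ≤ 10 ^ 9 * K ^ 3 * N ^ 3 * κ := by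
    have h0 : 0 ≤ K ^ 3 * N ^ 3 * κ := by positivity
    nlinarith
  have sub : ∀ s t : Set ℝ, (∀ x ∈ s, x + r ∈ t) →
      pr t (h + r • (1 : A)) * pr s h = pr s h := by
    intro s t hst
    rw [← fc_add_const r hh, pr, fc_comp _ _ hh]
    refine fc_mul_pr_eq_pr (fun x hx => ?_) h
    exact Set.indicator_of_mem (hst x hx) _
  refine ⟨W, w1, w2, w3, ?_, ?_⟩
  · rw [← sub (Set.Ici (3/8)) (Set.Ici (1/4)) fun x hx => by
      rw [Set.mem_Ici] at hx ⊢; linarith, ← mul_assoc]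
    have := norm_mul_le_of_le w4 (norm_pr_le (Set.Ici (3/8)) h)
    linarith
  · rw [← sub (Set.Iic (-(3/8))) (Set.Iic (-(1/4))) fun x hx => by
      rw [Set.mem_Iic] at hx ⊢; linarith, ← mul_assoc]
    have := norm_mul_le_of_le w5 (norm_pr_le (Set.Iic (-(3/8))) h)
    linarith

section
variable {A : Type} [CStarAlgebra A] [FiniteDimensional ℂ A]

/-- The cutting property inside the commutant of a self-adjoint element. -/
theorem Cut.relative {C : ℝ} (hC : Cut C) {a h J : A} {N κ : ℝ} (ha : IsSelfAdjoint a)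
    (hh : IsSelfAdjoint h) (hJ : IsSelfAdjoint J) (hJa : J * a = a * J) (hJh : J * h = h * J)
    (hN : 1 ≤ N) (hna : ‖a‖ ≤ N) (hnh : ‖h‖ ≤ 1/2) (hκ : ‖⁅h, a⁆‖ ≤ κ)
    (hs : C * N ^ 4 * κ ≤ 1) :
    ∃ W : A, IsSelfAdjoint W ∧ W * W = W ∧ J * W = W * J ∧ ‖⁅a, W⁆‖ ≤ 3 ∧
      ‖(1 - W) * pr (Set.Ici (3/8)) h‖ ≤ C * N ^ 3 * κ ∧
      ‖W * pr (Set.Iic (-(3/8))) h‖ ≤ C * N ^ 3 * κ := by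
  set B := StarSubalgebra.centralizer ℂ {J} with hB
  have hmem : ∀ {x : A}, J * x = x * J → x ∈ B := fun {x} hx => by
    rw [hB, StarSubalgebra.mem_centralizer_iff]
    intro g hg
    rw [Set.mem_singleton_iff] at hg
    rw [hg, hJ.star_eq]; exact ⟨hx, hx⟩
  have hfd : FiniteDimensional ℂ B :=
    FiniteDimensional.finiteDimensional_submodule (Subalgebra.toSubmodule B.toSubalgebra)
  have hcl : IsClosed (B : Set A) :=
    (Subalgebra.toSubmodule B.toSubalgebra).closed_of_finiteDimensional
  let : CStarAlgebra B := StarSubalgebra.cstarAlgebra B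
  have hpr : ∀ (s : Set ℝ) {x : B}, IsSelfAdjoint x → ((pr s x : B) : A) = pr s (x : A) :=
    fun s x hx => fc_map B.subtype _ hx
  let a0 : B := ⟨a, hmem hJa⟩
  let h0 : B := ⟨h, hmem hJh⟩
  have sh0 : IsSelfAdjoint h0 := Subtype.ext hh
  obtain ⟨W, w1, w2, w3, w4, w5⟩ := hC B a0 h0 N κ (Subtype.ext ha) sh0 hN hna hnh hκ hs
  refine ⟨W, congrArg Subtype.val w1, congrArg Subtype.val w2, ?_, w3, ?_, ?_⟩
  · exact ((StarSubalgebra.mem_centralizer_iff ℂ).1 W.2 J rfl).1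
  · rw [← hpr _ sh0]; exact w4
  · rw [← hpr _ sh0]; exact w5

theorem expI_two_pi {a : A} (ha : IsSelfAdjoint a)
    (h : ∀ t ∈ spectrum ℝ a, ∃ k : ℤ, t = k) : expI (2 * Real.pi) a = 1 := by
  rw [← cfc_cexp_eq_expI _ ha]
  have : cfc (fun z : ℂ => Complex.exp ((2 * Real.pi : ℝ) * Complex.I * z)) a
      = cfc (fun _ : ℂ => 1) a := by
    refine cfc_congr fun z hz => ?_
    have h1 := ha.mem_spectrum_eq_re hz
    obtain ⟨k, hk⟩ := h z.re ((spectrum.algebraMap_mem_iff ℂ).1 (by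
      rw [Complex.coe_algebraMap, ← h1]; exact hz))
    rw [h1, hk, Complex.exp_eq_one_iff]
    exact ⟨k, by push_cast; ring⟩
  rw [this, cfc_const_one ℂ a]

theorem expI_two_pi_floor (h : A) :
    expI (2 * Real.pi) (fc (fun t => (⌊t⌋ : ℝ)) h) = 1 := by
  refine expI_two_pi (fc_isSelfAdjoint _ _) fun t ht => ?_
  by_cases hh : IsSelfAdjoint h
  · rw [fc, cfc_map_spectrum _ h hh (fcont _ h)] at ht
    obtain ⟨x, _, rfl⟩ := ht
    exact ⟨⌊x⌋, rfl⟩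
  · rw [fc, cfc_apply_of_not_predicate h hh] at ht
    obtain _ | _ := subsingleton_or_nontrivial A
    · simp at ht
    · rw [spectrum.zero_eq, Set.mem_singleton_iff] at ht
      exact ⟨0, by rw [ht]; simp⟩

theorem expI_two_pi_idempotent {W : A} (hW : IsSelfAdjoint W) (hi : W * W = W) :
    expI (2 * Real.pi) W = 1 := by
  refine expI_two_pi hW fun t ht => ?_
  rcases IsIdempotentElem.spectrum_subset ℝ hi ht with h | h
  · exact ⟨0, by rw [h]; simp⟩
  · exact ⟨1, by rw [Set.mem_singleton_iff.1 h]; simp⟩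

theorem expI_add_elem (s : ℝ) {x y : A} (h : x * y = y * x) :
    expI s (x + y) = expI s x * expI s y := by
  let +nondep : NormedAlgebra ℚ A := NormedAlgebra.restrictScalars ℚ ℂ A
  unfold expI
  rw [smul_add, smul_add]
  have hc : Commute x y := h
  exact NormedSpace.exp_add_of_commute
    (((hc.smul_left Complex.I).smul_right Complex.I).smul_left s |>.smul_right s)

theorem continuous_expI (a : A) : Continuous fun s => expI s a :=
  continuous_iff_continuousAt.2 fun s => (hasDerivAt_expI s a).continuousAt

theorem comm_of_expI_comm {H m : A} (h : ∀ s, expI s H * m = m * expI s H) : H * m = m * H := by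
  have h1 := (hasDerivAt_expI 0 H).mul_const m
  have h2 := (hasDerivAt_expI 0 H).const_mul m
  have h3 : (fun s => expI s H * m) = fun s => m * expI s H := funext h
  rw [h3] at h1
  have h4 := h1.unique h2
  rw [expI_zero, one_mul, smul_mul_assoc, mul_smul_comm] at h4
  exact smul_right_injective A Complex.I_ne_zero h4

/-- Averaging over the periodic group generated by an element with integer spectrum. -/
theorem exists_commuting_of_periodic {a H : A} (ha : IsSelfAdjoint a) (hH : IsSelfAdjoint H)
    (hper : expI (2 * Real.pi) H = 1) {c : ℝ} (hc : ‖⁅H, a⁆‖ ≤ c) :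
    ∃ a' : A, IsSelfAdjoint a' ∧ H * a' = a' * H ∧ ‖a' - a‖ ≤ 7 * c := by
  have hc0 : 0 ≤ c := (norm_nonneg _).trans hc
  have hpi := Real.pi_pos
  set f : ℝ → A := fun s => expI s H * a * expI (-s) H with hf
  have fc' : Continuous f :=
    ((continuous_expI H).mul continuous_const).mul ((continuous_expI H).comp continuous_neg)
  have hinv : ∀ s, expI s H * expI (-s) H = 1 := fun s => by
    rw [← expI_add, add_neg_cancel, expI_zero]
  have hinv' : ∀ s, expI (-s) H * expI s H = 1 := fun s => by
    rw [← expI_add, neg_add_cancel, expI_zero]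
  have hconj : ∀ s t, expI s H * f t * expI (-s) H = f (s + t) := fun s t => by
    have e : -(s + t) = -t + -s := by ring
    simp only [hf]
    rw [e, expI_add, expI_add]; noncomm_ring
  have hneg : expI (-(2 * Real.pi)) H = 1 := by
    have := hinv (2 * Real.pi)
    rwa [hper, one_mul] at this
  have fper : Function.Periodic f (2 * Real.pi) := fun s => by
    rw [add_comm, ← hconj, hper, hneg, one_mul, mul_one]
  set m := ∫ s in (0 : ℝ)..(2 * Real.pi), f s with hm
  have hcm : H * m = m * H := by
    refine comm_of_expI_comm fun s => ?_
    have e1 : expI s H * m * expI (-s) H = m := by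
      have := (((ContinuousLinearMap.mul ℂ A).flip (expI (-s) H)).comp
        (ContinuousLinearMap.mul ℂ A (expI s H))).intervalIntegral_comp_comm
          (fc'.intervalIntegrable (μ := MeasureTheory.volume) 0 (2 * Real.pi))
      simp only [ContinuousLinearMap.comp_apply, ContinuousLinearMap.flip_apply,
        ContinuousLinearMap.mul_apply', hconj] at this
      rw [hm, ← this, intervalIntegral.integral_comp_add_left, add_zero,
        fper.intervalIntegral_add_eq s 0, zero_add]
    calc expI s H * m = expI s H * m * expI (-s) H * expI s H := by
          rw [mul_assoc _ _ (expI s H), hinv', mul_one]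
      _ = m * expI s H := by rw [e1]
  have hd : ‖m - (2 * Real.pi) • a‖ ≤ (2 * Real.pi * c) * |2 * Real.pi - 0| := by
    have e1 : m - (2 * Real.pi) • a = ∫ s in (0 : ℝ)..(2 * Real.pi), (f s - a) := by
      rw [intervalIntegral.integral_sub (fc'.intervalIntegrable _ _) (by simp),
        intervalIntegral.integral_const, sub_zero]
    rw [e1]
    refine intervalIntegral.norm_integral_le_of_norm_le_const fun s hs => ?_
    rw [Set.uIoc_of_le (by positivity)] at hs
    have e2 : f s - a = (expI s H * a - a * expI s H) * expI (-s) H := by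
      rw [sub_mul, mul_assoc a, hinv, mul_one]
    rw [e2]
    have h1 := norm_mul_le_of_le (norm_expI_mul_sub_le s a hH hH) (norm_expI_le (-s) hH)
    rw [mul_one] at h1
    refine h1.trans ?_
    rw [abs_of_pos hs.1]
    exact mul_le_mul hs.2 hc (norm_nonneg _) (by positivity)
  set m' := (2 * Real.pi)⁻¹ • m with hm'
  have hcm' : H * m' = m' * H := by rw [hm', mul_smul_comm, smul_mul_assoc, hcm]
  have hd' : ‖m' - a‖ ≤ 7 * c := by
    have e1 : m' - a = (2 * Real.pi)⁻¹ • (m - (2 * Real.pi) • a) := by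
      rw [smul_sub, smul_smul, inv_mul_cancel₀ (by positivity), one_smul]
    rw [e1, norm_smul, Real.norm_of_nonneg (by positivity)]
    rw [sub_zero, abs_of_pos (by positivity)] at hd
    have h2 : (2 * Real.pi)⁻¹ * ‖m - (2 * Real.pi) • a‖ ≤ 2 * Real.pi * c := by
      rw [inv_mul_le_iff₀ (by positivity)]; linarith
    have := Real.pi_lt_d2
    nlinarith
  refine ⟨rePt m', rePt_sa m', comm_rePt hH hcm', ?_⟩
  have e : rePt m' - a = rePt (m' - a) := by
    simp only [rePt, star_sub, ha.star_eq]; module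
  rw [e]; exact norm_rePt_le hd'

theorem norm_le_one_of_idempotent {W : A} (hW : IsSelfAdjoint W) (hi : W * W = W) : ‖W‖ ≤ 1 := by
  have h := norm_mul_star_self' W
  rw [hW.star_eq, hi] at h
  nlinarith [norm_nonneg W]

theorem sylvester_lie_symm {s t : Set ℝ} {α g : ℝ} (hg : 0 < g) (hs : ∀ x ∈ s, α ≤ x)
    (ht : ∀ x ∈ t, x ≤ α - g) {a y : A} (hy : IsSelfAdjoint y) (ha : IsSelfAdjoint a) :
    g * ‖pr t a * y * pr s a‖ ≤ ‖⁅a, y⁆‖ := by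
  have e : pr t a * y * pr s a = star (pr s a * y * pr t a) := by
    simp only [star_mul, star_pr, hy.star_eq, mul_assoc]
  rw [e, norm_star]
  exact sylvester_lie hg hs ht y ha

theorem floor_mul_blk {h : A} (j : ℤ) :
    fc (fun t => (⌊t⌋ : ℝ)) h * blk h j = (j : ℝ) • blk h j := by
  classical
  unfold blk pr
  rw [fc_mul, fc_smul]
  refine fc_congr fun t _ => ?_
  simp only [Set.indicator_apply, Set.mem_Ico]
  split_ifs with hj
  · rw [Int.floor_eq_iff.2 hj]
  · simp

theorem blk_mul_floor {h : A} (j : ℤ) :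
    blk h j * fc (fun t => (⌊t⌋ : ℝ)) h = (j : ℝ) • blk h j := by
  rw [← floor_mul_blk]; exact fc_mul_comm _ _ _

theorem norm_pinch_le (I : Finset ℤ) (h y : A) (k : ℤ) :
    ‖∑ j ∈ I, blk h j * y * blk h (j + k)‖ ≤ ‖y‖ := by
  refine norm_sum_block_le I (norm_nonneg _) _ _ (fun _ => y)
    (fun i _ => blk_isSelfAdjoint h i) (fun i _ => blk_isSelfAdjoint h (i + k))
    (fun i _ => blk_mul_self h _) (fun i _ j _ hij => blk_mul_blk h hij)
    (fun i _ j _ hij => blk_mul_blk h fun e => hij (by omega)) fun i _ => ?_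
  have := norm_mul_le_of_le (norm_mul_le_of_le (norm_pr_le (Set.Ico (i:ℝ) (i + 1)) h) (le_refl ‖y‖))
    (norm_pr_le (Set.Ico ((i + k : ℤ):ℝ) ((i + k : ℤ) + 1)) h)
  simp only [one_mul, mul_one] at this
  exact this

theorem norm_le_card_sq {I : Finset ℤ} {Q : ℤ → A} (h1 : ∑ j ∈ I, Q j = 1) {F : A} {c : ℝ}
    (hF : ∀ j ∈ I, ∀ l ∈ I, ‖Q j * F * Q l‖ ≤ c) : ‖F‖ ≤ (I.card : ℝ) ^ 2 * c := by
  have e : F = ∑ j ∈ I, ∑ l ∈ I, Q j * F * Q l := by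
    simp only [← Finset.mul_sum, h1, mul_one]
    rw [← Finset.sum_mul, h1, one_mul]
  rw [e]
  refine (norm_sum_le_of_le I fun j hj => norm_sum_le_of_le I fun l hl => hF j hj l hl).trans ?_
  simp only [Finset.sum_const, nsmul_eq_mul]
  exact le_of_eq (by ring)

theorem blk_mul_sum_mul_blk {I : Finset ℤ} (h a : A) (k : ℤ) {j : ℤ} (hj : j ∈ I) (l : ℤ) :
    blk h j * (∑ i ∈ I, blk h i * a * blk h (i + k)) * blk h l
      = if j + k = l then blk h j * a * blk h l else 0 := by
  rw [Finset.mul_sum, Finset.sum_mul, Finset.sum_eq_single j]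
  · rw [← mul_assoc, ← mul_assoc, blk_mul_self]
    split_ifs with hl
    · rw [hl, mul_assoc, blk_mul_self]
    · rw [mul_assoc, blk_mul_blk h hl, mul_zero]
  · intro i _ hi
    rw [← mul_assoc, ← mul_assoc, blk_mul_blk h (Ne.symm hi)]; simp only [zero_mul]
  · exact fun h' => absurd hj h'

theorem norm_sub_tridiagonal_le {a h : A} {κ : ℝ} {M : ℕ} (ha : IsSelfAdjoint a)
    (hh : IsSelfAdjoint h) (hM : ‖h‖ < M) (hκ : ‖⁅h, a⁆‖ ≤ κ) {D G : A}
    (hD : D = ∑ j ∈ Finset.Icc (-(M : ℤ)) (M - 1), blk h j * a * blk h (j + 0))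
    (hG : G = ∑ j ∈ Finset.Icc (-(M : ℤ)) (M - 1), blk h j * a * blk h (j + 1)) :
    ‖a - D - G - star G‖ ≤ 4 * (M : ℝ) ^ 2 * κ := by
  have hκ0 : 0 ≤ κ := (norm_nonneg _).trans hκ
  refine (norm_le_card_sq (sum_blk hh hM) (F := a - D - G - star G) (c := κ) ?_).trans ?_
  · intro j hj l hl
    have e1 := blk_mul_sum_mul_blk h a 0 hj l
    have e2 := blk_mul_sum_mul_blk h a 1 hj l
    have e3 := congrArg star (blk_mul_sum_mul_blk h a 1 hl j)
    rw [← hD] at e1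
    rw [← hG] at e2 e3
    have e4 : blk h j * star G * blk h l = if l + 1 = j then blk h j * a * blk h l else 0 := by
      rw [apply_ite star, star_zero] at e3
      simpa only [star_mul, (blk_isSelfAdjoint h _).star_eq, ha.star_eq, mul_assoc] using e3
    have e5 : blk h j * (a - D - G - star G) * blk h l
        = blk h j * a * blk h l - (if j + 0 = l then blk h j * a * blk h l else 0)
          - (if j + 1 = l then blk h j * a * blk h l else 0)
          - (if l + 1 = j then blk h j * a * blk h l else 0) := by
      rw [← e1, ← e2, ← e4]; noncomm_ring
    rw [e5]
    have key : j + 2 ≤ l ∨ l + 2 ≤ j → ‖blk h j * a * blk h l‖ ≤ κ := by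
      rintro (hc | hc)
      · have hc' : (j : ℝ) + 2 ≤ l := by exact_mod_cast hc
        have := sylvester_lie_symm (s := Set.Ico (l : ℝ) (l + 1)) (t := Set.Ico (j : ℝ) (j + 1))
          (α := l) one_pos (fun x hx => hx.1) (fun x hx => by linarith [hx.2]) ha hh
        rw [one_mul] at this
        exact this.trans hκ
      · have hc' : (l : ℝ) + 2 ≤ j := by exact_mod_cast hc
        have := sylvester_lie (s := Set.Ico (j : ℝ) (j + 1)) (t := Set.Ico (l : ℝ) (l + 1))
          (α := j) one_pos (fun x hx => hx.1) (fun x hx => by linarith [hx.2]) a hh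
        rw [one_mul] at this
        exact this.trans hκ
    by_cases c1 : j + 0 = l
    · rw [if_pos c1, if_neg (by omega), if_neg (by omega)]; simpa using hκ0
    · by_cases c2 : j + 1 = l
      · rw [if_neg c1, if_pos c2, if_neg (by omega)]; simpa using hκ0
      · by_cases c3 : l + 1 = j
        · rw [if_neg c1, if_neg c2, if_pos c3]; simpa using hκ0
        · rw [if_neg c1, if_neg c2, if_neg c3, sub_zero, sub_zero, sub_zero]
          exact key (by omega)
  · rw [Int.card_Icc]
    have : ((((M : ℤ) - 1 + 1 - -(M : ℤ)).toNat : ℕ) : ℝ) = 2 * M := by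
      have : ((M : ℤ) - 1 + 1 - -(M : ℤ)).toNat = 2 * M := by omega
      rw [this]; push_cast; ring
    rw [this]
    exact le_of_eq (by ring)

theorem norm_lie_pinch_le {a h : A} {κ : ℝ} (hh : IsSelfAdjoint h) {I : Finset ℤ}
    (hκ : ‖⁅h, a⁆‖ ≤ κ) :
    ‖⁅fc (fun t => t - ⌊t⌋ - 1/2) h, ∑ j ∈ I, blk h j * a * blk h (j + 0)⁆‖ ≤ κ := by
  set J := fc (fun t => (⌊t⌋ : ℝ)) h with hJ
  have e0 : fc (fun t => t - ⌊t⌋ - 1/2) h = h - J - ((1/2 : ℝ)) • 1 := by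
    rw [hJ, ← fc_const _ hh, ← fc_sub, ← fc_sub, fc_id hh]
  have e1 : ⁅fc (fun t => t - ⌊t⌋ - 1/2) h, ∑ j ∈ I, blk h j * a * blk h (j + 0)⁆
      = ∑ j ∈ I, blk h j * ⁅h, a⁆ * blk h (j + 0) := by
    rw [bra_sum]
    refine Finset.sum_congr rfl fun j _ => ?_
    rw [e0, add_zero, Ring.lie_def, Ring.lie_def]
    have c1 : h * blk h j = blk h j * h := self_mul_fc _ hh
    have c2 : J * blk h j = (j : ℝ) • blk h j := floor_mul_blk j
    have c3 : blk h j * J = (j : ℝ) • blk h j := blk_mul_floor j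
    have d1 : h * (blk h j * a * blk h j) = blk h j * (h * a) * blk h j := by
      rw [← mul_assoc, ← mul_assoc, c1]; simp only [mul_assoc]
    have d2 : blk h j * a * blk h j * h = blk h j * (a * h) * blk h j := by
      rw [mul_assoc, ← c1]; simp only [mul_assoc]
    have d3 : J * (blk h j * a * blk h j) = blk h j * a * blk h j * J := by
      rw [← mul_assoc, ← mul_assoc, c2, mul_assoc _ _ J, c3, mul_smul_comm, smul_mul_assoc,
        smul_mul_assoc]
    simp only [sub_mul, mul_sub, d1, d2, d3, smul_mul_assoc, mul_smul_comm, one_mul, mul_one]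
    abel
  rw [e1]
  exact (norm_pinch_le I h _ 0).trans hκ

theorem pr_fract_eq {h : A} (hh : IsSelfAdjoint h) (s : Set ℝ) :
    pr s (fc (fun t => t - ⌊t⌋ - 1/2) h) = pr {t | t - ⌊t⌋ - 1/2 ∈ s} h := by
  unfold pr
  rw [fc_comp _ _ hh]
  rfl

theorem norm_upper_row_le {a h : A} {κ : ℝ} (ha : IsSelfAdjoint a) (hh : IsSelfAdjoint h)
    (I : Finset ℤ) (hκ : ‖⁅h, a⁆‖ ≤ κ) :
    ‖(1 - pr (Set.Ici (3/8)) (fc (fun t => t - ⌊t⌋ - 1/2) h))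
      * ∑ j ∈ I, blk h j * a * blk h (j + 1)‖ ≤ 8 * κ := by
  have hκ0 : 0 ≤ κ := (norm_nonneg _).trans hκ
  rw [← pr_compl _ (fc_isSelfAdjoint _ _), pr_fract_eq hh]
  set P := pr {t : ℝ | t - ⌊t⌋ - 1/2 ∈ (Set.Ici (3/8) : Set ℝ)ᶜ} h with hP
  have e : P * ∑ j ∈ I, blk h j * a * blk h (j + 1)
      = ∑ j ∈ I, blk h j * (P * a) * blk h (j + 1) := by
    rw [Finset.mul_sum]
    refine Finset.sum_congr rfl fun j _ => ?_
    have c : P * blk h j = blk h j * P := fc_mul_comm _ _ _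
    rw [← mul_assoc, ← mul_assoc, ← mul_assoc, c]
  rw [e]
  refine norm_sum_block_le I (by linarith) _ _ (fun _ => P * a)
    (fun i _ => blk_isSelfAdjoint h i) (fun i _ => blk_isSelfAdjoint h (i + 1))
    (fun i _ => blk_mul_self h _) (fun i _ j _ hij => blk_mul_blk h hij)
    (fun i _ j _ hij => blk_mul_blk h fun e => hij (by omega)) fun j _ => ?_
  have e1 : blk h j * (P * a) * blk h (j + 1)
      = pr (Set.Ico (j : ℝ) (j + 1) ∩ {t : ℝ | t - ⌊t⌋ - 1/2 ∈ (Set.Ici (3/8) : Set ℝ)ᶜ}) h * a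
        * pr (Set.Ico ((j + 1 : ℤ) : ℝ) ((j + 1 : ℤ) + 1)) h := by
    rw [← pr_mul_pr, ← mul_assoc]; rfl
  rw [e1]
  have := sylvester_lie_symm (s := Set.Ico ((j + 1 : ℤ) : ℝ) ((j + 1 : ℤ) + 1))
    (t := Set.Ico (j : ℝ) (j + 1) ∩ {t : ℝ | t - ⌊t⌋ - 1/2 ∈ (Set.Ici (3/8) : Set ℝ)ᶜ})
    (α := (j + 1 : ℤ)) (g := 1/8) (by norm_num) (fun x hx => hx.1) (fun x hx => by
      have h1 := Int.floor_eq_iff.2 hx.1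
      have h2 : ¬ (3/8 ≤ x - ⌊x⌋ - 1/2) := hx.2
      rw [h1] at h2
      push_cast
      linarith) ha hh
  linarith

theorem norm_upper_col_le {a h : A} {κ : ℝ} (ha : IsSelfAdjoint a) (hh : IsSelfAdjoint h)
    (I : Finset ℤ) (hκ : ‖⁅h, a⁆‖ ≤ κ) :
    ‖(∑ j ∈ I, blk h j * a * blk h (j + 1))
      * (1 - pr (Set.Iic (-(3/8))) (fc (fun t => t - ⌊t⌋ - 1/2) h))‖ ≤ 8 * κ := by
  have hκ0 : 0 ≤ κ := (norm_nonneg _).trans hκ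
  rw [← pr_compl _ (fc_isSelfAdjoint _ _), pr_fract_eq hh]
  set P := pr {t : ℝ | t - ⌊t⌋ - 1/2 ∈ (Set.Iic (-(3/8)) : Set ℝ)ᶜ} h with hP
  have e : (∑ j ∈ I, blk h j * a * blk h (j + 1)) * P
      = ∑ j ∈ I, blk h j * (a * P) * blk h (j + 1) := by
    rw [Finset.sum_mul]
    refine Finset.sum_congr rfl fun j _ => ?_
    have c : P * blk h (j + 1) = blk h (j + 1) * P := fc_mul_comm _ _ _
    simp only [mul_assoc, c]
  rw [e]
  refine norm_sum_block_le I (by linarith) _ _ (fun _ => a * P)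
    (fun i _ => blk_isSelfAdjoint h i) (fun i _ => blk_isSelfAdjoint h (i + 1))
    (fun i _ => blk_mul_self h _) (fun i _ j _ hij => blk_mul_blk h hij)
    (fun i _ j _ hij => blk_mul_blk h fun e => hij (by omega)) fun j _ => ?_
  have e1 : blk h j * (a * P) * blk h (j + 1)
      = pr (Set.Ico (j : ℝ) (j + 1)) h * a
        * pr ({t : ℝ | t - ⌊t⌋ - 1/2 ∈ (Set.Iic (-(3/8)) : Set ℝ)ᶜ}
          ∩ Set.Ico ((j + 1 : ℤ) : ℝ) ((j + 1 : ℤ) + 1)) h := by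
    rw [← pr_mul_pr]; simp only [← mul_assoc]; rfl
  rw [e1]
  have := sylvester_lie_symm (s := {t : ℝ | t - ⌊t⌋ - 1/2 ∈ (Set.Iic (-(3/8)) : Set ℝ)ᶜ}
          ∩ Set.Ico ((j + 1 : ℤ) : ℝ) ((j + 1 : ℤ) + 1))
    (t := Set.Ico (j : ℝ) (j + 1))
    (α := (j + 1 + 1/8 : ℝ)) (g := 1/8) (by norm_num) (fun x hx => by
      have h1 := Int.floor_eq_iff.2 hx.2
      have h2 : ¬ (x - ⌊x⌋ - 1/2 ≤ -(3/8)) := hx.1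
      rw [h1] at h2
      push_cast at h2
      linarith) (fun x hx => by linarith [hx.2]) ha hh
  linarith

/-- Almost commuting self-adjoint elements of norm at most `N`, with commutator small compared
to `N⁻⁴`, lie within an absolute constant of commuting self-adjoint elements. -/
theorem exists_commuting_of_cut {C : ℝ} (h1C : 1 ≤ C) (hC : Cut C) {a h : A} {N κ : ℝ}
    (ha : IsSelfAdjoint a) (hh : IsSelfAdjoint h) (hN : 1 ≤ N) (hna : ‖a‖ ≤ N) (hnh : ‖h‖ ≤ N)
    (hκ : ‖⁅h, a⁆‖ ≤ κ) (hs : C * N ^ 4 * κ ≤ 1) :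
    ∃ a' h' : A, IsSelfAdjoint a' ∧ IsSelfAdjoint h' ∧ h' * a' = a' * h' ∧
      ‖a' - a‖ ≤ 1785 ∧ ‖h' - h‖ ≤ 1785 := by
  have hκ0 : 0 ≤ κ := (norm_nonneg _).trans hκ
  set M : ℕ := ⌈N⌉₊ + 1 with hMdef
  have hM1 : (M : ℝ) ≤ 3 * N := by
    have := Nat.ceil_lt_add_one (show 0 ≤ N by linarith)
    rw [hMdef]; push_cast; linarith
  have hM : ‖h‖ < M := by
    have := Nat.le_ceil N
    rw [hMdef]; push_cast; linarith
  set I : Finset ℤ := Finset.Icc (-(M : ℤ)) (M - 1) with hI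
  set J := fc (fun t => (⌊t⌋ : ℝ)) h with hJ
  set k := fc (fun t => t - ⌊t⌋ - 1/2) h with hk
  set D := ∑ j ∈ I, blk h j * a * blk h (j + 0) with hD
  set G := ∑ j ∈ I, blk h j * a * blk h (j + 1) with hG
  have sJ : IsSelfAdjoint J := fc_isSelfAdjoint _ _
  have sk : IsSelfAdjoint k := fc_isSelfAdjoint _ _
  have sD : IsSelfAdjoint D := by
    rw [IsSelfAdjoint, hD, star_sum]
    refine Finset.sum_congr rfl fun j _ => ?_
    rw [add_zero]
    simp only [star_mul, (blk_isSelfAdjoint h _).star_eq, ha.star_eq, mul_assoc]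
  have nD : ‖D‖ ≤ N := (norm_pinch_le I h a 0).trans hna
  have nG : ‖G‖ ≤ N := (norm_pinch_le I h a 1).trans hna
  have nk : ‖k‖ ≤ 1/2 := norm_fc_le' fun t => by
    rw [abs_le]; constructor <;> linarith [Int.floor_le t, Int.lt_floor_add_one t]
  have hJD : J * D = D * J := by
    rw [hD, Finset.mul_sum, Finset.sum_mul]
    refine Finset.sum_congr rfl fun j _ => ?_
    rw [add_zero, mul_assoc _ _ J, blk_mul_floor, ← mul_assoc, ← mul_assoc, floor_mul_blk,
      mul_smul_comm, smul_mul_assoc, smul_mul_assoc]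
  have hJk : J * k = k * J := fc_mul_comm _ _ _
  obtain ⟨W, w1, w2, w3, w4, w5, w6⟩ := hC.relative sD sk sJ hJD hJk hN nD nk
    (norm_lie_pinch_le hh hκ) hs
  have hWn := norm_le_one_of_idempotent w1 w2
  have hWi : (1 - W) * (1 - W) = 1 - W := by
    rw [mul_sub, sub_mul, sub_mul, w2]; simp
  have sW' : IsSelfAdjoint (1 - W) := (IsSelfAdjoint.one A).sub w1
  have hWn' := norm_le_one_of_idempotent sW' hWi
  have hN3 : 1 ≤ N ^ 3 := one_le_pow₀ hN
  have hN4 : 1 ≤ N ^ 4 := one_le_pow₀ hN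
  have hκ1 : κ ≤ 1 := by
    have : κ ≤ C * N ^ 4 * κ := le_mul_of_one_le_left hκ0 (one_le_mul_of_one_le_of_one_le h1C hN4)
    linarith
  have hCN : C * N ^ 3 * κ * N ≤ 1 := by linarith [show C * N ^ 3 * κ * N = C * N ^ 4 * κ by ring]
  have hNκ : N ^ 3 * κ ≤ 1 := by
    have h2 : N ^ 3 * κ ≤ N ^ 3 * κ * (C * N) :=
      le_mul_of_one_le_right (by positivity) (one_le_mul_of_one_le_of_one_le h1C hN)
    linarith [show N ^ 3 * κ * (C * N) = C * N ^ 4 * κ by ring]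
  have r1 : ‖(1 - W) * G‖ ≤ 9 := by
    set Z := pr (Set.Ici (3/8)) k
    have e : (1 - W) * G = (1 - W) * Z * G + (1 - W) * ((1 - Z) * G) := by noncomm_ring
    rw [e]
    have u1 := norm_mul_le_of_le w5 nG
    have u2 := norm_mul_le_of_le hWn' (norm_upper_row_le ha hh I hκ)
    refine (norm_add_le _ _).trans ?_
    linarith
  have r2 : ‖G * W‖ ≤ 9 := by
    set Z := pr (Set.Iic (-(3/8))) k
    have e : G * W = G * (Z * W) + G * (1 - Z) * W := by noncomm_ring
    have w6' : ‖Z * W‖ ≤ C * N ^ 3 * κ := by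
      rw [← norm_star, star_mul, star_pr, w1.star_eq]; exact w6
    rw [e]
    have u1 := norm_mul_le_of_le nG w6'
    have u2 := norm_mul_le_of_le (norm_upper_col_le ha hh I hκ) hWn
    refine (norm_add_le _ _).trans ?_
    linarith
  have hGJ : G * J - J * G = G := by
    rw [hG, Finset.mul_sum, Finset.sum_mul, ← Finset.sum_sub_distrib]
    refine Finset.sum_congr rfl fun j _ => ?_
    rw [mul_assoc _ _ J, blk_mul_floor, ← mul_assoc, ← mul_assoc, floor_mul_blk,
      mul_smul_comm, smul_mul_assoc, smul_mul_assoc, ← sub_smul]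
    push_cast
    rw [add_sub_cancel_left, one_smul]
  have sH : IsSelfAdjoint (J + W) := sJ.add w1
  have lG : ‖⁅G, J + W⁆‖ ≤ 18 := by
    have e : ⁅G, J + W⁆ = (1 - W) * G + G * W := by
      rw [Ring.lie_def]
      calc G * (J + W) - (J + W) * G = (G * J - J * G) + G * W - W * G := by noncomm_ring
        _ = _ := by rw [hGJ]; noncomm_ring
    rw [e]
    refine (norm_add_le _ _).trans ?_
    linarith
  have lG' : ‖⁅star G, J + W⁆‖ ≤ 18 := by rw [norm_lie_star_left G sH]; exact lG
  have lD : ‖⁅D, J + W⁆‖ ≤ 3 := by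
    rw [bra_add, Ring.lie_def D J, hJD, sub_self, zero_add]; exact w4
  have nJh : ‖h - J‖ ≤ 1 := by
    have e : h - J = fc (fun t => t - ⌊t⌋) h := by rw [hJ, ← fc_sub, fc_id hh]
    rw [e]
    exact norm_fc_le' fun t => by
      rw [abs_le]; constructor <;> linarith [Int.floor_le t, Int.lt_floor_add_one t]
  have nh : ‖J + W - h‖ ≤ 2 := by
    have e : J + W - h = W - (h - J) := by abel
    rw [e]
    refine (norm_sub_le _ _).trans ?_
    linarith
  have nH : ‖J + W‖ ≤ 3 * N := by
    have e : J + W = (J + W - h) + h := by abel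
    rw [e]
    refine (norm_add_le _ _).trans ?_
    linarith
  set F := a - D - G - star G with hF
  have nF : ‖F‖ ≤ 36 * N ^ 2 * κ := by
    refine (norm_sub_tridiagonal_le ha hh hM hκ hD hG).trans ?_
    have : (M : ℝ) ^ 2 ≤ (3 * N) ^ 2 := pow_le_pow_left₀ (Nat.cast_nonneg _) hM1 2
    nlinarith
  have lF : ‖⁅F, J + W⁆‖ ≤ 216 := by
    refine (norm_lie_le _ _).trans ?_
    calc 2 * ‖F‖ * ‖J + W‖ ≤ 2 * (36 * N ^ 2 * κ) * (3 * N) := by gcongr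
      _ = 216 * (N ^ 3 * κ) := by ring
      _ ≤ 216 := by linarith
  have hc : ‖⁅J + W, a⁆‖ ≤ 255 := by
    have e : a = F + D + G + star G := by rw [hF]; abel
    rw [norm_lie_swap, e, add_bra, add_bra, add_bra]
    refine (norm_add_le _ _).trans ?_
    have t1 := norm_add_le (⁅F, J + W⁆ + ⁅D, J + W⁆) ⁅G, J + W⁆
    have t2 := norm_add_le ⁅F, J + W⁆ ⁅D, J + W⁆
    linarith
  have hper : expI (2 * Real.pi) (J + W) = 1 := by
    rw [expI_add_elem _ w3, hJ, expI_two_pi_floor, expI_two_pi_idempotent w1 w2, one_mul]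
  obtain ⟨a', s', c', n'⟩ := exists_commuting_of_periodic ha sH hper hc
  exact ⟨a', J + W, s', sH, c', by linarith, by linarith⟩

theorem pr_singleton_ne_zero {T : A} (hT : IsSelfAdjoint T) {t : ℝ} (ht : t ∈ spectrum ℝ T) :
    pr {t} T ≠ 0 := by
  intro h0
  have h1 : (1 : ℝ) ∈ spectrum ℝ (pr {t} T) := by
    rw [pr, fc, cfc_map_spectrum _ T hT (fcont _ T)]
    exact ⟨t, ht, by simp⟩
  have := abs_le_norm_of_mem h1
  rw [h0] at this
  simp at this
  linarith

theorem self_mul_pr_singleton {T : A} (hT : IsSelfAdjoint T) (t : ℝ) :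
    T * pr {t} T = t • pr {t} T := by
  classical
  conv_lhs => enter [1]; rw [← fc_id hT]
  unfold pr
  rw [fc_mul, fc_smul]
  refine fc_congr fun s _ => ?_
  simp only [Set.indicator_apply, Set.mem_singleton_iff]
  split_ifs with h <;> simp [h]

theorem norm_le_two_mul_of_quarter {X Z : A} (h : star X * X - (1/4 : ℂ) • 1 = star Z * Z) (z : A) :
    ‖z‖ ≤ 2 * ‖X * z‖ := by
  have e : star (X * z) * (X * z)
      = star ((1/2 : ℂ) • z) * ((1/2 : ℂ) • z) + star (Z * z) * (Z * z) := by
    have : star X * X = (1/4 : ℂ) • 1 + star Z * Z := by rw [← h]; abel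
    rw [star_mul, star_mul, mul_assoc, ← mul_assoc (star X), this, star_smul, smul_mul_smul_comm]
    have h4 : star (1/2 : ℂ) * (1/2) = 1/4 := by
      simp only [star_div₀, star_one, star_ofNat]; norm_num
    rw [h4, add_mul, mul_add, smul_mul_assoc, one_mul, mul_smul_comm]
    simp only [mul_assoc]
  have := norm_star_mul_self_le_add ((1/2 : ℂ) • z) (Z * z)
  rw [← e, norm_mul_star_self', norm_mul_star_self', norm_smul] at this
  have h2 := abs_le_of_sq_le_sq' this (norm_nonneg _)
  have h3 := h2.2
  norm_num at h3
  linarith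

theorem exists_normal_annulus {X₀ : A} (hn : star X₀ * X₀ = X₀ * star X₀) {τ : ℝ} (h0 : 0 ≤ τ)
    (h4 : τ ≤ 1/4) (hup : ‖X₀‖ ≤ 1 + τ) (hlow : ∀ z, (1/2 - τ) * ‖z‖ ≤ ‖X₀ * z‖) :
    ∃ Y Z : A, star Y * Y = Y * star Y ∧ ‖Y‖ ≤ 1 ∧ star Y * Y - (1/4 : ℂ) • 1 = star Z * Z ∧
      ‖X₀ - Y‖ ≤ τ := by
  set T := star X₀ * X₀ with hT
  have sT : IsSelfAdjoint T := IsSelfAdjoint.star_mul_self X₀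
  have hspec : ∀ t ∈ spectrum ℝ T, 0 ≤ t ∧ 1/2 - τ ≤ √t ∧ √t ≤ 1 + τ := by
    intro t ht
    have hP := norm_pos_iff.2 (pr_singleton_ne_zero sT ht)
    set P := pr {t} T with hPdef
    have e : star (X₀ * P) * (X₀ * P) = t • P := by
      rw [star_mul, mul_assoc, ← mul_assoc (star X₀), ← hT, self_mul_pr_singleton sT, mul_smul_comm,
        hPdef, star_pr, pr_mul_self]
    have e2 : t • P = t • (star P * P) := by rw [hPdef, star_pr, pr_mul_self]
    have e3 := congrArg norm e
    rw [e2, norm_mul_star_self', norm_smul, norm_mul_star_self', Real.norm_eq_abs] at e3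
    have l1 := hlow P
    have l2 : ((1/2 - τ) * ‖P‖) ^ 2 ≤ |t| * ‖P‖ ^ 2 := by
      rw [← e3]; exact pow_le_pow_left₀ (mul_nonneg (by linarith) hP.le) l1 2
    have l3 : (1/2 - τ) ^ 2 ≤ |t| := by
      rw [mul_pow] at l2
      exact le_of_mul_le_mul_right l2 (by positivity)
    have hpos : 0 ≤ t :=
    spectrum_star_mul_self_nonneg (b := X₀) t ht
    rw [abs_of_nonneg hpos] at l3
    refine ⟨hpos, Real.le_sqrt_of_sq_le l3, Real.sqrt_le_iff.2 ⟨by linarith, ?_⟩⟩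
    have l4 := abs_le_norm_of_mem ht
    rw [hT, norm_mul_star_self', abs_of_nonneg hpos] at l4
    exact l4.trans (pow_le_pow_left₀ (norm_nonneg _) hup 2)
  have hTX : T * X₀ = X₀ * T := by
    conv_lhs => rw [hn, mul_assoc]
  set cl : ℝ → ℝ := fun s => max (1/2) (min s 1) with hcl
  set φ : ℝ → ℝ := fun t => cl √t / √t with hφ
  have cφ : fc φ T * X₀ = X₀ * fc φ T := fc_comm φ sT hTX
  have cφ' : fc φ T * star X₀ = star X₀ * fc φ T := comm_star (fc_isSelfAdjoint _ _) cφ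
  have sφ := (fc_isSelfAdjoint φ T).star_eq
  have cl1 : ∀ s, 1/2 ≤ cl s := fun s => le_max_left _ _
  have cl2 : ∀ s, cl s ≤ 1 := fun s => max_le (by norm_num) (min_le_right _ _)
  have hYY : star (X₀ * fc φ T) * (X₀ * fc φ T) = fc (fun t => cl √t ^ 2) T := by
    rw [star_mul, sφ, mul_assoc, ← mul_assoc (star X₀), ← hT, ← mul_assoc, fc_mul_self_mul_fc _ _ sT]
    refine fc_congr fun t ht => ?_
    obtain ⟨p1, p2, _⟩ := hspec t ht
    have p3 : 0 < √t := by linarith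
    simp only [hφ]
    have := Real.sq_sqrt p1
    field_simp
    rw [this]
  refine ⟨X₀ * fc φ T, fc (fun t => √(cl √t ^ 2 - 1/4)) T, ?_, ?_, ?_, ?_⟩
  · calc star (X₀ * fc φ T) * (X₀ * fc φ T) = fc φ T * (star X₀ * X₀) * fc φ T := by
          rw [star_mul, sφ]; simp only [mul_assoc]
      _ = fc φ T * X₀ * (star X₀ * fc φ T) := by rw [← hT, hn]; simp only [mul_assoc]
      _ = _ := by rw [cφ, ← cφ', star_mul, sφ]
  · have h1 : ‖X₀ * fc φ T‖ ^ 2 ≤ 1 := by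
      rw [← norm_mul_star_self', hYY]
      refine norm_fc_le' fun t => ?_
      rw [abs_of_nonneg (sq_nonneg _)]
      exact pow_le_one₀ (by linarith [cl1 √t]) (cl2 _)
    exact (sq_le_one_iff₀ (norm_nonneg _)).1 h1
  · rw [hYY, (fc_isSelfAdjoint _ T).star_eq, fc_mul]
    have : (1/4 : ℂ) • (1 : A) = ((1/4 : ℝ)) • (1 : A) := by
      rw [← Complex.coe_smul]; norm_num
    rw [this, ← fc_const _ sT, fc_sub]
    refine fc_congr fun t _ => ?_
    rw [Real.mul_self_sqrt]
    nlinarith [cl1 √t]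
  · have e : X₀ - X₀ * fc φ T = X₀ * fc (fun t => 1 - φ t) T := by
      rw [← one_sub_fc _ sT]; noncomm_ring
    have h1 : ‖X₀ - X₀ * fc φ T‖ ^ 2 ≤ τ ^ 2 := by
      rw [e, ← norm_mul_star_self', star_mul, star_fc, mul_assoc, ← mul_assoc (star X₀), ← hT,
        ← mul_assoc, fc_mul_self_mul_fc _ _ sT]
      refine norm_fc_le (sq_nonneg _) fun t ht => ?_
      obtain ⟨p1, p2, p4⟩ := hspec t ht
      have p3 : 0 < √t := by linarith
      have e2 : (1 - φ t) * t * (1 - φ t) = (√t - cl √t) ^ 2 := by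
        simp only [hφ]
        have := Real.sq_sqrt p1
        field_simp
        rw [this, mul_comm]
      rw [e2, abs_of_nonneg (sq_nonneg _)]
      refine sq_le_sq.2 ?_
      rw [abs_of_nonneg h0, abs_le]
      simp only [hcl]
      rcases max_cases (1/2) (min √t 1) with ⟨m1, m2⟩ | ⟨m1, m2⟩ <;>
        rcases min_cases √t 1 with ⟨m3, m4⟩ | ⟨m3, m4⟩ <;> constructor <;> linarith
    exact abs_le_of_sq_le_sq h1 h0 |>.trans' (le_abs_self _)

theorem exists_normal_near_annulus {C : ℝ} (h1C : 1 ≤ C) (hC : Cut C) {δ : ℝ} (hδ : 0 < δ) {X Z : A}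
    (hX : ‖X‖ ≤ 1) (hZ : star X * X - (1/4 : ℂ) • 1 = star Z * Z) (hc : ‖⁅star X, X⁆‖ ≤ δ) :
    ∃ Y Z : A, star Y * Y = Y * star Y ∧ ‖Y‖ ≤ 1 ∧ star Y * Y - (1/4 : ℂ) • 1 = star Z * Z ∧
      ‖X - Y‖ ≤ 28560 * C * δ ^ ((1 : ℝ) / 6) := by
  set L := C * δ ^ ((1 : ℝ) / 6) with hL
  have hL0 : 0 < L := by positivity
  have hL6 : L ^ 6 = C ^ 6 * δ := by
    rw [hL, mul_pow, ← Real.rpow_natCast (δ ^ ((1 : ℝ) / 6)), ← Real.rpow_mul hδ.le]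
    norm_num
  set τ := 3570 * L with hτ
  have hε : 28560 * C * δ ^ ((1 : ℝ) / 6) = 8 * τ := by rw [hτ, hL]; ring
  rw [hε]
  rcases lt_or_ge (1/4) τ with hbig | hsmall
  · refine ⟨1, ((√(3/4) : ℝ) : ℂ) • 1, by simp, norm_one_le, ?_, ?_⟩
    · rw [star_smul, smul_mul_smul_comm, star_one, mul_one, Complex.star_def,
        Complex.conj_ofReal, ← Complex.ofReal_mul, Real.mul_self_sqrt (by norm_num)]
      have : (1 : A) - (1/4 : ℂ) • 1 = (1 - 1/4 : ℂ) • 1 := by rw [sub_smul, one_smul]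
      rw [this]
      norm_num
    · refine (norm_sub_le _ _).trans ?_
      linarith [norm_one_le (A := A)]
  · have hL1 : L ≤ 1 := by linarith
    set a := L⁻¹ • imPt X with ha
    set h := L⁻¹ • rePt X with hh
    have sa : IsSelfAdjoint a := (IsSelfAdjoint.all L⁻¹).smul (imPt_sa X)
    have sh : IsSelfAdjoint h := (IsSelfAdjoint.all L⁻¹).smul (rePt_sa X)
    have na : ‖a‖ ≤ L⁻¹ := by
      rw [ha, norm_smul, norm_inv, Real.norm_of_nonneg hL0.le]
      exact mul_le_of_le_one_right (by positivity) (norm_imPt_le hX)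
    have nh : ‖h‖ ≤ L⁻¹ := by
      rw [hh, norm_smul, norm_inv, Real.norm_of_nonneg hL0.le]
      exact mul_le_of_le_one_right (by positivity) (norm_rePt_le hX)
    have hri : ‖⁅rePt X, imPt X⁆‖ ≤ δ / 2 := by
      have := lie_star_self_eq (rePt_sa X) (imPt_sa X)
      rw [rePt_add_imPt] at this
      rw [this, norm_smul] at hc
      norm_num at hc
      linarith
    have hk : ‖⁅h, a⁆‖ ≤ L⁻¹ ^ 2 * (δ / 2) := by
      have e : ⁅h, a⁆ = L⁻¹ ^ 2 • ⁅rePt X, imPt X⁆ := by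
        rw [hh, ha, Ring.lie_def, Ring.lie_def, smul_mul_smul_comm, smul_mul_smul_comm, smul_sub, sq]
      rw [e, norm_smul, Real.norm_of_nonneg (by positivity)]
      gcongr
    have hs : C * L⁻¹ ^ 4 * (L⁻¹ ^ 2 * (δ / 2)) ≤ 1 := by
      have e : C * L⁻¹ ^ 4 * (L⁻¹ ^ 2 * (δ / 2)) = C * δ / 2 / L ^ 6 := by
        field_simp
      rw [e, div_le_one (by positivity), hL6]
      have : C ≤ C ^ 6 := le_self_pow₀ h1C (by norm_num)
      nlinarith
    obtain ⟨a', h', sa', sh', hcm, ea, eh⟩ :=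
      exists_commuting_of_cut h1C hC sa sh ((one_le_inv₀ hL0).2 hL1) na nh hk hs
    set X₀ := L • (h' + Complex.I • a') with hX₀
    have hn : star X₀ * X₀ = X₀ * star X₀ := by
      have e := lie_star_self_eq sh' sa'
      rw [Ring.lie_def, Ring.lie_def, hcm, sub_self, smul_zero, sub_eq_zero] at e
      rw [hX₀, star_smul, smul_mul_smul_comm, smul_mul_smul_comm, e]
      simp only [star_trivial]
    have hd : ‖X - X₀‖ ≤ τ := by
      have e : X - X₀ = L • ((h - h') + Complex.I • (a - a')) := by
        have e1 : L • h = rePt X := by rw [hh, smul_inv_smul₀ hL0.ne']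
        have e2 : L • a = imPt X := by rw [ha, smul_inv_smul₀ hL0.ne']
        conv_lhs => rw [← rePt_add_imPt X, ← e1, ← e2]
        rw [hX₀, smul_comm Complex.I L a, ← smul_add, ← smul_sub, smul_sub Complex.I]
        congr 1
        exact add_sub_add_comm _ _ _ _
      rw [e, norm_smul, Real.norm_of_nonneg hL0.le, hτ, mul_comm]
      refine mul_le_mul_of_nonneg_right ?_ hL0.le
      refine (norm_add_le _ _).trans ?_
      rw [norm_smul, Complex.norm_I, one_mul, norm_sub_rev h, norm_sub_rev a]
      linarith
    have hup : ‖X₀‖ ≤ 1 + τ := by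
      have e : X₀ = X - (X - X₀) := by abel
      rw [e]
      exact (norm_sub_le _ _).trans (add_le_add hX hd)
    have hlow : ∀ z, (1/2 - τ) * ‖z‖ ≤ ‖X₀ * z‖ := fun z => by
      have l1 := norm_le_two_mul_of_quarter hZ z
      have l2 : ‖X * z‖ ≤ ‖X₀ * z‖ + τ * ‖z‖ := by
        have e : X * z = X₀ * z + (X - X₀) * z := by noncomm_ring
        rw [e]
        exact (norm_add_le _ _).trans (add_le_add le_rfl (norm_mul_le_of_le hd le_rfl))
      linarith
    obtain ⟨Y, Z', y1, y2, y3, y4⟩ := exists_normal_annulus hn (by positivity) hsmall hup hlow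
    refine ⟨Y, Z', y1, y2, y3, ?_⟩
    have e : X - Y = (X - X₀) + (X₀ - Y) := by abel
    rw [e]
    refine (norm_add_le _ _).trans ?_
    linarith [show 0 ≤ τ by positivity]

end

open scoped MatrixOrder in
theorem exists_eq_star_mul_self {n : ℕ} {M : Matrix (Fin n) (Fin n) ℂ} (h : M.PosSemidef) :
    ∃ Z, M = star Z * Z :=
  CStarAlgebra.nonneg_iff_eq_star_mul_self.1 h.nonneg

open scoped Matrix.Norms.L2Operator in
theorem exists_normal_near_annulus_matrix {C : ℝ} (h1C : 1 ≤ C) (hC : Cut C) {n : ℕ} {δ : ℝ}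
    (hδ : 0 < δ) {X : Matrix (Fin n) (Fin n) ℂ} (hX : opNorm X ≤ 1)
    (hp : (Xᴴ * X - ((1/4 : ℂ) • 1)).PosSemidef) (hc : opNorm (Xᴴ * X - X * Xᴴ) ≤ δ) :
    ∃ Y : Matrix (Fin n) (Fin n) ℂ, Yᴴ * Y = Y * Yᴴ ∧ opNorm Y ≤ 1 ∧
      (Yᴴ * Y - ((1/4 : ℂ) • 1)).PosSemidef ∧ opNorm (X - Y) ≤ 28560 * C * δ ^ ((1 : ℝ) / 6) := by
  obtain ⟨Z, hZ⟩ := exists_eq_star_mul_self hp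
  obtain ⟨Y, Z', y1, y2, y3, y4⟩ :=
    exists_normal_near_annulus (A := Matrix (Fin n) (Fin n) ℂ) h1C hC hδ hX hZ hc
  refine ⟨Y, y1, y2, ?_, y4⟩
  rw [← star_eq_conjTranspose, y3]
  exact posSemidef_conjTranspose_mul_self Z'

end AC

/-- Theorem (`thm:quantitiativeAnnulus`): there is a dimension-independent function `ε`
with `ε(δ) = E(1/δ)·δ^{1/6}` (so `ε(δ)/δ^{1/6−α} → 0` as `δ → 0⁺` for every
`α ∈ (0, 1/6)`) such that any δ-representation of the annulus (a contraction `X` with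
`X*X ≥ (1/4)I` and `‖[X*,X]‖ ≤ δ`) is within `ε(δ)` of an exact representation of the
annulus. -/
theorem annulus_quantitative :
    ∃ ε : ℝ → ℝ,
      (∀ δ > (0 : ℝ), 0 < ε δ) ∧
      (∀ α ∈ Set.Ioo (0 : ℝ) (1/6),
        Filter.Tendsto (fun δ : ℝ => ε δ / δ ^ ((1:ℝ)/6 - α))
          (nhdsWithin 0 (Set.Ioi 0)) (nhds 0)) ∧
      (∀ (n : ℕ), 1 ≤ n → ∀ δ : ℝ, 0 < δ →
        ∀ X : Matrix (Fin n) (Fin n) ℂ,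
          AC.opNorm X ≤ 1 →
          (Xᴴ * X - ((1/4 : ℂ) • 1)).PosSemidef →
          AC.opNorm (Xᴴ * X - X * Xᴴ) ≤ δ →
          ∃ Y : Matrix (Fin n) (Fin n) ℂ,
            Yᴴ * Y = Y * Yᴴ ∧
            AC.opNorm Y ≤ 1 ∧
            (Yᴴ * Y - ((1/4 : ℂ) • 1)).PosSemidef ∧
            AC.opNorm (X - Y) ≤ ε δ) := by
  obtain ⟨C, h1C, hC⟩ := AC.exists_Cut
  refine ⟨fun δ => 28560 * C * δ ^ ((1 : ℝ) / 6), fun δ hδ => by positivity, ?_,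
    fun n _ δ hδ X h1 h2 h3 => AC.exists_normal_near_annulus_matrix h1C hC hδ h1 h2 h3⟩
  intro α hα
  have ht : Filter.Tendsto (fun δ : ℝ => 28560 * C * δ ^ α) (nhdsWithin 0 (Set.Ioi 0)) (nhds 0) := by
    have h := ((Real.continuousAt_rpow_const 0 α (Or.inr hα.1.le)).tendsto.const_mul
      (28560 * C)).mono_left (nhdsWithin_le_nhds (s := Set.Ioi 0))
    rwa [Real.zero_rpow hα.1.ne', mul_zero] at h
  refine ht.congr' ?_
  filter_upwards [self_mem_nhdsWithin] with δ hδ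
  rw [mul_div_assoc, ← Real.rpow_sub hδ]
  congr 2
  ring
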